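/- For every ε > 0 there is a constant K > 0 such that for all integers T ≥ 16, |C(T) − (3/(8π⁴))·T⁴| ≤ K·T³·(log T)^{2/3}·(log log T)^{1+ε}. -/

import Mathlib

/-- The set of Farey fractions of order `T`: rationals `a/b` with
`0 ≤ a < b ≤ T` and `gcd(a,b) = 1`, viewed as a finite set of rationals in `[0,1)`. -/
def farey (T : ℕ) : Finset ℚ :=
  (((Finset.range (T + 1)) ×ˢ (Finset.range (T + 1))).filter
    (fun p => p.1 < p.2 ∧ Nat.gcd p.1 p.2 = 1)).image (fun p => (p.1 : ℚ) / (p.2 : ℚ))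

/-- `F(T)` is the number of Farey fractions of order `T`. -/
def F (T : ℕ) : ℕ := (farey T).card

/-- The Farey fractions of order `T` lying in `[0, 1/2]`. -/
def fareyHalf (T : ℕ) : Finset ℚ := (farey T).filter (fun q => q ≤ 1 / 2)

/-- `C(T) = ∑_{a/b ∈ 𝓕(T) ∩ [0,1/2]} #(𝓕(T) ∩ [1 - a²/b², 1])`, where a Farey fraction
`q = a/b` in lowest terms satisfies `a²/b² = q²`. -/
def C (T : ℕ) : ℕ :=
  ∑ q ∈ fareyHalf T, ((farey T).filter (fun ξ => 1 - q ^ 2 ≤ ξ ∧ ξ ≤ 1)).card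

/-- `G(T) = ∑_{ξ ∈ 𝓕(T), ξ ≤ 1/2} ξ²`. -/
noncomputable def G (T : ℕ) : ℝ := ∑ q ∈ fareyHalf T, (q : ℝ) ^ 2

/-- The Mertens function `M(n) = ∑_{1 ≤ k ≤ n} μ(k)`. -/
def mertens (n : ℕ) : ℤ := ∑ k ∈ Finset.Icc 1 n, ArithmeticFunction.moebius k

namespace VK

open Finset

/-- Equal power sums force every `X i` to be a root of `∏ (t - Y l)`. -/
lemma newton_core {R : Type*} [CommRing R] (k : ℕ)
    (hk : ∀ j : ℕ, 1 ≤ j → j ≤ k → IsUnit (j : R)) (X Y : Fin k → R)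
    (h : ∀ j : ℕ, 1 ≤ j → j ≤ k → ∑ i, X i ^ j = ∑ i, Y i ^ j) (i : Fin k) :
    ∏ l, (X i - Y l) = 0 := by
  have hes : ∀ j : ℕ, j ≤ k → MvPolynomial.aeval X (MvPolynomial.esymm (Fin k) R j)
      = MvPolynomial.aeval Y (MvPolynomial.esymm (Fin k) R j) := by
    intro j
    induction j using Nat.strong_induction_on with
    | _ j ih =>
      intro hj
      rcases Nat.eq_zero_or_pos j with rfl | hpos
      · simp
      · have key : ∀ Z : Fin k → R, (j : R) * MvPolynomial.aeval Z (MvPolynomial.esymm (Fin k) R j)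
            = (-1) ^ (j + 1) * ∑ a ∈ antidiagonal j with a.1 < j, (-1) ^ a.1 *
              MvPolynomial.aeval Z (MvPolynomial.esymm (Fin k) R a.1) * ∑ i, Z i ^ a.2 := by
          intro Z
          have := congrArg (MvPolynomial.aeval Z) (MvPolynomial.mul_esymm_eq_sum (Fin k) R j)
          simpa [MvPolynomial.psum, map_sum] using this
        apply (hk j hpos hj).mul_left_cancel
        rw [key X, key Y]
        congr 1
        apply sum_congr rfl
        intro a ha
        simp only [mem_filter, HasAntidiagonal.mem_antidiagonal] at ha
        rw [ih a.1 ha.2 (by omega), h a.2 (by omega) (by omega)]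
  have hpoly : ∀ Z : Fin k → R, ∀ t : R, ∏ l, (t - Z l) = ∑ j ∈ range (k + 1), (-1) ^ j *
      (MvPolynomial.aeval Z (MvPolynomial.esymm (Fin k) R j) * t ^ (k - j)) := by
    intro Z t
    have := congrArg (Polynomial.eval t)
      (Multiset.prod_X_sub_X_eq_sum_esymm ((univ : Finset (Fin k)).val.map Z))
    simp only [Multiset.map_map, Multiset.card_map, card_val, card_univ, Fintype.card_fin] at this
    rw [Polynomial.eval_finsetSum, Polynomial.eval_multiset_prod] at this
    simp only [Multiset.map_map, Function.comp_def, Polynomial.eval_sub, Polynomial.eval_X,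
      Polynomial.eval_C, Polynomial.eval_mul, Polynomial.eval_pow, Polynomial.eval_neg,
      Polynomial.eval_one] at this
    simp only [MvPolynomial.aeval_esymm_eq_multiset_esymm]
    exact this
  have h0 : ∏ l, (X i - X l) = 0 := prod_eq_zero (mem_univ i) (sub_self _)
  rw [← h0, hpoly X, hpoly Y]
  apply sum_congr rfl
  intro j hj
  rw [hes j (by simpa [Nat.lt_succ_iff] using hj)]

/-- Core of the Linnik lemma. -/
lemma linnik_core (p k : ℕ) (hp : p.Prime) (hpk : k < p) (X Y : Fin k → ℤ)
    (h : ∀ j : ℕ, 1 ≤ j → j ≤ k → (p : ℤ) ^ k ∣ (∑ i, X i ^ j - ∑ i, Y i ^ j))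
    (hY : ∀ i l, i ≠ l → ¬ (p : ℤ) ∣ Y i - Y l) (i : Fin k) :
    ∃ l, (p : ℤ) ^ k ∣ X i - Y l := by
  have hpz : Prime (p : ℤ) := Nat.prime_iff_prime_int.mp hp
  have hprod : (p : ℤ) ^ k ∣ ∏ l, (X i - Y l) := by
    have hc : ((p ^ k : ℕ) : ℤ) = (p : ℤ) ^ k := by push_cast; rfl
    rw [← hc, ← ZMod.intCast_zmod_eq_zero_iff_dvd]
    push_cast
    apply newton_core k _ (fun i => ((X i : ℤ) : ZMod (p ^ k))) (fun i => ((Y i : ℤ) : ZMod (p ^ k)))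
    · intro j hj1 hj
      have := h j hj1 hj
      rw [← hc, ← ZMod.intCast_zmod_eq_zero_iff_dvd] at this
      push_cast at this
      exact sub_eq_zero.mp this
    · intro j hj1 hj
      rw [ZMod.isUnit_iff_coprime]
      apply Nat.Coprime.pow_right
      exact (Nat.coprime_of_lt_prime (by omega) (by omega) hp).symm
  have hk0 : 0 < k := i.pos
  have hpd : (p : ℤ) ∣ ∏ l, (X i - Y l) := (dvd_pow_self _ (by omega)).trans hprod
  obtain ⟨l, _, hl⟩ := (Prime.dvd_finsetProd_iff hpz _).mp hpd
  refine ⟨l, ?_⟩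
  rw [← mul_prod_erase univ _ (mem_univ l)] at hprod
  refine IsCoprime.dvd_of_dvd_mul_right ?_ hprod
  apply IsCoprime.pow_left
  apply IsCoprime.prod_right
  intro m hm
  rw [hpz.coprime_iff_not_dvd]
  intro hd
  apply hY m l (ne_of_mem_erase hm)
  have := dvd_sub hl hd
  simpa using this

lemma linnik_count (p k P : ℕ) (hp : p.Prime) (hpk : k < p) (hP : P ≤ p ^ k) (a : ℤ) (c : ℕ → ℤ) :
    #{X : Fin k → Fin P | (∀ i l, i ≠ l → ¬ (p : ℤ) ∣ ((X i : ℕ) : ℤ) - ((X l : ℕ) : ℤ)) ∧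
      ∀ j, 1 ≤ j → j ≤ k → (p : ℤ) ^ j ∣ ∑ i, (((X i : ℕ) : ℤ) - a) ^ j - c j}
      ≤ k ^ k * p ^ (k * (k - 1) / 2) := by
  classical
  have hp0 : (0 : ℤ) < p := by exact_mod_cast hp.pos
  set S : (Fin k → Fin P) → ℕ → ℤ := fun X j => ∑ i, (((X i : ℕ) : ℤ) - a) ^ j - c j with hS
  set f : (Fin k → Fin P) → (Fin k → ℤ) := fun X j =>
    (S X (j + 1) / (p : ℤ) ^ ((j : ℕ) + 1)) % (p : ℤ) ^ (k - 1 - (j : ℕ)) with hf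
  set t : Finset (Fin k → ℤ) := Fintype.piFinset (fun j : Fin k => Ico (0 : ℤ) ((p : ℤ) ^ (k - 1 - (j : ℕ))))
    with ht
  have hcard : #t = p ^ (k * (k - 1) / 2) := by
    rw [ht, Fintype.card_piFinset]
    simp only [Int.card_Ico, sub_zero]
    have : ∀ j : Fin k, ((p : ℤ) ^ (k - 1 - (j : ℕ))).toNat = p ^ (k - 1 - (j : ℕ)) := by
      intro j
      have : ((p : ℤ) ^ (k - 1 - (j : ℕ))) = ((p ^ (k - 1 - (j : ℕ)) : ℕ) : ℤ) := by push_cast; rfl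
      rw [this, Int.toNat_natCast]
    rw [prod_congr rfl (fun j _ => this j), prod_pow_eq_pow_sum]
    congr 1
    rw [Fin.sum_univ_eq_sum_range (fun j => k - 1 - j) k, sum_range_reflect (fun j => j) k,
      sum_range_id]
  rw [← hcard]
  apply card_le_mul_card_image_of_maps_to (f := f)
  · intro X _
    rw [ht, Fintype.mem_piFinset]
    intro j
    rw [mem_Ico]
    exact ⟨Int.emod_nonneg _ (by positivity), Int.emod_lt_of_pos _ (by positivity)⟩
  · intro b _
    rcases Finset.eq_empty_or_nonempty
      (filter (fun X => f X = b) {X : Fin k → Fin P |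
        (∀ i l, i ≠ l → ¬ (p : ℤ) ∣ ((X i : ℕ) : ℤ) - ((X l : ℕ) : ℤ)) ∧
        ∀ j, 1 ≤ j → j ≤ k → (p : ℤ) ^ j ∣ ∑ i, (((X i : ℕ) : ℤ) - a) ^ j - c j}) with he | ⟨X0, hX0⟩
    · rw [he]; simp
    · have hsub : (filter (fun X => f X = b) {X : Fin k → Fin P |
        (∀ i l, i ≠ l → ¬ (p : ℤ) ∣ ((X i : ℕ) : ℤ) - ((X l : ℕ) : ℤ)) ∧
        ∀ j, 1 ≤ j → j ≤ k → (p : ℤ) ^ j ∣ ∑ i, (((X i : ℕ) : ℤ) - a) ^ j - c j}) ⊆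
          (univ : Finset (Fin k → Fin k)).image (fun σ => X0 ∘ σ) := by
        intro X hX
        simp only [mem_filter, mem_univ, true_and] at hX hX0
        have key : ∀ i, ∃ l, X i = X0 l := by
          intro i
          obtain ⟨l, hl⟩ := linnik_core p k hp hpk (fun i => ((X i : ℕ) : ℤ) - a)
            (fun i => ((X0 i : ℕ) : ℤ) - a) (by
              intro j hj1 hj
              have e1 := hX.1.2 j hj1 hj
              have e2 := hX0.1.2 j hj1 hj
              have e3 : f X ⟨j - 1, by omega⟩ = f X0 ⟨j - 1, by omega⟩ := by rw [hX.2, hX0.2]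
              simp only [hf] at e3
              rw [show j - 1 + 1 = j by omega, show k - 1 - (j - 1) = k - j by omega] at e3
              obtain ⟨q1, hq1⟩ := e1
              obtain ⟨q2, hq2⟩ := e2
              have hS1 : S X j = (p : ℤ) ^ j * q1 := hq1
              have hS2 : S X0 j = (p : ℤ) ^ j * q2 := hq2
              rw [hS1, hS2, Int.mul_ediv_cancel_left _ (by positivity),
                Int.mul_ediv_cancel_left _ (by positivity)] at e3
              have e4 : (p : ℤ) ^ (k - j) ∣ q1 - q2 := Int.ModEq.dvd (Eq.symm e3)
              have : ∑ i, (((X i : ℕ) : ℤ) - a) ^ j - ∑ i, (((X0 i : ℕ) : ℤ) - a) ^ j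
                  = (p : ℤ) ^ j * (q1 - q2) := by
                rw [mul_sub, ← hq1, ← hq2]; ring
              rw [this, show k = j + (k - j) by omega, pow_add]
              exact mul_dvd_mul_left _ e4)
            (by
              intro i l hil
              have := hX0.1.1 i l hil
              simpa using this) i
          refine ⟨l, ?_⟩
          have h1 : (p : ℤ) ^ k ∣ ((X i : ℕ) : ℤ) - ((X0 l : ℕ) : ℤ) := by
            simpa using hl
          have h2 : |((X i : ℕ) : ℤ) - ((X0 l : ℕ) : ℤ)| < (p : ℤ) ^ k := by
            have a1 := (X i).2
            have a2 := (X0 l).2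
            have a3 : (P : ℤ) ≤ (p : ℤ) ^ k := by exact_mod_cast hP
            rw [abs_lt]
            constructor <;> omega
          have h3 := Int.eq_zero_of_abs_lt_dvd h1 h2
          apply Fin.ext
          omega
        choose σ hσ using key
        rw [mem_image]
        exact ⟨σ, mem_univ _, by funext i; simp [hσ i]⟩
      refine (card_le_card hsub).trans (card_image_le.trans ?_)
      simp

end VK

namespace VK

open Finset

lemma newton_lower (p k : ℕ) (hk : 1 ≤ k) (f : Fin p → ℂ) (σ : ℝ) (hσ0 : 0 ≤ σ)
    (hσ : σ ^ 2 = ∑ a, ‖f a‖ ^ 2) (hF : 4 * k * σ < ‖∑ a, f a‖) :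
    ‖∑ a, f a‖ ^ k ≤ (2 * k) ^ k * ‖MvPolynomial.aeval f (MvPolynomial.esymm (Fin p) ℂ k)‖ := by
  set F := ‖∑ a, f a‖ with hFdef
  set e : ℕ → ℂ := fun j => MvPolynomial.aeval f (MvPolynomial.esymm (Fin p) ℂ j) with he
  have hk' : (1 : ℝ) ≤ k := by exact_mod_cast hk
  have hF0 : 0 < F := lt_of_le_of_lt (by positivity) hF
  have hps : ∀ m, 2 ≤ m → ‖∑ a, f a ^ m‖ ≤ σ ^ m := by
    intro m hm
    have hle : ∀ a, ‖f a‖ ≤ σ := by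
      intro a
      have : ‖f a‖ ^ 2 ≤ σ ^ 2 := by
        rw [hσ]
        exact single_le_sum (f := fun a => ‖f a‖ ^ 2) (fun _ _ => by positivity) (mem_univ a)
      exact le_of_sq_le_sq this hσ0
    calc ‖∑ a, f a ^ m‖ ≤ ∑ a, ‖f a‖ ^ m := by
          refine (norm_sum_le _ _).trans ?_
          simp
      _ ≤ ∑ a, σ ^ (m - 2) * ‖f a‖ ^ 2 := by
          apply sum_le_sum
          intro a _
          rw [show m = (m - 2) + 2 by omega, pow_add, show m - 2 + 2 - 2 = m - 2 by omega]
          gcongr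
          exact hle a
      _ = σ ^ m := by
          rw [← mul_sum, ← hσ, ← pow_add]; congr 1; omega
  have hnewton : ∀ j : ℕ, (j : ℂ) * e j = (-1) ^ (j + 1) * ∑ i ∈ range j,
      (-1) ^ i * e i * ∑ a, f a ^ (j - i) := by
    intro j
    have := congrArg (MvPolynomial.aeval f) (MvPolynomial.mul_esymm_eq_sum (Fin p) ℂ j)
    simp only [MvPolynomial.psum, map_sum, map_mul, map_pow, map_natCast, map_neg, map_one,
      MvPolynomial.aeval_X] at this
    rw [he]
    simp only
    rw [this, sum_filter, Finset.Nat.sum_antidiagonal_eq_sum_range_succ_mk, sum_range_succ]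
    simp only [lt_self_iff_false, if_false, add_zero]
    congr 1
    apply sum_congr rfl
    intro i hi
    rw [if_pos (mem_range.mp hi)]
  have step : ∀ j : ℕ, j + 1 ≤ k → F / (2 * k) * ‖e j‖ ≤ ‖e (j + 1)‖ := by
    intro j
    induction j using Nat.strong_induction_on with
    | _ j ih =>
      intro hj
      have hback : ∀ d, d ≤ j → (F / (2 * k)) ^ d * ‖e (j - d)‖ ≤ ‖e j‖ := by
        intro d
        induction d with
        | zero => intro _; simp
        | succ d ihd =>
          intro hd
          have h1 := ih (j - (d + 1)) (by omega) (by omega)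
          rw [show j - (d + 1) + 1 = j - d by omega] at h1
          calc (F / (2 * k)) ^ (d + 1) * ‖e (j - (d + 1))‖
              = (F / (2 * k)) ^ d * (F / (2 * k) * ‖e (j - (d + 1))‖) := by ring
            _ ≤ (F / (2 * k)) ^ d * ‖e (j - d)‖ := by gcongr
            _ ≤ ‖e j‖ := ihd (by omega)
      have hn := hnewton (j + 1)
      rw [sum_range_succ] at hn
      rw [show j + 1 - j = 1 by omega] at hn
      simp only [pow_one] at hn
      have hsmall : ‖∑ i ∈ range j, (-1 : ℂ) ^ i * e i * ∑ a, f a ^ (j + 1 - i)‖ ≤ σ * ‖e j‖ := by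
        calc ‖∑ i ∈ range j, (-1 : ℂ) ^ i * e i * ∑ a, f a ^ (j + 1 - i)‖
            ≤ ∑ i ∈ range j, ‖e i‖ * σ ^ (j + 1 - i) := by
              refine (norm_sum_le _ _).trans (sum_le_sum ?_)
              intro i hi
              have := mem_range.mp hi
              rw [norm_mul, norm_mul]
              simp only [norm_pow, norm_neg, norm_one, one_pow, one_mul]
              gcongr
              exact hps _ (by omega)
          _ ≤ ∑ i ∈ range j, σ * ‖e j‖ * (1 / 2) ^ (j - 1 - i + 1) := by
              apply sum_le_sum
              intro i hi
              have hi := mem_range.mp hi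
              have h1 := hback (j - i) (by omega)
              rw [show j - (j - i) = i by omega] at h1
              have h2 : 2 * σ ≤ F / (2 * k) := by
                rw [le_div_iff₀ (by positivity)]; linarith
              have h3 : (2 * σ) ^ (j - i) * ‖e i‖ ≤ ‖e j‖ := le_trans (by gcongr) h1
              rw [show j - 1 - i + 1 = j - i by omega, show j + 1 - i = j - i + 1 by omega]
              calc ‖e i‖ * σ ^ (j - i + 1) = σ * ((2 * σ) ^ (j - i) * ‖e i‖) * (1 / 2) ^ (j - i) := by
                    rw [mul_pow, one_div, inv_pow]; field_simp; ring
                _ ≤ σ * ‖e j‖ * (1 / 2) ^ (j - i) := by gcongr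
          _ = σ * ‖e j‖ * ∑ i ∈ range j, (1 / 2 : ℝ) ^ (i + 1) := by
              rw [← mul_sum, sum_range_reflect (fun i => (1 / 2 : ℝ) ^ (i + 1)) j]
          _ ≤ σ * ‖e j‖ * 1 := by
              gcongr
              have : ∑ i ∈ range j, (1 / 2 : ℝ) ^ (i + 1) = 1 - (1 / 2) ^ j := by
                induction j with
                | zero => simp
                | succ n _ =>
                  clear * -
                  induction n with
                  | zero => norm_num
                  | succ m ihm => rw [sum_range_succ, ihm]; ring
              rw [this]
              have : (0 : ℝ) ≤ (1 / 2) ^ j := by positivity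
              linarith
          _ = σ * ‖e j‖ := by ring
      have h4 : ‖((j + 1 : ℕ) : ℂ) * e (j + 1)‖ ≥ F * ‖e j‖ - σ * ‖e j‖ := by
        rw [hn, norm_mul]
        simp only [norm_pow, norm_neg, norm_one, one_pow, one_mul]
        have h5 : ‖(-1 : ℂ) ^ j * e j * ∑ a, f a‖ = F * ‖e j‖ := by
          rw [norm_mul, norm_mul]; simp [hFdef, mul_comm]
        have h6 := norm_sub_le_norm_add ((-1 : ℂ) ^ j * e j * ∑ a, f a)
          (∑ i ∈ range j, (-1 : ℂ) ^ i * e i * ∑ a, f a ^ (j + 1 - i))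
        rw [h5, add_comm ((-1 : ℂ) ^ j * e j * ∑ a, f a)] at h6
        linarith
      rw [norm_mul, Complex.norm_natCast] at h4
      have h7 : ((j + 1 : ℕ) : ℝ) ≤ k := by exact_mod_cast hj
      have h8 : ((j + 1 : ℕ) : ℝ) * ‖e (j + 1)‖ ≤ k * ‖e (j + 1)‖ := by gcongr
      have h9 : σ ≤ F / 2 := by nlinarith
      have h10 : σ * ‖e j‖ ≤ F / 2 * ‖e j‖ := by gcongr
      rw [div_mul_eq_mul_div, div_le_iff₀ (by positivity)]
      linarith
  have fin : ∀ j, j ≤ k → F ^ j ≤ (2 * k) ^ j * ‖e j‖ := by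
    intro j
    induction j with
    | zero => intro _; simp [he]
    | succ j ih =>
      intro hj
      have h1 := step j hj
      rw [div_mul_eq_mul_div, div_le_iff₀ (by positivity)] at h1
      calc F ^ (j + 1) = F ^ j * F := by ring
        _ ≤ (2 * k) ^ j * ‖e j‖ * F := by gcongr; exact ih (by omega)
        _ = (2 * k) ^ j * (F * ‖e j‖) := by ring
        _ ≤ (2 * k) ^ j * (‖e (j + 1)‖ * (2 * k)) := by gcongr
        _ = _ := by ring
  exact fin k le_rfl

end VK

namespace VK

open Finset

lemma esymm_strictMono (p k : ℕ) (f : Fin p → ℂ) :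
    MvPolynomial.aeval f (MvPolynomial.esymm (Fin p) ℂ k)
      = ∑ c : Fin k → Fin p with StrictMono c, ∏ i, f (c i) := by
  classical
  rw [MvPolynomial.esymm, map_sum]
  simp only [map_prod, MvPolynomial.aeval_X]
  symm
  refine sum_bij' (fun c _ => univ.image c)
    (fun t ht => ⇑(t.orderEmbOfFin (mem_powersetCard.mp ht).2)) ?_ ?_ ?_ ?_ ?_
  · intro c hc
    simp only [mem_filter, mem_univ, true_and] at hc
    rw [mem_powersetCard]
    exact ⟨subset_univ _, by rw [card_image_of_injective _ hc.injective]; simp⟩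
  · intro t ht
    simp only [mem_filter, mem_univ, true_and]
    exact (t.orderEmbOfFin _).strictMono
  · intro c hc
    simp only [mem_filter, mem_univ, true_and] at hc
    symm
    exact Finset.orderEmbOfFin_unique _ (fun x => mem_image_of_mem _ (mem_univ x)) hc
  · intro t ht
    have := Finset.image_orderEmbOfFin_univ t (mem_powersetCard.mp ht).2
    simpa using this
  · intro c hc
    simp only [mem_filter, mem_univ, true_and] at hc
    rw [prod_image (fun a _ b _ h => hc.injective h)]

/-- Number of coincidences of a map. -/
def cnt {A G : Type*} [Fintype A] [DecidableEq G] (u : A → G) : ℕ :=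
  #{q : A × A | u q.1 = u q.2}

lemma four_cnt {A G : Type*} [Fintype A] [AddCommGroup G] [Fintype G] [DecidableEq G] (u : A → G) :
    ∑ ψ : AddChar G ℂ, ‖∑ a, ψ (u a)‖ ^ 2 = Fintype.card G * cnt u := by
  classical
  have h1 : ∀ ψ : AddChar G ℂ, ((‖∑ a, ψ (u a)‖ ^ 2 : ℝ) : ℂ)
      = ∑ q : A × A, ψ (u q.1 - u q.2) := by
    intro ψ
    rw [Complex.ofReal_pow, ← Complex.conj_mul', map_sum, sum_mul_sum, ← univ_product_univ, sum_product, sum_comm]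
    apply sum_congr rfl; intro a _
    apply sum_congr rfl; intro b _
    rw [← AddChar.map_neg_eq_conj, ← AddChar.map_add_eq_mul]
    congr 1; abel
  have h2 : ((∑ ψ : AddChar G ℂ, ‖∑ a, ψ (u a)‖ ^ 2 : ℝ) : ℂ) = Fintype.card G * cnt u := by
    rw [Complex.ofReal_sum, sum_congr rfl (fun ψ _ => h1 ψ), sum_comm]
    simp only [AddChar.sum_apply_eq_ite, sub_eq_zero]
    rw [← sum_filter]
    simp [cnt, mul_comm]
  exact_mod_cast h2

end VK

namespace VK

open Finset

lemma addChar_sum {G ι : Type*} [AddCommGroup G] (ψ : AddChar G ℂ) (s : Finset ι) (f : ι → G) :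
    ψ (∑ i ∈ s, f i) = ∏ i ∈ s, ψ (f i) := by
  classical
  induction s using Finset.induction_on with
  | empty => simp
  | insert a s ha ih => rw [sum_insert ha, prod_insert ha, AddChar.map_add_eq_mul, ih]

/-- Exponential sum attached to a map into a group. -/
noncomputable def pw {A G : Type*} [Fintype A] [AddCommGroup G] (u : A → G) (ψ : AddChar G ℂ) : ℂ :=
  ∑ a, ψ (u a)

lemma pw_pow {A G : Type*} [Fintype A] [AddCommGroup G] (u : A → G) (ψ : AddChar G ℂ) (s : ℕ) :
    pw u ψ ^ s = pw (fun x : Fin s → A => ∑ i, u (x i)) ψ := by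
  classical
  unfold pw
  rw [Fintype.sum_pow]
  exact sum_congr rfl fun x _ => (addChar_sum ψ _ _).symm

lemma pw_mul {A B G : Type*} [Fintype A] [Fintype B] [AddCommGroup G] (u : A → G) (v : B → G)
    (ψ : AddChar G ℂ) :
    pw u ψ * pw v ψ = pw (fun q : A × B => u q.1 + v q.2) ψ := by
  unfold pw
  rw [sum_mul_sum, ← univ_product_univ, sum_product]
  exact sum_congr rfl fun x _ => sum_congr rfl fun y _ => (AddChar.map_add_eq_mul ψ _ _).symm

lemma four_pw {A G : Type*} [Fintype A] [AddCommGroup G] [Fintype G] [DecidableEq G] (u : A → G) :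
    ∑ ψ : AddChar G ℂ, ‖pw u ψ‖ ^ 2 = Fintype.card G * cnt u := four_cnt u

lemma pow_sum_le {p : ℕ} (g : Fin p → ℝ) (hg : ∀ a, 0 ≤ g a) (n : ℕ) (hn : 1 ≤ n) :
    (∑ a, g a) ^ n ≤ (p:ℝ) ^ (n-1) * ∑ a, g a ^ n := by
  obtain ⟨m, rfl⟩ := Nat.exists_eq_add_of_le' hn
  have h := pow_sum_div_card_le_sum_pow (s := (univ : Finset (Fin p))) (f := g) (n := m) (fun a _ => hg a)
  rcases Nat.eq_zero_or_pos p with rfl | hp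
  · simp
  simp only [card_univ, Fintype.card_fin] at h
  rw [div_le_iff₀ (by positivity)] at h
  simpa [mul_comm] using h

variable {X G : Type*} [Fintype X] [AddCommGroup G] [Fintype G] [DecidableEq G]

lemma esymm_pw (p k : ℕ) (γ : X → G) (ρ : X → Fin p) (ψ : AddChar G ℂ) :
    MvPolynomial.aeval (fun a : Fin p => pw (fun x : {x // ρ x = a} => γ x.1) ψ)
      (MvPolynomial.esymm (Fin p) ℂ k)
      = pw (fun x : {x : Fin k → X // StrictMono (ρ ∘ x)} => ∑ i, γ (x.1 i)) ψ := by
  classical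
  rw [esymm_strictMono]
  have h1 : ∀ a : Fin p, pw (fun x : {x // ρ x = a} => γ x.1) ψ = ∑ x : X with ρ x = a, ψ (γ x) := by
    intro a
    unfold pw
    exact (sum_subtype _ (by simp) (fun x => ψ (γ x))).symm
  simp only [h1]
  have h2 : pw (fun x : {x : Fin k → X // StrictMono (ρ ∘ x)} => ∑ i, γ (x.1 i)) ψ
      = ∑ x : Fin k → X with StrictMono (ρ ∘ x), ∏ i, ψ (γ (x i)) := by
    unfold pw
    rw [← sum_subtype (p := fun x : Fin k → X => StrictMono (ρ ∘ x))
      ({x : Fin k → X | StrictMono (ρ ∘ x)} : Finset _) (by simp) (fun x => ψ (∑ i, γ (x i)))]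
    exact sum_congr rfl fun x _ => (addChar_sum ψ _ _)
  rw [h2]
  rw [← sum_fiberwise_of_maps_to (s := ({x : Fin k → X | StrictMono (ρ ∘ x)} : Finset _))
    (t := ({c : Fin k → Fin p | StrictMono c} : Finset _)) (g := fun x => ρ ∘ x)
    (by intro x hx; simpa using hx)]
  apply sum_congr rfl
  intro c hc
  rw [prod_univ_sum]
  apply sum_congr _ (fun _ _ => rfl)
  ext x
  simp only [Fintype.mem_piFinset, mem_filter, mem_univ, true_and] at hc ⊢
  constructor
  · intro h
    have : ρ ∘ x = c := funext h
    exact ⟨this ▸ hc, this⟩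
  · rintro ⟨_, h⟩ i
    exact congrFun h i

lemma sum_pw_fib (p : ℕ) (γ : X → G) (ρ : X → Fin p) (ψ : AddChar G ℂ) :
    ∑ a : Fin p, pw (fun x : {x // ρ x = a} => γ x.1) ψ = pw γ ψ := by
  classical
  unfold pw
  have := (sum_fiberwise (univ : Finset X) ρ (fun x => ψ (γ x)))
  rw [← this]
  exact sum_congr rfl fun a _ => (sum_subtype _ (by simp) (fun x => ψ (γ x))).symm

lemma pointwise (p k r : ℕ) (hk : 1 ≤ k) (hr : 1 ≤ r) (γ : X → G) (ρ : X → Fin p)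
    (ψ : AddChar G ℂ) :
    ‖pw γ ψ‖ ^ (2*(k+r)) ≤ (2*k:ℝ)^(2*k) * (p:ℝ)^(2*r-1) *
      (∑ a : Fin p, ‖pw (fun q : {x : Fin k → X // StrictMono (ρ ∘ x)} × (Fin r → {x // ρ x = a}) =>
        (∑ i, γ (q.1.1 i)) + ∑ i, γ (q.2 i).1) ψ‖^2)
      + (16*k^2:ℝ)^(k+r) * (p:ℝ)^(k+r-1) *
      ∑ a : Fin p, ‖pw (fun x : Fin (k+r) → {x // ρ x = a} => ∑ i, γ (x i).1) ψ‖^2 := by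
  classical
  set f : Fin p → ℂ := fun a => pw (fun x : {x // ρ x = a} => γ x.1) ψ with hf
  set e := MvPolynomial.aeval f (MvPolynomial.esymm (Fin p) ℂ k) with he
  have e1 := esymm_pw p k γ ρ ψ
  have e2 := sum_pw_fib p γ ρ ψ
  have e5 : ∀ a, pw (fun q : {x : Fin k → X // StrictMono (ρ ∘ x)} × (Fin r → {x // ρ x = a}) =>
        (∑ i, γ (q.1.1 i)) + ∑ i, γ (q.2 i).1) ψ = e * pw (fun x : Fin r → {x // ρ x = a} => ∑ i, γ (x i).1) ψ := by
    intro a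
    rw [he, e1, pw_mul]
  simp only [e5]
  rw [← e2]
  have e3 : ∀ a, pw (fun x : Fin r → {x // ρ x = a} => ∑ i, γ (x i).1) ψ = f a ^ r := by
    intro a; rw [hf]; simp only; rw [pw_pow]
  have e4 : ∀ a, pw (fun x : Fin (k+r) → {x // ρ x = a} => ∑ i, γ (x i).1) ψ = f a ^ (k+r) := by
    intro a; rw [hf]; simp only; rw [pw_pow]
  simp only [e3, e4]
  change ‖∑ a, f a‖ ^ (2*(k+r)) ≤ (2*k:ℝ)^(2*k) * (p:ℝ)^(2*r-1) * (∑ a : Fin p, ‖e * f a ^ r‖^2) + _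
  have hS : 0 ≤ ∑ a, ‖f a‖^2 := sum_nonneg fun _ _ => by positivity
  by_cases hF : 4*k*Real.sqrt (∑ a, ‖f a‖^2) < ‖∑ a, f a‖
  · have h := newton_lower p k hk f _ (Real.sqrt_nonneg _) (Real.sq_sqrt hS) hF
    have h2 : ‖∑ a, f a‖^(2*r) ≤ (p:ℝ)^(2*r-1) * ∑ a, ‖f a‖^(2*r) :=
      (pow_le_pow_left₀ (norm_nonneg _) (norm_sum_le _ _) _).trans
        (pow_sum_le _ (fun a => norm_nonneg _) (2*r) (by omega))
    have h3 : ‖∑ a, f a‖^(2*(k+r)) ≤ ((2*k)^k * ‖e‖)^2 * ((p:ℝ)^(2*r-1) * ∑ a, ‖f a‖^(2*r)) := by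
      calc ‖∑ a, f a‖^(2*(k+r)) = (‖∑ a, f a‖^k)^2 * ‖∑ a, f a‖^(2*r) := by ring
        _ ≤ _ := by gcongr
    refine h3.trans (le_trans (le_of_eq ?_) (le_add_of_nonneg_right (by positivity)))
    simp only [norm_mul, norm_pow, mul_pow, ← mul_sum, ← pow_mul, mul_comm r 2, mul_comm k 2]
    ring
  · push Not at hF
    refine le_trans ?_ (le_add_of_nonneg_left (by positivity))
    have h2 := pow_sum_le (fun a => ‖f a‖^2) (fun a => by positivity) (k+r) (by omega)
    calc ‖∑ a, f a‖ ^ (2*(k+r)) ≤ (4*k*Real.sqrt (∑ a, ‖f a‖^2))^(2*(k+r)) := by gcongr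
      _ = (16*k^2:ℝ)^(k+r) * (∑ a, ‖f a‖^2)^(k+r) := by
        rw [pow_mul, mul_pow, Real.sq_sqrt hS, mul_pow]; ring
      _ ≤ (16*k^2:ℝ)^(k+r) * ((p:ℝ) ^ (k+r-1) * ∑ a, (‖f a‖^2)^(k+r)) := by gcongr
      _ = _ := by
        simp only [norm_pow, ← pow_mul, mul_comm (k+r) 2]; ring

lemma lemmaA (p k r : ℕ) (hk : 1 ≤ k) (hr : 1 ≤ r) (γ : X → G) (ρ : X → Fin p) :
    (cnt (fun x : Fin (k+r) → X => ∑ i, γ (x i)) : ℝ) ≤ (2*k:ℝ)^(2*k) * (p:ℝ)^(2*r-1) *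
      (∑ a : Fin p, (cnt (fun q : {x : Fin k → X // StrictMono (ρ ∘ x)} × (Fin r → {x // ρ x = a}) =>
        (∑ i, γ (q.1.1 i)) + ∑ i, γ (q.2 i).1) : ℝ))
      + (16*k^2:ℝ)^(k+r) * (p:ℝ)^(k+r-1) *
      ∑ a : Fin p, (cnt (fun x : Fin (k+r) → {x // ρ x = a} => ∑ i, γ (x i).1) : ℝ) := by
  have hG : (0:ℝ) < Fintype.card G := by exact_mod_cast Fintype.card_pos
  refine le_of_mul_le_mul_left ?_ hG
  rw [← four_pw]
  simp only [← pw_pow γ, norm_pow, ← pow_mul, mul_comm (k+r) 2]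
  refine (sum_le_sum fun ψ _ => pointwise p k r hk hr γ ρ ψ).trans (le_of_eq ?_)
  rw [sum_add_distrib, ← mul_sum, ← mul_sum, sum_comm, sum_comm (s := (univ : Finset (AddChar G ℂ)))]
  simp only [four_pw, ← mul_sum]
  ring

end VK

namespace VK

open Finset

lemma cross_eq {A B Γ : Type*} [Fintype A] [Fintype B] [DecidableEq Γ] (u : A → Γ) (v : B → Γ)
    (S : Finset Γ) (hu : ∀ a, u a ∈ S) :
    #{q : A × B | u q.1 = v q.2} = ∑ l ∈ S, #{a | u a = l} * #{b | v b = l} := by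
  rw [card_eq_sum_card_fiberwise (f := fun q => u q.1) (t := S) (fun q _ => hu _)]
  apply sum_congr rfl
  intro l _
  rw [← card_product]
  congr 1
  ext ⟨a, b⟩
  simp only [mem_filter, mem_univ, true_and, mem_product]
  constructor
  · rintro ⟨h1, h2⟩; exact ⟨h2, h1 ▸ h2⟩
  · rintro ⟨h1, h2⟩; exact ⟨h1.trans h2.symm, h1⟩

lemma two_cross_le {A B Γ : Type*} [Fintype A] [Fintype B] [DecidableEq Γ] (u : A → Γ) (v : B → Γ) :
    2 * #{q : A × B | u q.1 = v q.2} ≤ cnt u + cnt v := by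
  classical
  set S := univ.image u ∪ univ.image v with hS
  have hu : ∀ a, u a ∈ S := fun a => mem_union_left _ (mem_image_of_mem _ (mem_univ a))
  have hv : ∀ a, v a ∈ S := fun a => mem_union_right _ (mem_image_of_mem _ (mem_univ a))
  unfold cnt
  rw [cross_eq u v S hu, cross_eq u u S hu, cross_eq v v S hv, mul_sum, ← sum_add_distrib]
  apply sum_le_sum
  intro l _
  nlinarith [two_mul_le_add_sq (#{a | u a = l}) (#{b | v b = l})]

lemma diff_cnt {B Γ : Type*} [Fintype B] [AddCommGroup Γ] [DecidableEq Γ] (v : B → Γ) (g : Γ) :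
    #{q : B × B | v q.1 = v q.2 + g} ≤ cnt v := by
  have h := two_cross_le v (fun b => v b + g)
  have h2 : cnt (fun b => v b + g) = cnt v := by
    unfold cnt; simp
  omega

lemma cnt_fiber {A B Γ : Type*} [Fintype A] [Fintype B] [AddCommGroup Γ] [DecidableEq Γ]
    (u : A → Γ) (v : B → Γ) (E : Finset (A × A))
    (hE : ∀ q q' : A × B, u q.1 + v q.2 = u q'.1 + v q'.2 → (q.1, q'.1) ∈ E) :
    cnt (fun q : A × B => u q.1 + v q.2) ≤ cnt v * #E := by
  classical
  unfold cnt
  refine card_le_mul_card_image_of_maps_to (f := fun Q : (A × B) × (A × B) => (Q.1.1, Q.2.1))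
    (t := E) ?_ _ ?_
  · intro Q hQ
    simp only [mem_filter, mem_univ, true_and] at hQ
    exact hE _ _ hQ
  · rintro ⟨a, a'⟩ _
    refine le_trans ?_ (diff_cnt v (u a' - u a))
    refine card_le_card_of_injOn (fun Q => (Q.1.2, Q.2.2)) ?_ ?_
    · intro Q hQ
      simp only [coe_filter, Set.mem_ofPred_eq, mem_filter, mem_univ, true_and, Prod.mk.injEq] at hQ ⊢
      obtain ⟨h, rfl, rfl⟩ := hQ
      rw [eq_comm, ← sub_eq_zero] at h ⊢
      rw [← h]; abel
    · rintro ⟨⟨b1, b2⟩, b3, b4⟩ hQ ⟨⟨c1, c2⟩, c3, c4⟩ hQ' h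
      simp only [coe_filter, Set.mem_ofPred_eq, mem_filter, mem_univ, true_and, Prod.mk.injEq] at hQ hQ' h ⊢
      obtain ⟨-, rfl, rfl⟩ := hQ
      obtain ⟨-, h1, h2⟩ := hQ'
      exact ⟨⟨h1.symm, h.1⟩, h2.symm, h.2⟩

lemma cnt_le_of_inj {A B Γ Δ : Type*} [Fintype A] [Fintype B] [DecidableEq Γ] [DecidableEq Δ]
    (u : A → Γ) (v : B → Δ) (φ : A → B) (hφ : Function.Injective φ)
    (h : ∀ a a', u a = u a' → v (φ a) = v (φ a')) : cnt u ≤ cnt v := by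
  unfold cnt
  refine card_le_card_of_injOn (fun q => (φ q.1, φ q.2)) ?_ ?_
  · intro q hq
    simp only [coe_filter, Set.mem_ofPred_eq, mem_univ, true_and] at hq ⊢
    exact h _ _ hq
  · rintro ⟨a, b⟩ _ ⟨c, d⟩ _ hh
    simp only [Prod.mk.injEq] at hh ⊢
    exact ⟨hφ hh.1, hφ hh.2⟩

/-- Vector of power sums. -/
def psv (k : ℕ) {ι : Type*} [Fintype ι] (x : ι → ℤ) : Fin k → ℤ := fun j => ∑ i, x i ^ (j.1 + 1)

/-- Vinogradov mean value. -/
def J (k s P : ℕ) : ℕ := cnt (fun x : Fin s → Fin P => psv k (fun i => ((x i : ℕ) : ℤ)))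

lemma psv_translate (k : ℕ) {ι : Type*} [Fintype ι] (x y : ι → ℤ) (h : psv k x = psv k y) (a : ℤ) :
    psv k (fun i => x i - a) = psv k (fun i => y i - a) := by
  have hm : ∀ m, m ≤ k → ∑ i, x i ^ m = ∑ i, y i ^ m := by
    intro m hm
    rcases Nat.eq_zero_or_pos m with rfl | h0
    · simp
    · have := congrFun h ⟨m - 1, by omega⟩
      simp only [psv] at this
      rwa [Nat.sub_add_cancel h0] at this
  funext j
  simp only [psv, sub_eq_add_neg, add_pow]
  rw [sum_comm, sum_comm (s := univ) (f := fun i m => y i ^ m * _ * _)]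
  apply sum_congr rfl
  intro m hmm
  rw [← sum_mul, ← sum_mul, ← sum_mul, ← sum_mul, hm m (by rw [mem_range] at hmm; omega)]

lemma psv_smul (k : ℕ) {ι : Type*} [Fintype ι] (x y : ι → ℤ) (p : ℤ) (hp : p ≠ 0)
    (h : psv k (fun i => p * x i) = psv k (fun i => p * y i)) : psv k x = psv k y := by
  funext j
  have := congrFun h j
  simp only [psv, mul_pow, ← mul_sum] at this ⊢
  exact mul_left_cancel₀ (pow_ne_zero _ hp) this

/-- The moment curve modulo Q. -/
def gam (k Q P : ℕ) (x : Fin P) : Fin k → ZMod Q := fun j => ((x : ℕ) : ZMod Q) ^ (j.1 + 1)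

lemma gam_iff (k Q P : ℕ) {ι : Type*} [Fintype ι] (hP : 1 ≤ P) (hQ : Fintype.card ι * P ^ k < Q) (x y : ι → Fin P) :
    ∑ i, gam k Q P (x i) = ∑ i, gam k Q P (y i) ↔
      psv k (fun i => ((x i : ℕ) : ℤ)) = psv k (fun i => ((y i : ℕ) : ℤ)) := by
  have hb : ∀ (x : ι → Fin P) (j : Fin k), ∑ i, (x i : ℕ) ^ (j.1+1) < Q := by
    intro x j
    refine lt_of_le_of_lt ?_ hQ
    calc ∑ i, (x i : ℕ) ^ (j.1+1) ≤ ∑ i : ι, P ^ k := by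
          apply sum_le_sum; intro i _
          calc (x i : ℕ) ^ (j.1+1) ≤ P ^ (j.1+1) := by gcongr; exact (x i).2.le
            _ ≤ P ^ k := by apply Nat.pow_le_pow_right hP; have := j.2; omega
      _ = _ := by simp
  rw [funext_iff, funext_iff]
  apply forall_congr'
  intro j
  simp only [psv, gam, Finset.sum_apply]
  have h1 : ∀ x : ι → Fin P, ∑ i, ((x i : ℕ) : ZMod Q) ^ (j.1 + 1) = ((∑ i, (x i : ℕ)^(j.1+1) : ℕ) : ZMod Q) := by
    intro x; push_cast; rfl
  have h2 : ∀ x : ι → Fin P, ∑ i, ((x i : ℕ) : ℤ) ^ (j.1 + 1) = ((∑ i, (x i : ℕ)^(j.1+1) : ℕ) : ℤ) := by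
    intro x; push_cast; rfl
  rw [h1, h1, h2, h2, ZMod.natCast_eq_natCast_iff', Nat.mod_eq_of_lt (hb x j), Nat.mod_eq_of_lt (hb y j)]
  norm_cast

lemma J_split1 (k r R : ℕ) : J k (k+r) R ≤ cnt (fun q : (Fin k → Fin R) × (Fin r → Fin R) =>
      psv k (fun i => ((q.1 i : ℕ) : ℤ)) + psv k (fun i => ((q.2 i : ℕ) : ℤ))) := by
  unfold J
  refine cnt_le_of_inj _ _ (fun x => (fun i => x (Fin.castAdd r i), fun i => x (Fin.natAdd k i))) ?_ ?_
  · intro x y h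
    rw [Prod.mk.injEq] at h
    funext i
    refine Fin.addCases (fun i => congrFun h.1 i) (fun i => congrFun h.2 i) i
  · intro x y h
    have : ∀ x : Fin (k+r) → Fin R, psv k (fun i => ((x i : ℕ) : ℤ)) =
      psv k (fun i => ((x (Fin.castAdd r i) : ℕ) : ℤ)) + psv k (fun i => ((x (Fin.natAdd k i) : ℕ) : ℤ)) := by
      intro x
      funext j
      simp only [psv, Fin.sum_univ_add, Pi.add_apply]
    rw [this, this] at h
    exact h

lemma J_split (k r R : ℕ) : J k (k+r) R ≤ R ^ (2*k) * J k r R := by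
  refine (J_split1 k r R).trans ?_
  have h := cnt_fiber (fun x : Fin k → Fin R => psv k (fun i => ((x i : ℕ) : ℤ)))
    (fun x : Fin r → Fin R => psv k (fun i => ((x i : ℕ) : ℤ))) univ (fun _ _ _ => mem_univ _)
  refine h.trans (le_of_eq ?_)
  rw [card_univ, Fintype.card_prod, Fintype.card_fun, Fintype.card_fin, Fintype.card_fin, J]
  ring

lemma N_bound (p k s P : ℕ) (hp : 0 < p) (a : Fin p) (Q : ℕ) (hP : 1 ≤ P) (hQ : s * P ^ k < Q) :
    cnt (fun x : Fin s → {x : Fin P // (⟨x.1 % p, Nat.mod_lt _ hp⟩ : Fin p) = a} =>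
      ∑ i, gam k Q P (x i).1) ≤ J k s (P / p + 1) := by
  unfold J
  refine cnt_le_of_inj _ _ (fun x i => ⟨(x i).1.1 / p, by
    have := Nat.div_le_div_right (c := p) (x i).1.2.le; omega⟩) ?_ ?_
  · intro x y h
    funext i
    have h1 := congrFun h i
    simp only [Fin.mk.injEq] at h1
    have h2 := (x i).2.trans (y i).2.symm
    simp only [Fin.mk.injEq] at h2
    apply Subtype.ext; apply Fin.ext
    rw [← Nat.div_add_mod (x i).1.1 p, ← Nat.div_add_mod (y i).1.1 p, h1, h2]
  · intro x y h
    rw [gam_iff k Q P hP (by simpa using hQ)] at h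
    have h3 := psv_translate k _ _ h (a.1 : ℤ)
    refine psv_smul k _ _ p (by exact_mod_cast hp.ne') ?_
    have e : ∀ (x : {x : Fin P // (⟨x.1 % p, Nat.mod_lt _ hp⟩ : Fin p) = a}),
      ((x.1.1 : ℕ):ℤ) - (a.1:ℤ) = p * ((x.1.1 / p : ℕ) : ℤ) := by
      intro x
      have h2 := x.2
      rw [Fin.ext_iff] at h2
      simp only at h2
      have := Nat.div_add_mod x.1.1 p
      rw [h2] at this
      zify at this
      push_cast
      linarith
    simp only [e] at h3
    exact h3

end VK

namespace VK

open Finset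

/-- Reduction modulo p. -/
def rho (p P : ℕ) (hp : 0 < p) (x : Fin P) : Fin p := ⟨x.1 % p, Nat.mod_lt _ hp⟩

lemma rho_decomp {p P : ℕ} (hp : 0 < p) (a : Fin p) (x : {x : Fin P // rho p P hp x = a}) :
    ((x.1.1 : ℕ):ℤ) - (a.1:ℤ) = p * ((x.1.1 / p : ℕ) : ℤ) := by
  have h2 := x.2
  rw [Fin.ext_iff] at h2
  simp only [rho] at h2
  have := Nat.div_add_mod x.1.1 p
  rw [h2] at this
  zify at this
  push_cast
  linarith

/-- Quotient by p of an element of a residue class. -/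
def quo {p P : ℕ} {hp : 0 < p} {a : Fin p} (x : {x : Fin P // rho p P hp x = a}) : Fin (P / p + 1) :=
  ⟨x.1.1 / p, by have := Nat.div_le_div_right (c := p) x.1.2.le; omega⟩

lemma quo_inj {p P : ℕ} {hp : 0 < p} {a : Fin p} :
    Function.Injective (quo (P := P) (hp := hp) (a := a)) := by
  intro x y h
  have h1 := rho_decomp hp a x
  have h2 := rho_decomp hp a y
  simp only [quo, Fin.mk.injEq] at h
  rw [h, ← h2] at h1
  apply Subtype.ext; apply Fin.ext
  have : ((x.1.1:ℕ):ℤ) = y.1.1 := by linarith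
  exact_mod_cast this

lemma E_card (p k P : ℕ) (hp : p.Prime) (hpk : k < p) (hP : P ≤ p^k) (a : ℤ) :
    #{q : {x : Fin k → Fin P // StrictMono (rho p P hp.pos ∘ x)} ×
        {x : Fin k → Fin P // StrictMono (rho p P hp.pos ∘ x)} |
      ∀ j : Fin k, (p:ℤ)^(j.1+1) ∣ psv k (fun i => ((q.1.1 i : ℕ):ℤ) - a) j
        - psv k (fun i => ((q.2.1 i : ℕ):ℤ) - a) j} ≤ P^k * (k^k * p^(k*(k-1)/2)) := by
  classical
  set S := {x : Fin k → Fin P // StrictMono (rho p P hp.pos ∘ x)}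
  set T := ({q : S × S |
      ∀ j : Fin k, (p:ℤ)^(j.1+1) ∣ psv k (fun i => ((q.1.1 i : ℕ):ℤ) - a) j
        - psv k (fun i => ((q.2.1 i : ℕ):ℤ) - a) j} : Finset (S × S)) with hT
  have h1 : #T ≤ (k^k * p^(k*(k-1)/2)) * #(univ : Finset S) := by
    refine card_le_mul_card_image_of_maps_to (f := Prod.snd) (fun _ _ => mem_univ _) _ ?_
    intro y _
    refine le_trans ?_ (linnik_count p k P hp hpk hP a (fun j => ∑ i, (((y.1 i : ℕ):ℤ) - a)^j))
    refine card_le_card_of_injOn (fun q => q.1.1) ?_ ?_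
    · intro q hq
      simp only [hT, coe_filter, Set.mem_ofPred_eq, mem_filter, mem_univ, true_and] at hq ⊢
      obtain ⟨hq, rfl⟩ := hq
      constructor
      · intro i l hil hd
        apply hil
        apply q.1.2.injective
        simp only [Function.comp, rho, Fin.mk.injEq]
        have h3 : (((q.1.1 l : ℕ)) ≡ ((q.1.1 i : ℕ)) [MOD p]) := (Nat.modEq_iff_dvd).2 hd
        exact h3.symm
      · intro j hj1 hjk
        have := hq ⟨j-1, by omega⟩
        simp only [psv, Nat.sub_add_cancel hj1] at this
        exact this
    · rintro ⟨x, y1⟩ hx ⟨x', y2⟩ hx' h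
      simp only [hT, coe_filter, Set.mem_ofPred_eq, mem_filter, mem_univ, true_and] at hx hx' h ⊢
      rw [Prod.mk.injEq]
      exact ⟨Subtype.ext h, hx.2.trans hx'.2.symm⟩
  have h2 : #(univ : Finset S) ≤ P^k := by
    rw [card_univ]
    refine (Fintype.card_subtype_le _).trans (le_of_eq ?_)
    simp
  calc #T ≤ _ := h1
    _ ≤ (k^k * p^(k*(k-1)/2)) * P^k := by gcongr
    _ = _ := by ring

lemma N_bound' (p k s P : ℕ) (hp : 0 < p) (a : Fin p) (Q : ℕ) (hP : 1 ≤ P) (hQ : s * P ^ k < Q) :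
    cnt (fun x : Fin s → {x : Fin P // rho p P hp x = a} =>
      ∑ i, gam k Q P (x i).1) ≤ J k s (P / p + 1) := N_bound p k s P hp a Q hP hQ

lemma M_bound (p k r P : ℕ) (hp : p.Prime) (hpk : k < p) (hPk : P ≤ p^k) (a : Fin p) (Q : ℕ) (hP : 1 ≤ P)
    (hQ : (k+r) * P ^ k < Q) :
    cnt (fun q : {x : Fin k → Fin P // StrictMono (rho p P hp.pos ∘ x)} ×
        (Fin r → {x : Fin P // rho p P hp.pos x = a}) =>
      (∑ i, gam k Q P (q.1.1 i)) + ∑ i, gam k Q P (q.2 i).1)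
      ≤ P^k * (k^k * p^(k*(k-1)/2)) * J k r (P / p + 1) := by
  classical
  set S := {x : Fin k → Fin P // StrictMono (rho p P hp.pos ∘ x)}
  have h1 : cnt (fun q : S × (Fin r → {x : Fin P // rho p P hp.pos x = a}) =>
      (∑ i, gam k Q P (q.1.1 i)) + ∑ i, gam k Q P (q.2 i).1) ≤
      cnt (fun q : S × (Fin r → Fin (P/p+1)) => psv k (fun i => ((q.1.1 i:ℕ):ℤ) - (a.1:ℤ)) +
        psv k (fun i => (p:ℤ) * ((q.2 i : ℕ):ℤ))) := by
    refine cnt_le_of_inj _ _ (fun q => (q.1, fun i => quo (q.2 i))) ?_ ?_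
    · rintro ⟨x, z⟩ ⟨x', z'⟩ h
      rw [Prod.mk.injEq] at h ⊢
      exact ⟨h.1, funext fun i => quo_inj (congrFun h.2 i)⟩
    · rintro ⟨x, z⟩ ⟨x', z'⟩ h
      have e1 : ∀ (x : Fin k → Fin P) (z : Fin r → Fin P),
          (∑ i, gam k Q P (x i)) + ∑ i, gam k Q P (z i) = ∑ i, gam k Q P (Sum.elim x z i) := by
        intro x z
        rw [Fintype.sum_sum_type]; rfl
      have e2 : ∀ (x : Fin k → Fin P) (z : Fin r → Fin P),
          psv k (fun i => (((Sum.elim x z i : Fin P) : ℕ):ℤ) - (a.1:ℤ)) = psv k (fun i => ((x i:ℕ):ℤ) - (a.1:ℤ))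
            + psv k (fun i => ((z i:ℕ):ℤ) - (a.1:ℤ)) := by
        intro x z
        funext j
        simp only [psv, Fintype.sum_sum_type, Pi.add_apply, Sum.elim_inl, Sum.elim_inr]
      simp only at h
      rw [e1 x.1 (fun i => (z i).1), e1 x'.1 (fun i => (z' i).1), gam_iff k Q P hP (by simpa using hQ)] at h
      have h3 := psv_translate k _ _ h (a.1 : ℤ)
      rw [e2, e2] at h3
      simp only [rho_decomp] at h3
      exact h3
  refine h1.trans ?_
  have h2 := cnt_fiber (fun x : S => psv k (fun i => ((x.1 i:ℕ):ℤ) - (a.1:ℤ)))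
    (fun z : Fin r → Fin (P/p+1) => psv k (fun i => (p:ℤ) * ((z i : ℕ):ℤ))) (univ.filter fun q : S × S =>
      ∀ j : Fin k, (p:ℤ)^(j.1+1) ∣ psv k (fun i => ((q.1.1 i : ℕ):ℤ) - (a.1:ℤ)) j
        - psv k (fun i => ((q.2.1 i : ℕ):ℤ) - (a.1:ℤ)) j) (fun q q' h => by
      rw [mem_filter]
      refine ⟨mem_univ _, fun j => ?_⟩
      have hj := congrFun h j
      simp only [Pi.add_apply] at hj
      have e : ∀ z : Fin r → Fin (P/p+1), (p:ℤ)^(j.1+1) ∣ psv k (fun i => (p:ℤ) * ((z i : ℕ):ℤ)) j := by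
        intro z
        simp only [psv, mul_pow, ← mul_sum]
        exact dvd_mul_right _ _
      have := dvd_sub (e q'.2) (e q.2)
      have e4 : psv k (fun i => ((q.1.1 i : ℕ):ℤ) - (a.1:ℤ)) j
        - psv k (fun i => ((q'.1.1 i : ℕ):ℤ) - (a.1:ℤ)) j = psv k (fun i => (p:ℤ) * ((q'.2 i : ℕ):ℤ)) j
          - psv k (fun i => (p:ℤ) * ((q.2 i : ℕ):ℤ)) j := by linarith
      simp only
      rw [e4]; exact this)
  refine h2.trans ?_
  have h3 := E_card p k P hp hpk hPk (a.1:ℤ)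
  have h4 : cnt (fun z : Fin r → Fin (P/p+1) => psv k (fun i => (p:ℤ) * ((z i : ℕ):ℤ))) ≤ J k r (P/p+1) := by
    unfold J
    refine cnt_le_of_inj _ _ id Function.injective_id ?_
    intro z z' h
    exact psv_smul k _ _ p (by exact_mod_cast hp.ne_zero) h
  rw [mul_comm]
  exact Nat.mul_le_mul h3 h4

/-- The basic recursion for the mean value. -/
lemma J_rec (p k r P : ℕ) (hk : 1 ≤ k) (hr : 1 ≤ r) (hp : p.Prime) (hpk : k < p) (hPk : P ≤ p^k) (hP : 1 ≤ P) :
    (J k (k+r) P : ℝ) ≤ ((2*k:ℝ)^(2*k) * (p:ℝ)^(2*r) * ((P:ℝ)^k * (k^k * (p:ℝ)^(k*(k-1)/2)))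
      + (16*k^2:ℝ)^(k+r) * (p:ℝ)^(k+r) * ((P/p+1 : ℕ):ℝ)^(2*k)) * J k r (P/p+1) := by
  classical
  set Q := (k+r) * P^k + 1 with hQ
  have : NeZero Q := ⟨by omega⟩
  have hQ' : (k+r) * P^k < Q := by omega
  have hp0 : (0:ℝ) < p := by exact_mod_cast hp.pos
  have h0 : J k (k+r) P ≤ cnt (fun x : Fin (k+r) → Fin P => ∑ i, gam k Q P (x i)) := by
    unfold J
    refine cnt_le_of_inj _ _ id Function.injective_id ?_
    intro x y h
    exact (gam_iff k Q P hP (by simpa using hQ') x y).2 h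
  have h1 := lemmaA p k r hk hr (gam k Q P) (rho p P hp.pos)
  set R := P/p+1
  have hM : ∑ a : Fin p, (cnt (fun q : {x : Fin k → Fin P // StrictMono (rho p P hp.pos ∘ x)} ×
        (Fin r → {x : Fin P // rho p P hp.pos x = a}) =>
      (∑ i, gam k Q P (q.1.1 i)) + ∑ i, gam k Q P (q.2 i).1) : ℝ) ≤
      p * ((P:ℝ)^k * (k^k * (p:ℝ)^(k*(k-1)/2)) * J k r R) := by
    refine (sum_le_sum (fun a _ => ?_) : _ ≤ ∑ a : Fin p, ((P:ℝ)^k * (k^k * (p:ℝ)^(k*(k-1)/2)) * J k r R)).trans (by simp)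
    exact_mod_cast M_bound p k r P hp hpk hPk a Q hP hQ'
  have hN : ∑ a : Fin p, (cnt (fun x : Fin (k+r) → {x : Fin P // rho p P hp.pos x = a} =>
      ∑ i, gam k Q P (x i).1) : ℝ) ≤ p * ((R:ℝ)^(2*k) * J k r R) := by
    refine (sum_le_sum (fun a _ => ?_) : _ ≤ ∑ a : Fin p, ((R:ℝ)^(2*k) * J k r R)).trans (by simp)
    exact_mod_cast (N_bound' p k (k+r) P hp.pos a Q hP hQ').trans (J_split k r R)
  have h0' : (J k (k+r) P : ℝ) ≤ cnt (fun x : Fin (k+r) → Fin P => ∑ i, gam k Q P (x i)) := by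
    exact_mod_cast h0
  refine h0'.trans (h1.trans ((add_le_add (mul_le_mul_of_nonneg_left hM (by positivity))
    (mul_le_mul_of_nonneg_left hN (by positivity))).trans (le_of_eq ?_)))
  have e1 : (p:ℝ)^(2*r) = p^(2*r-1) * p := by rw [← pow_succ]; congr 1; omega
  have e2 : (p:ℝ)^(k+r) = p^(k+r-1) * p := by rw [← pow_succ]; congr 1; omega
  rw [e1, e2]
  ring

end VK

namespace VK

open Finset

lemma bracket (k s : ℕ) (hk : 1 ≤ k) (hs : k^2 ≤ s) (x p R : ℝ) (hx : 1 ≤ x) (hp : 0 ≤ p) (hpx : p ≤ 4*k*x)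
    (hR : 0 ≤ R) (hRx : R ≤ 2 * x^(k-1)) :
    (2*k:ℝ)^(2*k) * p^(2*s) * ((x^k)^k * (k^k * p^(k*(k-1)/2)))
      + (16*k^2:ℝ)^(k+s) * p^(k+s) * R^(2*k) ≤ 2 * (4*k:ℝ)^(3*s+5*k^2) * x^(2*s+k^2+k*(k-1)/2) := by
  have hk' : (1:ℝ) ≤ k := by exact_mod_cast hk
  have hb : (1:ℝ) ≤ 4*k := by linarith
  have h0 : k*(k-1)/2 ≤ k^2 := by
    calc k*(k-1)/2 ≤ k*(k-1) := Nat.div_le_self _ _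
      _ ≤ k*k := by gcongr; omega
      _ = k^2 := by ring
  have hkk : k ≤ k^2 := by nlinarith
  have t1 : (2*k:ℝ)^(2*k) * p^(2*s) * ((x^k)^k * (k^k * p^(k*(k-1)/2))) ≤
      (4*k:ℝ)^(3*s+5*k^2) * x^(2*s+k^2+k*(k-1)/2) := by
    calc (2*k:ℝ)^(2*k) * p^(2*s) * ((x^k)^k * (k^k * p^(k*(k-1)/2)))
        ≤ (4*k:ℝ)^(2*k) * (4*k*x)^(2*s) * ((x^k)^k * ((4*k)^k * (4*k*x)^(k*(k-1)/2))) := by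
          gcongr <;> linarith
      _ = (4*k:ℝ)^(3*k+2*s+k*(k-1)/2) * x^(2*s+k^2+k*(k-1)/2) := by
          rw [mul_pow (4*k:ℝ) x, mul_pow (4*k:ℝ) x]; ring
      _ ≤ _ := by
          refine mul_le_mul_of_nonneg_right (pow_le_pow_right₀ hb ?_) (by positivity)
          nlinarith
  have t2 : (16*k^2:ℝ)^(k+s) * p^(k+s) * R^(2*k) ≤
      (4*k:ℝ)^(3*s+5*k^2) * x^(2*s+k^2+k*(k-1)/2) := by
    calc (16*k^2:ℝ)^(k+s) * p^(k+s) * R^(2*k)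
        ≤ (16*k^2:ℝ)^(k+s) * (4*k*x)^(k+s) * (4*k * x^(k-1))^(2*k) := by
          gcongr
          refine hRx.trans ?_
          gcongr
          linarith
      _ = (4*k:ℝ)^(2*(k+s)+(k+s)+2*k) * x^((k+s)+(k-1)*(2*k)) := by
          rw [show (16*k^2:ℝ) = (4*k)^2 by ring, ← pow_mul, mul_pow (4*k:ℝ) x, mul_pow (4*k:ℝ) (x^(k-1)), ← pow_mul x]
          ring
      _ ≤ _ := by
          have hT : k*(k-1) = 2*(k*(k-1)/2) :=
            (Nat.mul_div_cancel' (Nat.even_mul_pred_self k).two_dvd).symm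
          have hT2 : k^2 = k*(k-1) + k := by
            obtain ⟨m, rfl⟩ := Nat.exists_eq_add_of_le' hk
            rw [Nat.add_sub_cancel]; ring
          have hT3 : (k-1)*(2*k) = 2*(k*(k-1)) := by ring
          refine mul_le_mul (pow_le_pow_right₀ hb ?_) (pow_le_pow_right₀ hx ?_) (by positivity) (by positivity)
          · omega
          · omega
  linarith

lemma two_K (k : ℕ) (hk : 1 ≤ k) : ((k*(k-1)/2 : ℕ) : ℝ) = k*(k-1)/2 := by
  have h : 2 ∣ k*(k-1) := by
    have := Nat.even_mul_pred_self k
    exact this.two_dvd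
  rw [Nat.cast_div h (by norm_num), Nat.cast_mul, Nat.cast_sub hk]
  norm_num

lemma exists_p (k P : ℕ) (hk : 1 ≤ k) (hP : 1 ≤ P) :
    ∃ p : ℕ, p.Prime ∧ k < p ∧ P ≤ p^k ∧ (p:ℝ) ≤ 4*k*(P:ℝ)^((1:ℝ)/k) ∧
      (((P/p+1 : ℕ)):ℝ) ≤ 2 * ((P:ℝ)^((1:ℝ)/k))^(k-1) := by
  set x := (P:ℝ)^((1:ℝ)/k) with hx
  have hk' : (1:ℝ) ≤ k := by exact_mod_cast hk
  have hP' : (1:ℝ) ≤ P := by exact_mod_cast hP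
  have hx1 : 1 ≤ x := Real.one_le_rpow hP' (by positivity)
  have hxk : x^k = P := by
    rw [hx, ← Real.rpow_natCast, ← Real.rpow_mul (by positivity)]
    rw [one_div_mul_cancel (by positivity), Real.rpow_one]
  obtain ⟨p, hp, h1, h2⟩ := Nat.exists_prime_lt_and_le_two_mul (max k ⌈x⌉₊) (by have := le_max_left k ⌈x⌉₊; omega)
  have hn : ((max k ⌈x⌉₊ : ℕ):ℝ) ≤ 2*k*x := by
    push_cast
    apply max_le
    · nlinarith
    · have := (Nat.ceil_lt_add_one (by linarith : 0 ≤ x)).le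
      nlinarith
  have hpx : x ≤ p := by
    refine (Nat.le_ceil x).trans ?_
    exact_mod_cast (le_max_right k ⌈x⌉₊).trans h1.le
  refine ⟨p, hp, lt_of_le_of_lt (le_max_left _ _) h1, ?_, ?_, ?_⟩
  · have : (P:ℝ) ≤ (p:ℝ)^k := by rw [← hxk]; gcongr
    exact_mod_cast this
  · have : (p:ℝ) ≤ 2 * (max k ⌈x⌉₊ : ℕ) := by exact_mod_cast h2
    linarith
  · push_cast
    have h3 : ((P/p:ℕ):ℝ) ≤ x^(k-1) := by
      calc ((P/p:ℕ):ℝ) ≤ (P:ℝ)/p := Nat.cast_div_le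
        _ ≤ P / x := by gcongr
        _ = x^(k-1) := by
          rw [← hxk, div_eq_iff (by positivity), ← pow_succ]; congr 1; omega
    have h4 : 1 ≤ x^(k-1) := one_le_pow₀ hx1
    linarith

lemma J_step (k s : ℕ) (hk : 1 ≤ k) (hs : k^2 ≤ s) (hs2 : s ≤ 10*k^2) (b E : ℝ) (hb : 0 ≤ b) (hE0 : 0 ≤ E) (hE : E ≤ 2*s)
    (ih : ∀ P : ℕ, 1 ≤ P → (J k s P : ℝ) ≤ b * (P:ℝ)^E) (P : ℕ) (hP : 1 ≤ P) :
    (J k (k+s) P : ℝ) ≤ (4*k:ℝ)^(56*k^2) * b * (P:ℝ)^((2*s+k^2+k*(k-1)/2+(k-1)*E)/k : ℝ) := by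
  obtain ⟨p, hp, hpk, hPp, hpx, hRx⟩ := exists_p k P hk hP
  set x := (P:ℝ)^((1:ℝ)/k) with hx
  have hk' : (1:ℝ) ≤ k := by exact_mod_cast hk
  have hP' : (1:ℝ) ≤ P := by exact_mod_cast hP
  have hx1 : 1 ≤ x := Real.one_le_rpow hP' (by positivity)
  have hxk : x^k = P := by
    rw [hx, ← Real.rpow_natCast, ← Real.rpow_mul (by positivity)]
    rw [one_div_mul_cancel (by positivity), Real.rpow_one]
  have h1 := J_rec p k s P hk (by nlinarith) hp hpk hPp hP
  set R := P/p+1 with hR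
  have h2 := bracket k s hk hs x p R hx1 (by positivity) hpx (by positivity) hRx
  rw [hxk] at h2
  have h3 := ih R (Nat.le_add_left 1 _)
  have h4 : (R:ℝ)^E ≤ (4*k:ℝ)^(2*s) * x^((k-1)*E : ℝ) := by
    calc (R:ℝ)^E ≤ (2 * x^(k-1))^E := by gcongr
      _ = 2^E * x^((k-1)*E : ℝ) := by
        rw [Real.mul_rpow (by norm_num) (by positivity), ← Real.rpow_natCast, ← Real.rpow_mul (by positivity)]
        rw [Nat.cast_sub hk]; norm_num
      _ ≤ (4*k:ℝ)^(2*s) * x^((k-1)*E : ℝ) := by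
        gcongr
        calc (2:ℝ)^E ≤ 2^(2*s:ℝ) := by gcongr; norm_num
          _ = 2^(2*s) := by rw [← Real.rpow_natCast]; push_cast; rfl
          _ ≤ _ := by gcongr; linarith
  have e1 : (P:ℝ)^((2*s+k^2+k*(k-1)/2+(k-1)*E)/k : ℝ) = x^(2*s+k^2+k*(k-1)/2) * x^((k-1)*E : ℝ) := by
    rw [← Real.rpow_natCast x, ← Real.rpow_add (by positivity), hx, ← Real.rpow_mul (by positivity)]
    congr 1
    rw [Nat.cast_add, two_K k hk]
    push_cast
    ring
  rw [e1]
  calc (J k (k+s) P : ℝ) ≤ _ := h1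
    _ ≤ (2 * (4*k:ℝ)^(3*s+5*k^2) * x^(2*s+k^2+k*(k-1)/2)) * (b * ((4*k:ℝ)^(2*s) * x^((k-1)*E : ℝ))) := by
      refine mul_le_mul h2 (h3.trans ?_) (by positivity) (by positivity)
      gcongr
    _ = 2 * (4*k:ℝ)^(3*s+5*k^2+2*s) * b * (x^(2*s+k^2+k*(k-1)/2) * x^((k-1)*E : ℝ)) := by ring
    _ ≤ (4*k:ℝ)^(56*k^2) * b * (x^(2*s+k^2+k*(k-1)/2) * x^((k-1)*E : ℝ)) := by
      gcongr
      calc 2 * (4*k:ℝ)^(3*s+5*k^2+2*s) ≤ (4*k) * (4*k:ℝ)^(3*s+5*k^2+2*s) := by gcongr; linarith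
        _ = (4*k:ℝ)^(3*s+5*k^2+2*s+1) := by ring
        _ ≤ _ := by
          gcongr
          · linarith
          · nlinarith

lemma J_triv (k s P : ℕ) : J k s P ≤ P^(2*s) := by
  unfold J cnt
  refine (card_le_univ _).trans (le_of_eq ?_)
  simp only [Fintype.card_prod, Fintype.card_fun, Fintype.card_fin]
  ring

lemma J_iter (k : ℕ) (hk : 1 ≤ k) (m : ℕ) (hm : m ≤ 8*k) (P : ℕ) (hP : 1 ≤ P) :
    (J k (2*k^2+k*m) P : ℝ) ≤ (4*k:ℝ)^(56*k^2*m) *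
      (P:ℝ)^(2*(2*k^2+k*m) - k*(k+1)/2 + k*(k+1)/2*(1-1/k)^m : ℝ) := by
  have hk' : (1:ℝ) ≤ k := by exact_mod_cast hk
  induction m generalizing P with
  | zero =>
    have h := J_triv k (2*k^2+k*0) P
    have h' : (J k (2*k^2+k*0) P : ℝ) ≤ (P:ℝ)^(2*(2*k^2+k*0)) := by exact_mod_cast h
    refine h'.trans (le_of_eq ?_)
    rw [← Real.rpow_natCast]
    simp
  | succ m ih =>
    have hq0 : 0 ≤ (1 - 1/(k:ℝ)) := by
      rw [sub_nonneg, div_le_one (by positivity)]; exact hk'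
    have hq1 : (1 - 1/(k:ℝ))^m ≤ 1 := pow_le_one₀ hq0 (by linarith [show 0 ≤ 1/(k:ℝ) by positivity])
    have hq2 : 0 ≤ (1 - 1/(k:ℝ))^m := by positivity
    have hmk : k*m ≤ 8*k^2 := by nlinarith
    have h := J_step k (2*k^2+k*m) hk (by nlinarith) (by nlinarith) ((4*k:ℝ)^(56*k^2*m))
      (2*(2*k^2+k*m) - k*(k+1)/2 + k*(k+1)/2*(1-1/k)^m) (by positivity) ?_ ?_
      (fun P hP => ih (by omega) P hP) P hP
    · rw [show k + (2*k^2+k*m) = 2*k^2+k*(m+1) by ring] at h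
      refine h.trans (le_of_eq ?_)
      congr 1
      · rw [← pow_add]; congr 1; ring
      · congr 1
        push_cast
        rw [pow_succ (1 - 1/(k:ℝ)) m]
        generalize (1 - 1/(k:ℝ))^m = q
        field_simp
        ring
    · have : 0 ≤ (k:ℝ)*(k+1)/2*(1-1/k)^m := by positivity
      have : (0:ℝ) ≤ k*m := by positivity
      nlinarith
    · push_cast
      nlinarith [show (k:ℝ)*(k+1)/2*(1-1/k)^m ≤ k*(k+1)/2*1 by gcongr]

/-- The mean value theorem. -/
theorem J_bound (k : ℕ) (hk : 1 ≤ k) (P : ℕ) (hP : 1 ≤ P) :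
    (J k (10*k^2) P : ℝ) ≤ (4*k:ℝ)^(448*k^3) * (P:ℝ)^(20*k^2 - k*(k+1)/2 + k^2/2000 : ℝ) := by
  have hk' : (1:ℝ) ≤ k := by exact_mod_cast hk
  have hP' : (1:ℝ) ≤ P := by exact_mod_cast hP
  have h := J_iter k hk (8*k) le_rfl P hP
  rw [show 2*k^2+k*(8*k) = 10*k^2 by ring, show 56*k^2*(8*k) = 448*k^3 by ring] at h
  refine h.trans ?_
  refine mul_le_mul_of_nonneg_left (Real.rpow_le_rpow_of_exponent_le hP' ?_) (by positivity)
  have h1 : (1-1/(k:ℝ))^(8*k) ≤ 1/2000 := by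
    have h2 : (1-1/(k:ℝ)) ≤ Real.exp (-(1/k)) := by
      have := Real.add_one_le_exp (-(1/(k:ℝ))); linarith
    have hq0 : 0 ≤ (1 - 1/(k:ℝ)) := by
      rw [sub_nonneg, div_le_one (by positivity)]; exact hk'
    calc (1-1/(k:ℝ))^(8*k) ≤ (Real.exp (-(1/k)))^(8*k) := by gcongr
      _ = Real.exp (-8) := by
        rw [← Real.exp_nat_mul]; congr 1; push_cast; field_simp
      _ = 1 / (Real.exp 1)^8 := by
        rw [Real.exp_neg, ← Real.exp_nat_mul]; norm_num
      _ ≤ 1 / 2.7^8 := by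
        have := Real.exp_one_gt_d9
        gcongr
        linarith
      _ ≤ _ := by norm_num
  have h3 : (k:ℝ)*(k+1)/2*(1-1/k)^(8*k) ≤ k^2 * (1/2000) := by
    refine mul_le_mul (by nlinarith) h1 ?_ (by positivity)
    rw [show 8*k = 2*(4*k) by ring, pow_mul]; positivity
  push_cast
  linarith

end VK

namespace VK

open Finset

/-- The additive character `exp(2πix)`. -/
noncomputable def ee (x : ℝ) : ℂ := Complex.exp ((2 * Real.pi * x : ℝ) * Complex.I)

lemma ee_add (x y : ℝ) : ee (x + y) = ee x * ee y := by
  unfold ee; rw [← Complex.exp_add]; congr 1; push_cast; ring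

lemma ee_zero : ee 0 = 1 := by simp [ee]

@[simp] lemma norm_ee (x : ℝ) : ‖ee x‖ = 1 := by
  unfold ee; exact Complex.norm_exp_ofReal_mul_I _

lemma ee_neg (x : ℝ) : ee (-x) = (starRingEnd ℂ) (ee x) := by
  unfold ee
  rw [← Complex.exp_conj]; congr 1
  rw [map_mul, Complex.conj_ofReal, Complex.conj_I]
  push_cast
  ring

lemma ee_sum {ι : Type*} (s : Finset ι) (f : ι → ℝ) : ee (∑ i ∈ s, f i) = ∏ i ∈ s, ee (f i) := by
  classical
  induction s using Finset.induction_on with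
  | empty => simp [ee_zero]
  | insert a s ha ih => rw [sum_insert ha, prod_insert ha, ee_add, ih]

lemma norm_pow_ee {V : Type*} [Fintype V] (s : ℕ) (φ : V → ℝ) :
    ((‖∑ v, ee (φ v)‖ ^ (2*s) : ℝ) : ℂ)
      = ∑ q : (Fin s → V) × (Fin s → V), ee (∑ i, φ (q.1 i) - ∑ i, φ (q.2 i)) := by
  classical
  rw [pow_mul, Complex.ofReal_pow, Complex.ofReal_pow, ← Complex.conj_mul', mul_pow, map_sum, Fintype.sum_pow,
    Fintype.sum_pow, sum_mul_sum, ← univ_product_univ, sum_product, sum_comm]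
  apply sum_congr rfl; intro x _
  apply sum_congr rfl; intro y _
  rw [sub_eq_add_neg, ee_add, ee_neg, ee_sum, ee_sum, map_prod, mul_comm]

/-- Difference of power sum vectors. -/
def lam (k s P : ℕ) (q : (Fin s → Fin P) × (Fin s → Fin P)) : Fin k → ℤ :=
  psv k (fun i => ((q.1 i : ℕ):ℤ)) - psv k (fun i => ((q.2 i : ℕ):ℤ))

/-- Weyl sum. -/
noncomputable def wey (k P : ℕ) (c : Fin k → ℝ) : ℂ := ∑ v : Fin P, ee (∑ j : Fin k, c j * (v.1:ℝ)^(j.1+1))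

lemma wey_pow (k s P : ℕ) (c : Fin k → ℝ) :
    ((‖wey k P c‖ ^ (2*s) : ℝ) : ℂ) = ∑ q, ee (∑ j, c j * (lam k s P q j : ℝ)) := by
  unfold wey
  rw [norm_pow_ee]
  apply sum_congr rfl; intro q _
  congr 1
  rw [sum_comm, sum_comm (s := univ) (t := univ) (f := fun i j => c j * ((q.2 i).1:ℝ)^(j.1+1)), ← sum_sub_distrib]
  apply sum_congr rfl; intro j _
  rw [← mul_sum, ← mul_sum, ← mul_sub]
  simp [lam, psv]

lemma wey_pow' (k s P : ℕ) (c : Fin k → ℝ) :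
    ‖wey k P c‖ ^ (2*s) = ‖∑ q, ee (∑ j, c j * (lam k s P q j : ℝ))‖ := by
  rw [← wey_pow, Complex.norm_real, Real.norm_of_nonneg (by positivity)]

lemma pow_sum_le' {ι : Type*} (t : Finset ι) (g : ι → ℝ) (hg : ∀ a, 0 ≤ g a) (n : ℕ) (hn : 1 ≤ n) :
    (∑ a ∈ t, g a) ^ n ≤ (#t:ℝ) ^ (n-1) * ∑ a ∈ t, g a ^ n := by
  obtain ⟨m, rfl⟩ := Nat.exists_eq_add_of_le' hn
  have h := pow_sum_div_card_le_sum_pow (s := t) (f := g) (n := m) (fun a _ => hg a)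
  rcases t.eq_empty_or_nonempty with rfl | ht
  · simp
  have := ht.card_pos
  rw [div_le_iff₀ (by positivity)] at h
  simpa [mul_comm] using h

/-- Multiplicity. -/
def mult (k s P : ℕ) (l : Fin k → ℤ) : ℕ := #{q | lam k s P q = l}

lemma mult_le (k s P : ℕ) (l : Fin k → ℤ) : mult k s P l ≤ J k s P := by
  refine le_trans (le_of_eq ?_) (diff_cnt (fun x : Fin s → Fin P => psv k (fun i => ((x i : ℕ) : ℤ))) l)
  unfold mult lam
  congr 1
  ext q
  simp [sub_eq_iff_eq_add, add_comm]

/-- The box of frequencies. -/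
noncomputable def box (k s P : ℕ) : Finset (Fin k → ℤ) :=
  Fintype.piFinset fun j : Fin k => Icc (-((s * P^(j.1+1) : ℕ):ℤ)) ((s * P^(j.1+1) : ℕ):ℤ)

lemma lam_mem (k s P : ℕ) (q) : lam k s P q ∈ box k s P := by
  rw [box, Fintype.mem_piFinset]
  intro j
  rw [mem_Icc]
  have h : ∀ x : Fin s → Fin P, 0 ≤ psv k (fun i => ((x i : ℕ):ℤ)) j ∧
      psv k (fun i => ((x i : ℕ):ℤ)) j ≤ ((s * P^(j.1+1) : ℕ):ℤ) := by
    intro x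
    refine ⟨sum_nonneg fun i _ => by positivity, ?_⟩
    unfold psv
    calc ∑ i, ((x i : ℕ):ℤ)^(j.1+1) ≤ ∑ i : Fin s, (P:ℤ)^(j.1+1) := by
          apply sum_le_sum; intro i _; gcongr; exact (x i).2.le
      _ = _ := by simp
  have h1 := h q.1
  have h2 := h q.2
  simp only [lam, Pi.sub_apply]
  constructor <;> linarith

lemma sum_lam (k s P : ℕ) (h : (Fin k → ℤ) → ℝ) :
    ∑ q, h (lam k s P q) = ∑ l ∈ box k s P, mult k s P l * h l := by
  rw [← sum_fiberwise_of_maps_to (s := univ) (t := box k s P) (g := lam k s P) (fun q _ => lam_mem k s P q)]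
  apply sum_congr rfl; intro l _
  rw [sum_congr rfl (g := fun _ => h l) (by intro q hq; simp only [mem_filter] at hq; rw [hq.2])]
  rw [sum_const, nsmul_eq_mul, mult]

lemma sum_mult (k s P : ℕ) : ∑ l ∈ box k s P, (mult k s P l : ℝ) = (P:ℝ)^(2*s) := by
  have := sum_lam k s P (fun _ => 1)
  simp only [mul_one] at this
  rw [← this]
  simp [Fintype.card_prod]
  ring

/-- The bilinear Weyl sum. -/
noncomputable def bwey (k P : ℕ) (α : Fin k → ℝ) : ℂ :=
  ∑ u : Fin P, wey k P (fun j => α j * (u.1:ℝ)^(j.1+1))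

/-- The linear average. -/
noncomputable def linB (α : ℝ) (L : ℕ) : ℝ :=
  ∑ m ∈ Icc (-(L:ℤ)) L, ‖∑ l ∈ Icc (-(L:ℤ)) L, ee (α * l * m)‖

lemma g_bound (k s P : ℕ) (α : Fin k → ℝ) :
    ∑ l ∈ box k s P, ‖wey k P (fun j => α j * l j)‖^(2*s) ≤ J k s P * ∏ j : Fin k, linB (α j) (s*P^(j.1+1)) := by
  classical
  have h1 : ((∑ l ∈ box k s P, ‖wey k P (fun j => α j * l j)‖^(2*s) : ℝ) : ℂ) =
      ∑ q, ∏ j : Fin k, ∑ l ∈ Icc (-((s * P^(j.1+1) : ℕ):ℤ)) ((s * P^(j.1+1) : ℕ):ℤ),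
        ee (α j * l * (lam k s P q j : ℝ)) := by
    rw [Complex.ofReal_sum]
    simp only [wey_pow]
    rw [sum_comm]
    apply sum_congr rfl; intro q _
    rw [prod_univ_sum]
    apply sum_congr rfl; intro l _
    rw [ee_sum]
  have h2 : ∑ l ∈ box k s P, ‖wey k P (fun j => α j * l j)‖^(2*s) ≤
      ∑ q, ∏ j : Fin k, ‖∑ l ∈ Icc (-((s * P^(j.1+1) : ℕ):ℤ)) ((s * P^(j.1+1) : ℕ):ℤ),
        ee (α j * l * (lam k s P q j : ℝ))‖ := by
    have h3 : ‖((∑ l ∈ box k s P, ‖wey k P (fun j => α j * l j)‖^(2*s) : ℝ) : ℂ)‖ =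
      ∑ l ∈ box k s P, ‖wey k P (fun j => α j * l j)‖^(2*s) := by
      rw [Complex.norm_real, Real.norm_of_nonneg (sum_nonneg fun _ _ => by positivity)]
    rw [← h3, h1]
    refine (norm_sum_le _ _).trans (le_of_eq ?_)
    simp only [norm_prod]
  refine h2.trans ?_
  rw [sum_lam k s P (fun m => ∏ j : Fin k, ‖∑ l ∈ Icc (-((s * P^(j.1+1) : ℕ):ℤ)) ((s * P^(j.1+1) : ℕ):ℤ),
        ee (α j * l * (m j : ℝ))‖)]
  unfold linB
  rw [prod_univ_sum, mul_sum]
  change ∑ l ∈ box k s P, _ ≤ ∑ l ∈ box k s P, _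
  apply sum_le_sum; intro l _
  refine mul_le_mul_of_nonneg_right ?_ (prod_nonneg fun _ _ => norm_nonneg _)
  exact_mod_cast mult_le k s P l

lemma linB_nonneg (α : ℝ) (L : ℕ) : 0 ≤ linB α L := sum_nonneg fun _ _ => norm_nonneg _

lemma Z_bound (k s P : ℕ) (hs : 1 ≤ s) (α : Fin k → ℝ) :
    (∑ u : Fin P, ‖wey k P (fun j => α j * (u.1:ℝ)^(j.1+1))‖^(2*s))^(2*s) ≤
      (P:ℝ)^(2*s*(2*s-1)) * (J k s P)^2 * ∏ j : Fin k, linB (α j) (s*P^(j.1+1)) := by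
  classical
  set Z := ∑ u : Fin P, ‖wey k P (fun j => α j * (u.1:ℝ)^(j.1+1))‖^(2*s) with hZ
  have hZ0 : 0 ≤ Z := sum_nonneg fun _ _ => by positivity
  set g : (Fin k → ℤ) → ℝ := fun l => ‖wey k P (fun j => α j * l j)‖ with hg
  have h1 : Z ≤ ∑ q, g (lam k s P q) := by
    have e1 : ((Z:ℝ):ℂ) = ∑ q, wey k P (fun j => α j * (lam k s P q j)) := by
      rw [hZ, Complex.ofReal_sum]
      simp only [wey_pow]
      rw [sum_comm]
      apply sum_congr rfl; intro q _
      unfold wey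
      apply sum_congr rfl; intro u _
      congr 1
      apply sum_congr rfl; intro j _
      ring
    have e2 : ‖((Z:ℝ):ℂ)‖ = Z := by rw [Complex.norm_real, Real.norm_of_nonneg hZ0]
    rw [← e2, e1]
    exact norm_sum_le _ _
  have h2 : Z^s ≤ (P:ℝ)^(2*s*(s-1)) * ∑ l ∈ box k s P, mult k s P l * g l ^ s := by
    refine (pow_le_pow_left₀ hZ0 h1 s).trans ((pow_sum_le' _ _ (fun q => norm_nonneg _) s hs).trans (le_of_eq ?_))
    rw [sum_lam k s P (fun l => g l ^ s)]
    congr 1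
    simp only [card_univ, Fintype.card_prod, Fintype.card_fun, Fintype.card_fin]
    push_cast
    rw [← pow_add, ← pow_mul]
    congr 1; ring
  have h3 : (∑ l ∈ box k s P, mult k s P l * g l ^ s)^2 ≤
      (∑ l ∈ box k s P, (mult k s P l:ℝ)^2) * ∑ l ∈ box k s P, (g l ^ s)^2 := sum_mul_sq_le_sq_mul_sq _ _ _
  have h4 : ∑ l ∈ box k s P, (mult k s P l:ℝ)^2 ≤ J k s P * (P:ℝ)^(2*s) := by
    rw [← sum_mult k s P, mul_sum]
    apply sum_le_sum; intro l _
    rw [sq]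
    gcongr
    exact mult_le k s P l
  have h5 := g_bound k s P α
  have h6 : ∑ l ∈ box k s P, (g l ^ s)^2 = ∑ l ∈ box k s P, ‖wey k P (fun j => α j * l j)‖^(2*s) := by
    apply sum_congr rfl; intro l _; rw [hg, ← pow_mul, mul_comm s 2]
  rw [← h6] at h5
  have hB : 0 ≤ ∏ j : Fin k, linB (α j) (s*P^(j.1+1)) := prod_nonneg fun _ _ => linB_nonneg _ _
  calc Z^(2*s) = (Z^s)^2 := by ring
    _ ≤ ((P:ℝ)^(2*s*(s-1)) * ∑ l ∈ box k s P, mult k s P l * g l ^ s)^2 := by gcongr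
    _ = ((P:ℝ)^(2*s*(s-1)))^2 * (∑ l ∈ box k s P, mult k s P l * g l ^ s)^2 := by ring
    _ ≤ ((P:ℝ)^(2*s*(s-1)))^2 * ((J k s P * (P:ℝ)^(2*s)) * (J k s P * ∏ j : Fin k, linB (α j) (s*P^(j.1+1)))) := by
      refine mul_le_mul_of_nonneg_left (h3.trans ?_) (by positivity)
      exact mul_le_mul h4 h5 (sum_nonneg fun _ _ => by positivity) (by positivity)
    _ = _ := by
      have : (P:ℝ)^(2*s*(2*s-1)) = ((P:ℝ)^(2*s*(s-1)))^2 * (P:ℝ)^(2*s) := by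
        rw [← pow_mul, ← pow_add]; congr 1
        obtain ⟨m, rfl⟩ := Nat.exists_eq_add_of_le' hs
        rw [show 2*(m+1)-1 = 2*m+1 by omega, Nat.add_sub_cancel]; ring
      rw [this]; ring

theorem bwey_bound (k s P : ℕ) (hs : 1 ≤ s) (α : Fin k → ℝ) :
    ‖bwey k P α‖^(4*s^2) ≤ (P:ℝ)^(8*s^2-4*s) * (J k s P)^2 * ∏ j : Fin k, linB (α j) (s*P^(j.1+1)) := by
  have h1 : ‖bwey k P α‖^(2*s) ≤ (P:ℝ)^(2*s-1) * ∑ u : Fin P, ‖wey k P (fun j => α j * (u.1:ℝ)^(j.1+1))‖^(2*s) := by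
    refine (pow_le_pow_left₀ (norm_nonneg _) (norm_sum_le _ _) _).trans ?_
    have := pow_sum_le (fun u : Fin P => ‖wey k P (fun j => α j * (u.1:ℝ)^(j.1+1))‖) (fun _ => norm_nonneg _)
      (2*s) (by omega)
    exact this
  have h2 := Z_bound k s P hs α
  calc ‖bwey k P α‖^(4*s^2) = (‖bwey k P α‖^(2*s))^(2*s) := by ring
    _ ≤ ((P:ℝ)^(2*s-1) * ∑ u : Fin P, ‖wey k P (fun j => α j * (u.1:ℝ)^(j.1+1))‖^(2*s))^(2*s) := by gcongr
    _ = ((P:ℝ)^(2*s-1))^(2*s) * (∑ u : Fin P, ‖wey k P (fun j => α j * (u.1:ℝ)^(j.1+1))‖^(2*s))^(2*s) := by ring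
    _ ≤ ((P:ℝ)^(2*s-1))^(2*s) * ((P:ℝ)^(2*s*(2*s-1)) * (J k s P)^2 * ∏ j : Fin k, linB (α j) (s*P^(j.1+1))) := by
      gcongr
    _ = _ := by
      have : (P:ℝ)^(8*s^2-4*s) = ((P:ℝ)^(2*s-1))^(2*s) * (P:ℝ)^(2*s*(2*s-1)) := by
        rw [← pow_mul, ← pow_add]; congr 1
        obtain ⟨m, rfl⟩ := Nat.exists_eq_add_of_le' hs
        rw [show 2*(m+1)-1 = 2*m+1 by omega]
        rw [Nat.sub_eq_iff_eq_add (by nlinarith)]; ring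
      rw [this]; ring

end VK

namespace VK

open Finset

lemma ee_int (n : ℤ) : ee n = 1 := by
  unfold ee
  rw [Complex.exp_eq_one_iff]
  exact ⟨n, by push_cast; ring⟩

lemma ee_mul_int (θ : ℝ) (n : ℤ) : ee (θ * n) = ee (θ) ^ n := by
  unfold ee
  rw [← Complex.exp_int_mul]; congr 1; push_cast; ring

/-- Distance to the nearest integer. -/
noncomputable def nd (x : ℝ) : ℝ := |x - round x|

lemma nd_nonneg (x : ℝ) : 0 ≤ nd x := abs_nonneg _

lemma nd_le_half (x : ℝ) : nd x ≤ 1/2 := abs_sub_round x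

lemma nd_le (x : ℝ) (n : ℤ) : nd x ≤ |x - n| := round_le x n

lemma norm_ee_sub_one (θ : ℝ) : 4 * nd θ ≤ ‖ee θ - 1‖ := by
  have h1 : ee θ = ee (θ - round θ) := by
    conv_lhs => rw [show θ = (θ - round θ) + (round θ : ℤ) by ring]
    rw [ee_add, ee_int, mul_one]
  set t := θ - round θ with ht
  have ht2 : |t| ≤ 1/2 := abs_sub_round θ
  have h2 : ‖ee t - 1‖ = ‖2 * Real.sin (2*Real.pi*t/2)‖ := by
    have := Complex.norm_exp_I_mul_ofReal_sub_one (2*Real.pi*t)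
    rw [← this]
    unfold ee
    rw [mul_comm]
  rw [h1, h2]
  have h3 : 2*Real.pi*t/2 = Real.pi * t := by ring
  rw [h3, Real.norm_eq_abs, abs_mul, abs_two]
  have h4 : |Real.sin (Real.pi*t)| = Real.sin (Real.pi * |t|) := by
    rcases abs_cases t with ⟨h, h'⟩ | ⟨h, h'⟩
    · rw [h, abs_of_nonneg]
      apply Real.sin_nonneg_of_nonneg_of_le_pi <;> nlinarith [Real.pi_pos, abs_le.mp ht2]
    · rw [h, mul_neg, Real.sin_neg, abs_of_nonpos]
      have := Real.sin_nonneg_of_nonneg_of_le_pi (x := Real.pi * (-t)) (by nlinarith [Real.pi_pos])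
        (by nlinarith [Real.pi_pos, abs_le.mp ht2])
      rw [mul_neg, Real.sin_neg] at this
      linarith
  rw [h4]
  have h5 := Real.mul_le_sin (x := Real.pi * |t|) (by positivity) (by nlinarith [Real.pi_pos])
  have h6 : 2/Real.pi*(Real.pi*|t|) = 2 * |t| := by field_simp
  rw [h6] at h5
  change 4 * |t| ≤ _
  linarith

lemma geom_bound (θ : ℝ) (a b : ℤ) (hθ : 0 < nd θ) :
    ‖∑ l ∈ Ico a b, ee (θ * l)‖ ≤ 1 / (2 * nd θ) := by
  have h1 := norm_ee_sub_one θ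
  have hz : ee θ ≠ 1 := by
    intro h; rw [h] at h1; simp at h1; linarith
  have hz0 : ee θ ≠ 0 := by
    intro h; have := norm_ee θ; rw [h] at this; simp at this
  rcases lt_or_ge a b with hab | hab
  swap
  · rw [Ico_eq_empty (by omega)]; simp; positivity
  have h2 : (∑ l ∈ Ico a b, ee (θ * l)) * (ee θ - 1) = ee (θ*b) - ee (θ*a) := by
    obtain ⟨n, rfl⟩ : ∃ n : ℕ, b = a + n := ⟨(b-a).toNat, by omega⟩
    clear hab
    induction n with
    | zero => simp
    | succ n ih =>
      have : Ico a (a + ((n+1:ℕ):ℤ)) = insert (a+n) (Ico a (a+n)) := by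
        ext x; simp only [mem_Ico, mem_insert]; omega
      rw [this, sum_insert (by simp), add_mul, ih]
      push_cast
      rw [show θ*((a:ℝ)+(n+1)) = θ*((a:ℝ)+n) + θ by ring, ee_add]
      ring
  have h3 : ‖∑ l ∈ Ico a b, ee (θ * l)‖ * ‖ee θ - 1‖ ≤ 2 := by
    rw [← norm_mul, h2]
    refine (norm_sub_le _ _).trans ?_
    simp only [norm_ee]; norm_num
  rw [le_div_iff₀ (by positivity)]
  nlinarith [norm_nonneg (∑ l ∈ Ico a b, ee (θ * l))]

lemma card_real_interval (S : Finset ℤ) (x y : ℝ) (hxy : x ≤ y) (h : ∀ m ∈ S, x ≤ m ∧ (m:ℝ) ≤ y) :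
    (#S : ℝ) ≤ y - x + 1 := by
  have h1 : S ⊆ Icc ⌈x⌉ ⌊y⌋ := by
    intro m hm
    rw [mem_Icc]
    exact ⟨Int.ceil_le.2 (h m hm).1, Int.le_floor.2 (h m hm).2⟩
  have h2 := card_le_card h1
  rw [Int.card_Icc] at h2
  have h3 : ((⌊y⌋ + 1 - ⌈x⌉).toNat : ℝ) ≤ y - x + 1 := by
    rcases le_total 0 (⌊y⌋ + 1 - ⌈x⌉) with hh | hh
    · have : ((⌊y⌋ + 1 - ⌈x⌉).toNat : ℝ) = ((⌊y⌋ + 1 - ⌈x⌉ : ℤ) : ℝ) := by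
        exact_mod_cast congrArg (Int.cast (R := ℝ)) (Int.toNat_of_nonneg hh)
      rw [this]; push_cast
      linarith [Int.floor_le y, Int.le_ceil x]
    · rw [Int.toNat_of_nonpos hh]; push_cast; linarith
  exact le_trans (by exact_mod_cast h2) h3

lemma count_small (α δ : ℝ) (hα : 0 < α) (hδ : 0 < δ) (hδ1 : δ ≤ 1) (L : ℝ) (hL : 0 ≤ L) (S : Finset ℤ)
    (hS : ∀ m ∈ S, |(m:ℝ)| ≤ L ∧ nd (α * m) ≤ δ) :
    (#S : ℝ) ≤ (2*δ/α + 1) * (2*L*α+3) := by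
  classical
  have h1 : ∀ N ∈ S.image (fun m : ℤ => round (α * m)), #(S.filter fun m : ℤ => round (α * (m:ℝ)) = N) ≤ ⌊2*δ/α + 1⌋₊ := by
    intro N _
    apply Nat.le_floor
    have := card_real_interval (S.filter fun m : ℤ => round (α * (m:ℝ)) = N) ((N-δ)/α) ((N+δ)/α) (by gcongr; linarith) ?_
    · refine this.trans (le_of_eq ?_)
      field_simp; ring
    · intro m hm
      rw [mem_filter] at hm
      have h := (hS m hm.1).2
      unfold nd at h
      rw [hm.2, abs_le] at h
      constructor
      · rw [div_le_iff₀ hα]; linarith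
      · rw [le_div_iff₀ hα]; linarith
  have h2 := card_le_mul_card_image S _ h1
  have h3 : (#(S.image (fun m : ℤ => round (α * m))) : ℝ) ≤ 2*L*α+3 := by
    have := card_real_interval (S.image (fun m : ℤ => round (α * m))) (-(α*L+1)) (α*L+1) (by nlinarith [mul_nonneg hα.le hL]) ?_
    · linarith
    · intro N hN
      rw [mem_image] at hN
      obtain ⟨m, hm, rfl⟩ := hN
      obtain ⟨ha, hb⟩ := hS m hm
      unfold nd at hb
      rw [abs_le] at ha hb
      constructor <;> nlinarith
  have h4 : (#S:ℝ) ≤ (⌊2*δ/α + 1⌋₊ : ℝ) * (#(S.image (fun m : ℤ => round (α * m))) : ℝ) := by exact_mod_cast h2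
  refine h4.trans ?_
  have h5 : (⌊2*δ/α + 1⌋₊ : ℝ) ≤ 2*δ/α + 1 := Nat.floor_le (by positivity)
  exact mul_le_mul h5 h3 (by positivity) (by positivity)

lemma linB_triv (α : ℝ) (L : ℕ) : linB α L ≤ (2*L+1)^2 := by
  have hc : (#(Icc (-(L:ℤ)) L) : ℝ) = 2*L+1 := by
    rw [Int.card_Icc]
    have : ((L:ℤ)+1 - -(L:ℤ)).toNat = 2*L+1 := by omega
    rw [this]; push_cast; ring
  unfold linB
  calc _ ≤ ∑ m ∈ Icc (-(L:ℤ)) L, (2*L+1:ℝ) := by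
        apply sum_le_sum; intro m _
        refine (norm_sum_le _ _).trans (le_of_eq ?_)
        simp only [norm_ee, sum_const, nsmul_eq_mul, mul_one]; exact hc
    _ = _ := by rw [sum_const, nsmul_eq_mul, hc]; ring

lemma linB_bound (α : ℝ) (L : ℕ) (hα : 0 < α) (hα1 : α ≤ 1) (hL : 1 ≤ L) :
    linB α L ≤ 5 * (2*L+1)^2 * (Real.sqrt α + 1 / (L * Real.sqrt α)) := by
  have hc : (#(Icc (-(L:ℤ)) L) : ℝ) = 2*L+1 := by
    rw [Int.card_Icc]
    have : ((L:ℤ)+1 - -(L:ℤ)).toNat = 2*L+1 := by omega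
    rw [this]; push_cast; ring
  have hL' : (1:ℝ) ≤ L := by exact_mod_cast hL
  set δ := Real.sqrt α with hδ
  have hδ0 : 0 < δ := Real.sqrt_pos.2 hα
  have hδ2 : δ * δ = α := Real.mul_self_sqrt hα.le
  have hδ1 : δ ≤ 1 := by nlinarith
  set S := (Icc (-(L:ℤ)) L).filter (fun m : ℤ => nd (α * m) ≤ δ) with hS
  have h1 := count_small α δ hα hδ0 hδ1 L (by positivity) S (by
    intro m hm
    rw [hS, mem_filter, mem_Icc] at hm
    refine ⟨?_, hm.2⟩
    rw [abs_le]
    exact ⟨by exact_mod_cast hm.1.1, by exact_mod_cast hm.1.2⟩)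
  have h2 : linB α L ≤ (#S) * (2*L+1) + (2*L+1) * (1/(2*δ)) := by
    unfold linB
    calc _ ≤ ∑ m ∈ Icc (-(L:ℤ)) L, ((if nd (α * m) ≤ δ then (2*L+1:ℝ) else 0) + 1/(2*δ)) := by
          apply sum_le_sum; intro m _
          split_ifs with h
          · refine (norm_sum_le _ _).trans ?_
            simp only [norm_ee, sum_const, nsmul_eq_mul, mul_one]
            rw [hc]
            have : 0 ≤ 1/(2*δ) := by positivity
            linarith
          · push Not at h
            have hb := geom_bound (α*m) (-L) (L+1) (hδ0.trans h)
            rw [zero_add]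
            have e : Icc (-(L:ℤ)) L = Ico (-(L:ℤ)) (L+1) := by ext x; simp only [mem_Icc, mem_Ico]; omega
            rw [e]
            refine le_trans (le_of_eq ?_) (hb.trans ?_)
            · congr 1; apply sum_congr rfl; intro l _; congr 1; ring
            · gcongr
      _ = _ := by
          rw [sum_add_distrib, ← sum_filter, sum_const, sum_const, nsmul_eq_mul, nsmul_eq_mul, hc]
  refine h2.trans ?_
  have e1 : 2*δ/α = 2/δ := by rw [← hδ2]; field_simp
  rw [e1] at h1
  have h3 : (#S:ℝ) ≤ 6*L*δ + 9/δ := by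
    refine h1.trans ?_
    have : 2/δ + 1 ≤ 3/δ := by
      rw [div_add_one hδ0.ne', div_le_div_iff_of_pos_right hδ0]; linarith
    calc (2/δ + 1) * (2*L*α+3) ≤ (3/δ) * (2*L*α+3) := by gcongr
      _ = _ := by rw [← hδ2]; field_simp; ring
  have h4 : (#S) * (2*L+1) + (2*L+1) * (1/(2*δ)) ≤ (6*L*δ + 9/δ) * (2*L+1) + (2*L+1) * (1/(2*δ)) := by gcongr
  refine h4.trans ?_
  have h5 : (6*L*δ + 9/δ) * (2*L+1) + (2*L+1) * (1/(2*δ)) = (2*L+1) * (6*L*δ + 19/2/δ) := by field_simp; ring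
  rw [h5]
  have h6 : 6*L*δ + 19/2/δ ≤ 5 * (2*L+1) * (δ + 1/(L*δ)) := by
    have e : 5 * (2*L+1) * (δ + 1/(L*δ)) = (10*L+5)*δ + 10/δ + 5/(L*δ) := by field_simp; ring
    rw [e]
    have : 0 ≤ 5/(L*δ) := by positivity
    have : 19/2/δ ≤ 10/δ := by gcongr; norm_num
    nlinarith
  calc (2*L+1) * (6*L*δ + 19/2/δ) ≤ (2*L+1) * (5 * (2*L+1) * (δ + 1/(L*δ))) := by gcongr
    _ = _ := by ring

lemma linB_neg (α : ℝ) (L : ℕ) : linB (-α) L = linB α L := by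
  unfold linB
  apply sum_congr rfl; intro m _
  have : (∑ l ∈ Icc (-(L:ℤ)) L, ee (-α * l * m)) = (starRingEnd ℂ) (∑ l ∈ Icc (-(L:ℤ)) L, ee (α * l * m)) := by
    rw [map_sum]; apply sum_congr rfl; intro l _; rw [← ee_neg]; congr 1; ring
  rw [this, Complex.norm_conj]

lemma linB_bound' (α : ℝ) (L : ℕ) (hα : 0 < |α|) (hα1 : |α| ≤ 1) (hL : 1 ≤ L) :
    linB α L ≤ 5 * (2*L+1)^2 * (Real.sqrt |α| + 1 / (L * Real.sqrt |α|)) := by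
  have : linB α L = linB |α| L := by
    rcases abs_cases α with ⟨h, _⟩ | ⟨h, _⟩ <;> rw [h]
    rw [linB_neg]
  rw [this]
  exact linB_bound _ L hα hα1 hL

end VK

namespace VK

open Finset

/-- Useful degrees. -/
def useful (t : ℝ) (j : ℕ) : Prop := 5*t/4 ≤ j+1 ∧ (j:ℝ)+1 ≤ 8*t/3

open Classical in
lemma useful_card (t : ℝ) (ht : 1/2 ≤ t) (k : ℕ) (hk : 3*t ≤ k) :
    t/2 ≤ #{j : Fin k | useful t j.1} := by
  set a := ⌈5*t/4⌉₊ with ha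
  set b := ⌊8*t/3⌋₊ with hb
  have ha1 : (a:ℝ) < 5*t/4 + 1 := Nat.ceil_lt_add_one (by linarith)
  have ha2 : 5*t/4 ≤ a := Nat.le_ceil _
  have hb1 : (b:ℝ) ≤ 8*t/3 := Nat.floor_le (by linarith)
  have hb2 : 8*t/3 < b + 1 := Nat.lt_floor_add_one _
  have hapos : 1 ≤ a := by
    have : (0:ℝ) < a := by linarith
    exact_mod_cast this
  have hbk : b ≤ k := by
    have : (b:ℝ) ≤ k := by linarith
    exact_mod_cast this
  have h1 : #(Icc a b) ≤ #{j : Fin k | useful t j.1} := by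
    refine card_le_card_of_injOn (fun i => if h : i - 1 < k then ⟨i-1, h⟩ else ⟨0, by
        have : (0:ℝ) < k := by linarith
        exact_mod_cast this⟩) ?_ ?_
    · intro i hi
      have hi' : a ≤ i ∧ i ≤ b := by simpa using hi
      have hh : i - 1 < k := by omega
      simp only [hh, dif_pos, coe_filter, mem_univ, true_and]
      change useful t (i-1)
      have h3 : ((i-1:ℕ):ℝ) = i - 1 := by rw [Nat.cast_sub (by omega)]; simp
      unfold useful
      rw [h3]
      have h4 : (a:ℝ) ≤ i := by exact_mod_cast hi'.1
      have h5 : (i:ℝ) ≤ b := by exact_mod_cast hi'.2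
      constructor <;> linarith
    · intro i hi i' hi' h
      have hi : a ≤ i ∧ i ≤ b := by simpa using hi
      have hi' : a ≤ i' ∧ i' ≤ b := by simpa using hi'
      have hh : i - 1 < k := by omega
      have hh' : i' - 1 < k := by omega
      simp only [hh, hh', dif_pos, Fin.mk.injEq] at h
      omega
  rw [Nat.card_Icc] at h1
  have h2 : ((b + 1 : ℕ):ℝ) - a ≤ ((b + 1 - a : ℕ):ℝ) := by
    rw [sub_le_iff_le_add]; exact_mod_cast (by omega : b + 1 ≤ b + 1 - a + a)
  push_cast at h2
  have h3 : ((b + 1 - a : ℕ):ℝ) ≤ #{j : Fin k | useful t j.1} := by exact_mod_cast h1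
  rcases le_or_gt (12/11) t with h | h
  · linarith
  · have h4 : 1 ≤ b + 1 - a := by
      rcases le_or_gt t (4/5) with h5 | h5
      · have : a ≤ 1 := by rw [ha, Nat.ceil_le]; push_cast; linarith
        have : 1 ≤ b := by rw [hb]; apply Nat.le_floor; push_cast; linarith
        omega
      · have : (0:ℝ) < ((b + 1 - a : ℕ):ℝ) := by linarith
        exact_mod_cast this
    have : (1:ℝ) ≤ ((b + 1 - a : ℕ):ℝ) := by exact_mod_cast h4
    linarith

lemma saving (M t : ℝ) (hM : 1 ≤ M) (ht : 1/2 ≤ t) (k i P L : ℕ) (hi : 1 ≤ i) (hik : i ≤ k) (n : ℝ) (hn : M ≤ n) (hn8 : n ≤ 8*M)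
    (h1 : 5*t/4 ≤ i) (h2 : (i:ℝ) ≤ 8*t/3) (hP : M^((1:ℝ)/3)/2 ≤ P) (hL : P^i ≤ L) (hP1 : 1 ≤ P)
    (α : ℝ) (hα : |α| = M^(1+t)/n^(i+1)) :
    linB α L ≤ (2*L+1)^2 * (16^(k+2) * M^(-(t/18))) := by
  have hM0 : 0 < M := by linarith
  have hn0 : 0 < n := by linarith
  have hL1 : 1 ≤ L := le_trans (Nat.one_le_pow _ _ hP1) hL
  have ha0 : 0 < |α| := by rw [hα]; positivity
  have hup : |α| ≤ M^(t - i) := by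
    rw [hα]
    calc M^(1+t)/n^(i+1) ≤ M^(1+t)/M^(i+1) := by gcongr
      _ = M^(t-i) := by
        rw [← Real.rpow_natCast M (i+1), ← Real.rpow_sub hM0]; congr 1; push_cast; ring
  have hup2 : |α| ≤ M^(-(t/4)) := hup.trans (Real.rpow_le_rpow_of_exponent_le hM (by linarith))
  have hup1 : |α| ≤ 1 := hup2.trans (Real.rpow_le_one_of_one_le_of_nonpos hM (by linarith))
  have hlow : M^(t-i) / 8^(i+1) ≤ |α| := by
    rw [hα]
    calc M^(t-i) / 8^(i+1) = M^(1+t)/(8*M)^(i+1) := by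
          rw [mul_pow, ← Real.rpow_natCast M (i+1), mul_comm, ← div_div, ← Real.rpow_sub hM0]
          congr 2; push_cast; ring
      _ ≤ _ := by gcongr
  have hb := linB_bound' α L ha0 hup1 hL1
  refine hb.trans ?_
  have s1 : Real.sqrt |α| ≤ M^(-(t/18)) := by
    calc Real.sqrt |α| ≤ Real.sqrt (M^(-(t/4))) := Real.sqrt_le_sqrt hup2
      _ = M^(-(t/8)) := by rw [Real.sqrt_eq_rpow, ← Real.rpow_mul hM0.le]; congr 1; ring
      _ ≤ _ := Real.rpow_le_rpow_of_exponent_le hM (by linarith)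
  have s2 : M^((t-i)/2) / 4^(i+1) ≤ Real.sqrt |α| := by
    apply Real.le_sqrt_of_sq_le
    refine le_trans ?_ hlow
    rw [div_pow, ← pow_mul, ← Real.rpow_natCast, ← Real.rpow_mul hM0.le]
    have e : (t-i)/2*((2:ℕ):ℝ) = t - i := by push_cast; ring
    rw [e]
    gcongr
    rw [mul_comm, pow_mul]
    gcongr
    norm_num
  have s3 : M^((i:ℝ)/3) / 2^i ≤ L := by
    calc M^((i:ℝ)/3) / 2^i = (M^((1:ℝ)/3)/2)^i := by
          rw [div_pow, ← Real.rpow_natCast (M^((1:ℝ)/3)), ← Real.rpow_mul hM0.le]; congr 2; ring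
      _ ≤ (P:ℝ)^i := by gcongr
      _ ≤ L := by exact_mod_cast hL
  have s4 : 1/(L * Real.sqrt |α|) ≤ 16^(k+1) * M^(-(t/18)) := by
    have hpos : 0 < Real.sqrt |α| := Real.sqrt_pos.2 ha0
    have hLpos : (0:ℝ) < L := by exact_mod_cast hL1
    calc 1/(L * Real.sqrt |α|) ≤ 1/((M^((i:ℝ)/3) / 2^i) * (M^((t-i)/2) / 4^(i+1))) := by gcongr
      _ = (2^i*4^(i+1)) * M^(-((i:ℝ)/3 + (t-i)/2)) := by
          rw [Real.rpow_neg hM0.le, Real.rpow_add hM0]; field_simp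
      _ ≤ 16^(k+1) * M^(-(t/18)) := by
          refine mul_le_mul ?_ (Real.rpow_le_rpow_of_exponent_le hM (by linarith)) (by positivity) (by positivity)
          calc (2:ℝ)^i*4^(i+1) ≤ 4^(i+1)*4^(i+1) := by
                gcongr
                calc (2:ℝ)^i ≤ 4^i := by gcongr; norm_num
                  _ ≤ 4^(i+1) := by gcongr <;> norm_num
            _ = 16^(i+1) := by rw [← mul_pow]; norm_num
            _ ≤ 16^(k+1) := by gcongr; norm_num
  have hMt : 0 < M^(-(t/18)) := by positivity
  have h16 : (1:ℝ) ≤ 16^(k+1) := one_le_pow₀ (by norm_num)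
  have : Real.sqrt |α| + 1/(L * Real.sqrt |α|) ≤ 2 * 16^(k+1) * M^(-(t/18)) := by nlinarith
  calc 5 * (2*L+1:ℝ)^2 * (Real.sqrt |α| + 1/(L * Real.sqrt |α|)) ≤ 5 * (2*L+1:ℝ)^2 * (2 * 16^(k+1) * M^(-(t/18))) := by gcongr
    _ = (2*L+1)^2 * (10 * 16^(k+1) * M^(-(t/18))) := by ring
    _ ≤ (2*L+1)^2 * (16 * 16^(k+1) * M^(-(t/18))) := by gcongr; norm_num
    _ = _ := by ring

lemma sum_fin_two (k : ℕ) : ∑ j : Fin k, 2*(j.1+1) = k*(k+1) := by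
  induction k with
  | zero => simp
  | succ k ih => rw [Fin.sum_univ_castSucc]; simp only [Fin.val_castSucc, Fin.val_last]; rw [ih]; ring

/-- A constant computation. -/
lemma const_comp (k : ℕ) (hk : 1 ≤ k) :
    (((4*k:ℝ)^(448*k^3))^2) * (9*((10*k^2:ℕ):ℝ)^2)^k * (16^(k+2))^k ≤ 64^(400*k^4) := by
  have hk' : (1:ℝ) ≤ k := by exact_mod_cast hk
  have h4 : (4*k:ℝ) ≤ 4^k := by
    have : 4 * k ≤ 4^k := by
      clear hk'
      induction k, hk using Nat.le_induction with
      | base => norm_num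
      | succ n hn ih => rw [pow_succ]; omega
    exact_mod_cast this
  have a1 : ((4*k:ℝ)^(448*k^3))^2 ≤ 4^(896*k^4) := by
    calc ((4*k:ℝ)^(448*k^3))^2 ≤ (((4:ℝ)^k)^(448*k^3))^2 := by gcongr
      _ = _ := by rw [← pow_mul, ← pow_mul]; congr 1; ring
  have hkk : k^2 ≤ k^4 := Nat.pow_le_pow_right hk (by norm_num)
  have hk1 : k ≤ k^2 := by nlinarith
  have a2 : (9*((10*k^2:ℕ):ℝ)^2)^k ≤ 4^(6*k^4) := by
    calc (9*((10*k^2:ℕ):ℝ)^2)^k ≤ (((4:ℝ)^k)^6)^k := by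
          gcongr
          push_cast
          calc 9*(10*(k:ℝ)^2)^2 = 900*(k:ℝ)^4 := by ring
            _ ≤ 4096*(k:ℝ)^6 := by
              have : (k:ℝ)^4 ≤ (k:ℝ)^6 := pow_le_pow_right₀ hk' (by norm_num)
              nlinarith [show (0:ℝ) ≤ (k:ℝ)^4 by positivity]
            _ = (4*(k:ℝ))^6 := by ring
            _ ≤ _ := by gcongr
      _ = 4^(6*k^2) := by rw [← pow_mul, ← pow_mul]; congr 1; ring
      _ ≤ _ := by gcongr; norm_num
  have a3 : ((16:ℝ)^(k+2))^k ≤ 4^(6*k^4) := by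
    calc ((16:ℝ)^(k+2))^k = 4^(2*(k+2)*k) := by
          rw [show (16:ℝ) = 4^2 by norm_num, ← pow_mul, ← pow_mul]; congr 1; ring
      _ ≤ _ := by
          apply pow_le_pow_right₀ (by norm_num)
          nlinarith
  calc _ ≤ (4:ℝ)^(896*k^4) * 4^(6*k^4) * 4^(6*k^4) := by gcongr
    _ = 4^(908*k^4) := by rw [← pow_add, ← pow_add]; congr 1; ring
    _ ≤ 4^(1200*k^4) := by apply pow_le_pow_right₀ (by norm_num); nlinarith
    _ = _ := by rw [show (64:ℝ) = 4^3 by norm_num, ← pow_mul]; congr 1; ring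

lemma bwey_save (M t : ℝ) (hM : 1 ≤ M) (ht : 1/2 ≤ t) (k P : ℕ) (hk3 : 3*t ≤ k) (hk5 : (k:ℝ) ≤ 5*t)
    (n : ℝ) (hn : M ≤ n) (hn8 : n ≤ 8*M) (hP : M^((1:ℝ)/3)/2 ≤ P) (hP' : (P:ℝ) ≤ M^((1:ℝ)/3)) (hP1 : 1 ≤ P)
    (α : Fin k → ℝ) (hα : ∀ j, |α j| = M^(1+t)/n^(j.1+1+1)) :
    ‖bwey k P α‖ ≤ 64 * (P:ℝ)^2 * M^(-(1/(600000*(k:ℝ)^2))) := by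
  classical
  have hM0 : 0 < M := by linarith
  have hk : 1 ≤ k := by
    have : (0:ℝ) < k := by linarith
    exact_mod_cast this
  have hk' : (1:ℝ) ≤ k := by exact_mod_cast hk
  have hPr : (1:ℝ) ≤ P := by exact_mod_cast hP1
  set s := 10*k^2 with hs
  have hs1 : 1 ≤ s := by have : 1 ≤ k^2 := Nat.one_le_pow _ _ hk; omega
  have h1 := bwey_bound k s P hs1 α
  have h2 := J_bound k hk P hP1
  set U := #{j : Fin k | useful t j.1} with hU
  have hUc : t/2 ≤ U := useful_card t ht k hk3
  have hUk : U ≤ k := (card_le_univ _).trans (by simp)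
  have h3 : ∏ j : Fin k, linB (α j) (s*P^(j.1+1)) ≤
      ((9*(s:ℝ)^2)^k * (P:ℝ)^(k*(k+1))) * ((16^(k+2))^k * M^(-(t^2/36))) := by
    calc ∏ j : Fin k, linB (α j) (s*P^(j.1+1)) ≤
        ∏ j : Fin k, ((9*(s:ℝ)^2 * (P:ℝ)^(2*(j.1+1))) * (if useful t j.1 then (16^(k+2) * M^(-(t/18))) else 1)) := by
          apply prod_le_prod (fun j _ => linB_nonneg _ _)
          intro j _
          have hbase : (2*((s*P^(j.1+1):ℕ):ℝ)+1)^2 ≤ 9*(s:ℝ)^2 * (P:ℝ)^(2*(j.1+1)) := by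
            have h5 : (1:ℝ) ≤ ((s*P^(j.1+1):ℕ):ℝ) := by
              exact_mod_cast Nat.mul_pos hs1 (Nat.pow_pos hP1)
            calc (2*((s*P^(j.1+1):ℕ):ℝ)+1)^2 ≤ (3*((s*P^(j.1+1):ℕ):ℝ))^2 := by gcongr; linarith
              _ = _ := by push_cast; ring
          split_ifs with hu
          · have hv := saving M t hM ht k (j.1+1) P (s*P^(j.1+1)) (by omega) (by have := j.2; omega) n hn hn8
              (by push_cast; exact hu.1) (by push_cast; exact hu.2) hP (Nat.le_mul_of_pos_left _ hs1) hP1 (α j) (hα j)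
            refine hv.trans ?_
            gcongr
          · rw [mul_one]
            exact (linB_triv _ _).trans hbase
      _ = ((9*(s:ℝ)^2)^k * (P:ℝ)^(k*(k+1))) * (16^(k+2) * M^(-(t/18)))^U := by
          rw [prod_mul_distrib, prod_mul_distrib, prod_const, prod_pow_eq_pow_sum, sum_fin_two, prod_ite, prod_const,
            prod_const_one, mul_one]
          simp [hU]
      _ ≤ _ := by
          rw [mul_pow ((16:ℝ)^(k+2))]
          have g1 : ((16:ℝ)^(k+2))^U ≤ ((16:ℝ)^(k+2))^k := pow_le_pow_right₀ (one_le_pow₀ (by norm_num)) hUk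
          refine mul_le_mul_of_nonneg_left (mul_le_mul g1 ?_
            (by positivity) (by positivity)) (by positivity)
          rw [← Real.rpow_natCast, ← Real.rpow_mul hM0.le]
          apply Real.rpow_le_rpow_of_exponent_le hM
          nlinarith
  have hEx : (P:ℝ)^(8*s^2-4*s) * ((P:ℝ)^(20*k^2 - k*(k+1)/2 + k^2/2000 : ℝ))^2 * (P:ℝ)^(k*(k+1))
      = (P:ℝ)^(8*s^2) * (P:ℝ)^((k:ℝ)^2/1000) := by
    rw [← Real.rpow_natCast (P:ℝ) (8*s^2-4*s), ← Real.rpow_natCast (P:ℝ) (k*(k+1)), ← Real.rpow_natCast (P:ℝ) (8*s^2),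
      ← Real.rpow_natCast _ 2, ← Real.rpow_mul (by positivity), ← Real.rpow_add (by positivity),
      ← Real.rpow_add (by positivity), ← Real.rpow_add (by positivity)]
    congr 1
    rw [Nat.cast_sub (by nlinarith), hs]
    push_cast
    ring
  have hPM : (P:ℝ)^((k:ℝ)^2/1000) ≤ M^(t^2/120) := by
    calc (P:ℝ)^((k:ℝ)^2/1000) ≤ (M^((1:ℝ)/3))^((k:ℝ)^2/1000) := by gcongr
      _ = M^((k:ℝ)^2/3000) := by rw [← Real.rpow_mul hM0.le]; congr 1; ring
      _ ≤ _ := by apply Real.rpow_le_rpow_of_exponent_le hM; nlinarith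
  have hfin : ‖bwey k P α‖^(4*s^2) ≤ (64 * (P:ℝ)^2 * M^(-(1/(600000*(k:ℝ)^2))))^(4*s^2) := by
    have hJ2 : ((J k s P:ℕ):ℝ)^2 ≤ ((4*k:ℝ)^(448*k^3) * (P:ℝ)^(20*k^2 - k*(k+1)/2 + k^2/2000 : ℝ))^2 := by gcongr
    calc ‖bwey k P α‖^(4*s^2) ≤ _ := h1
      _ ≤ (P:ℝ)^(8*s^2-4*s) * ((4*k:ℝ)^(448*k^3) * (P:ℝ)^(20*k^2 - k*(k+1)/2 + k^2/2000 : ℝ))^2 *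
          (((9*(s:ℝ)^2)^k * (P:ℝ)^(k*(k+1))) * ((16^(k+2))^k * M^(-(t^2/36)))) := by
        refine mul_le_mul (mul_le_mul_of_nonneg_left hJ2 (by positivity)) h3
          (prod_nonneg fun _ _ => linB_nonneg _ _) (by positivity)
      _ = ((((4*k:ℝ)^(448*k^3))^2) * (9*(s:ℝ)^2)^k * (16^(k+2))^k) *
          ((P:ℝ)^(8*s^2-4*s) * ((P:ℝ)^(20*k^2 - k*(k+1)/2 + k^2/2000 : ℝ))^2 * (P:ℝ)^(k*(k+1))) * M^(-(t^2/36)) := by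
        ring
      _ = ((((4*k:ℝ)^(448*k^3))^2) * (9*(s:ℝ)^2)^k * (16^(k+2))^k) *
          ((P:ℝ)^(8*s^2) * (P:ℝ)^((k:ℝ)^2/1000)) * M^(-(t^2/36)) := by rw [hEx]
      _ ≤ 64^(400*k^4) * ((P:ℝ)^(8*s^2) * M^(t^2/120)) * M^(-(t^2/36)) := by
        gcongr
        exact const_comp k hk
      _ = 64^(400*k^4) * (P:ℝ)^(8*s^2) * M^(t^2/120 + -(t^2/36)) := by
        rw [Real.rpow_add hM0]; ring
      _ ≤ 64^(400*k^4) * (P:ℝ)^(8*s^2) * M^(-((k:ℝ)^2/1500)) := by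
        refine mul_le_mul_of_nonneg_left (Real.rpow_le_rpow_of_exponent_le hM ?_) (by positivity)
        have : (k:ℝ)^2 ≤ (5*t)^2 := by gcongr
        nlinarith
      _ = _ := by
        have e4 : 4*s^2 = 400*k^4 := by rw [hs]; ring
        have e8 : 8*s^2 = 2*(400*k^4) := by rw [hs]; ring
        rw [e4, e8, mul_pow (64*(P:ℝ)^2) _, mul_pow (64:ℝ) ((P:ℝ)^2), ← pow_mul (P:ℝ), ← Real.rpow_natCast (M^_), ← Real.rpow_mul hM0.le]
        congr 1
        · congr 1
          push_cast
          field_simp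
          ring
  exact (pow_le_pow_iff_left₀ (norm_nonneg _) (by positivity) (by positivity)).1 hfin

end VK

namespace VK

open Finset

lemma norm_ee_sub_le (x y : ℝ) : ‖ee x - ee y‖ ≤ 2*Real.pi*|x-y| := by
  have h : ee x - ee y = ee y * (Complex.exp (Complex.I * ((2*Real.pi*(x-y):ℝ):ℂ)) - 1) := by
    rw [mul_sub, mul_one]
    congr 1
    rw [show x = y + (x-y) by ring, ee_add]
    congr 1
    unfold ee
    push_cast
    congr 1
    ring_nf
  rw [h, norm_mul, norm_ee, one_mul]
  refine (Real.norm_exp_I_mul_ofReal_sub_one_le).trans ?_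
  rw [Real.norm_eq_abs, abs_mul, abs_of_pos (by positivity)]

lemma shift_bound (f : ℕ → ℂ) (hf : ∀ n, ‖f n‖ ≤ 1) (a b : ℕ) (hab : a ≤ b) (w : ℕ) :
    ‖∑ n ∈ Ico a b, f n - ∑ n ∈ Ico a b, f (n+w)‖ ≤ 2*w := by
  have h1 : ∑ n ∈ Ico a b, f (n+w) = ∑ n ∈ Ico (a+w) (b+w), f n := by
    rw [← Finset.sum_Ico_add' f a b w]
  have h2 : ∑ n ∈ Ico a b, f n + ∑ n ∈ Ico b (b+w), f n = ∑ n ∈ Ico a (b+w), f n :=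
    Finset.sum_Ico_consecutive f hab (by omega)
  have h3 : ∑ n ∈ Ico a (a+w), f n + ∑ n ∈ Ico (a+w) (b+w), f n = ∑ n ∈ Ico a (b+w), f n :=
    Finset.sum_Ico_consecutive f (by omega) (by omega)
  have h4 : ∀ c : ℕ, ‖∑ n ∈ Ico c (c+w), f n‖ ≤ w := by
    intro c
    refine (norm_sum_le_of_le _ (fun n _ => hf n)).trans ?_
    simp
  have h5 : ∑ n ∈ Ico a b, f n - ∑ n ∈ Ico a b, f (n+w) = ∑ n ∈ Ico a (a+w), f n - ∑ n ∈ Ico b (b+w), f n := by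
    rw [h1]; linear_combination h2 - h3
  rw [h5]
  refine (norm_sub_le _ _).trans ?_
  linarith [h4 a, h4 b]

lemma taylor_inv (n w : ℝ) (hn : 0 < n) (hw : 0 ≤ w) (k : ℕ) :
    1/(n+w) = 1/n + ∑ j : Fin k, ((-1)^(j.1+1)/n^(j.1+1+1)) * w^(j.1+1) + (-1)^(k+1)*w^(k+1)/(n^(k+1)*(n+w)) := by
  induction k with
  | zero => 
    have : 0 < n + w := by linarith
    simp; field_simp; ring
  | succ k ih =>
    have : 0 < n + w := by linarith
    rw [ih, Fin.sum_univ_castSucc]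
    simp only [Fin.val_castSucc, Fin.val_last]
    have : (-1:ℝ)^(k+1)*w^(k+1)/(n^(k+1)*(n+w)) = (-1)^(k+1)/n^(k+1+1) * w^(k+1) + (-1)^(k+1+1)*w^(k+1+1)/(n^(k+1+1)*(n+w)) := by
      field_simp; ring
    rw [this]; ring

set_option maxHeartbeats 1000000 in
lemma ES2 (M Y : ℝ) (hM : 2 ≤ M) (hY : M^((3:ℝ)/2) ≤ Y) (a b : ℕ) (hab : a ≤ b) (ha : M ≤ a) (hb : b ≤ 8*M) :
    ‖∑ m ∈ Ico a b, ee (Y/m)‖ ≤ 600 * M * Real.exp (-((Real.log M)^3/(15000000*(Real.log Y)^2))) := by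
  have hM0 : 0 < M := by linarith
  have hM1 : 1 ≤ M := by linarith
  have hlM : 0 < Real.log M := Real.log_pos (by linarith)
  have hY0 : 0 < Y := lt_of_lt_of_le (by positivity) hY
  have hlY : 3/2*Real.log M ≤ Real.log Y := by
    rw [← Real.log_rpow hM0]; exact Real.log_le_log (by positivity) hY
  set t := Real.log Y/Real.log M - 1 with ht
  have ht2 : 1/2 ≤ t := by
    have : 3/2 ≤ Real.log Y/Real.log M := by rw [le_div_iff₀ hlM]; exact hlY
    linarith
  have hYt : M^(1+t) = Y := by
    rw [ht, Real.rpow_def_of_pos hM0]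
    have : Real.log M * (1 + (Real.log Y/Real.log M - 1)) = Real.log Y := by field_simp; ring
    rw [this, Real.exp_log hY0]
  set k := ⌈3*t⌉₊ with hk
  have hk3 : 3*t ≤ k := Nat.le_ceil _
  have hk5 : (k:ℝ) ≤ 5*t := by
    have : (k:ℝ) < 3*t+1 := Nat.ceil_lt_add_one (by linarith)
    linarith
  have hk0 : (0:ℝ) < k := by linarith
  set x := M^((1:ℝ)/3) with hx
  have hx1 : 1 ≤ x := Real.one_le_rpow hM1 (by norm_num)
  have hx3 : x^3 = M := by
    rw [hx, ← Real.rpow_natCast, ← Real.rpow_mul hM0.le]; norm_num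
  set P := ⌊x⌋₊ with hP
  have hP1 : 1 ≤ P := Nat.le_floor (by simpa using hx1)
  have hP' : (P:ℝ) ≤ x := Nat.floor_le (by linarith)
  have hPr : (1:ℝ) ≤ P := by exact_mod_cast hP1
  have hP2 : x/2 ≤ P := by
    have : x < P + 1 := Nat.lt_floor_add_one x
    linarith
  set f : ℕ → ℂ := fun n => ee (Y/n) with hf
  have hf1 : ∀ n, ‖f n‖ ≤ 1 := fun n => by simp [hf]
  set S := ∑ m ∈ Ico a b, f m with hS
  set η := M^(-(1/(600000*(k:ℝ)^2))) with hη
  -- inner bound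
  have inner : ∀ n ∈ Ico a b, ‖∑ u : Fin P, ∑ v : Fin P, f (n + u.1*v.1)‖ ≤ (P:ℝ)^2*(64*η + 7*x⁻¹) := by
    intro n hn
    rw [mem_Ico] at hn
    have hnM : M ≤ n := ha.trans (by exact_mod_cast hn.1)
    have hn8 : (n:ℝ) ≤ 8*M := le_trans (by exact_mod_cast hn.2.le) hb
    have hn0 : (0:ℝ) < n := by linarith
    set α : Fin k → ℝ := fun j => Y * ((-1)^(j.1+1)/(n:ℝ)^(j.1+1+1)) with hα
    have hb := bwey_save M t hM1 ht2 k P hk3 hk5 n hnM hn8 hP2 hP' hP1 α (by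
      intro j
      rw [hα, hYt]
      simp only [abs_mul, abs_div, abs_pow, abs_neg, abs_one, one_pow]
      rw [abs_of_pos hY0, abs_of_pos hn0]; ring)
    have key : ∀ u v : Fin P, ‖f (n+u.1*v.1) - f n * ee (∑ j : Fin k, α j * (u.1:ℝ)^(j.1+1) * (v.1:ℝ)^(j.1+1))‖ ≤ 7*x⁻¹ := by
      intro u v
      have hu : (u.1:ℝ) ≤ x := le_trans (by exact_mod_cast u.2.le) hP'
      have hv : (v.1:ℝ) ≤ x := le_trans (by exact_mod_cast v.2.le) hP'
      set w : ℝ := (u.1:ℝ)*v.1 with hw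
      have hw0 : 0 ≤ w := by positivity
      have hwx : w ≤ x^2 := by rw [sq]; exact mul_le_mul hu hv (by positivity) (by positivity)
      simp only [hf]
      rw [← ee_add]
      refine (norm_ee_sub_le _ _).trans ?_
      have e1 : Y/((n+u.1*v.1:ℕ):ℝ) - (Y/n + ∑ j : Fin k, α j * (u.1:ℝ)^(j.1+1) * (v.1:ℝ)^(j.1+1))
          = Y * ((-1)^(k+1)*w^(k+1)/((n:ℝ)^(k+1)*(n+w))) := by
        have e2 : ((n+u.1*v.1:ℕ):ℝ) = n + w := by push_cast; rfl
        have e3 : ∑ j : Fin k, α j * (u.1:ℝ)^(j.1+1) * (v.1:ℝ)^(j.1+1) = Y * ∑ j : Fin k, ((-1)^(j.1+1)/(n:ℝ)^(j.1+1+1)) * w^(j.1+1) := by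
          rw [mul_sum]
          apply sum_congr rfl
          intro j _
          rw [hα, hw, mul_pow]; ring
        have e4 := taylor_inv n w hn0 hw0 k
        rw [e2, e3, div_eq_mul_one_div Y ((n:ℝ)+w), e4]; ring
      rw [e1]
      have e5 : |Y * ((-1)^(k+1)*w^(k+1)/((n:ℝ)^(k+1)*(n+w)))| ≤ x⁻¹ := by
        rw [abs_mul, abs_div, abs_mul, abs_pow, abs_neg, abs_one, one_pow, one_mul, abs_of_pos hY0,
          abs_of_nonneg (by positivity : 0 ≤ w^(k+1)), abs_of_pos (by positivity : 0 < (n:ℝ)^(k+1)*(n+w))]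
        have hYx : Y ≤ x^3 * x^k := by
          rw [← hYt, hx3, Real.rpow_add hM0, Real.rpow_one]
          gcongr
          rw [hx, ← Real.rpow_natCast, ← Real.rpow_mul hM0.le]
          apply Real.rpow_le_rpow_of_exponent_le hM1
          linarith
        calc Y * (w^(k+1)/((n:ℝ)^(k+1)*(n+w))) ≤ (x^3*x^k) * ((x^2)^(k+1)/((x^3)^(k+1)*(x^3))) := by
              have : x^3 ≤ n := hx3 ▸ hnM
              gcongr
              linarith
          _ = x⁻¹ := by field_simp; ring
      have hpi : 2*Real.pi ≤ 7 := by linarith [Real.pi_lt_d2]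
      gcongr
    have hsum : ∑ u : Fin P, ∑ v : Fin P, f (n+u.1*v.1) = f n * bwey k P α +
        ∑ u : Fin P, ∑ v : Fin P, (f (n+u.1*v.1) - f n * ee (∑ j : Fin k, α j * (u.1:ℝ)^(j.1+1) * (v.1:ℝ)^(j.1+1))) := by
      simp only [bwey, wey, sum_sub_distrib, mul_sum]
      ring
    rw [hsum]
    refine (norm_add_le _ _).trans ?_
    have h1 : ‖f n * bwey k P α‖ ≤ 64*(P:ℝ)^2*η := by
      rw [norm_mul]
      refine le_trans ?_ hb
      have := hf1 n
      nlinarith [norm_nonneg (bwey k P α)]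
    have h2 : ‖∑ u : Fin P, ∑ v : Fin P, (f (n+u.1*v.1) - f n * ee (∑ j : Fin k, α j * (u.1:ℝ)^(j.1+1) * (v.1:ℝ)^(j.1+1)))‖ ≤ (P:ℝ)^2*(7*x⁻¹) := by
      refine (norm_sum_le_of_le _ (fun u _ => norm_sum_le_of_le _ (fun v _ => key u v))).trans ?_
      simp only [sum_const, card_univ, Fintype.card_fin, nsmul_eq_mul]
      rw [sq]; exact le_of_eq (by ring)
    nlinarith
  -- outer
  have outer : ‖(P:ℂ)^2 * S - ∑ n ∈ Ico a b, ∑ u : Fin P, ∑ v : Fin P, f (n + u.1*v.1)‖ ≤ (P:ℝ)^2 * (2*(P:ℝ)^2) := by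
    have : (P:ℂ)^2 * S - ∑ n ∈ Ico a b, ∑ u : Fin P, ∑ v : Fin P, f (n + u.1*v.1)
        = ∑ u : Fin P, ∑ v : Fin P, (S - ∑ n ∈ Ico a b, f (n + u.1*v.1)) := by
      simp only [sum_sub_distrib, sum_const, card_univ, Fintype.card_fin, nsmul_eq_mul]
      rw [sum_comm]
      congr 1
      · ring
      · apply sum_congr rfl; intro u _; rw [sum_comm]
    rw [this]
    refine (norm_sum_le_of_le _ (fun u _ => norm_sum_le_of_le _ (fun v _ => 
      (shift_bound f hf1 a b hab (u.1*v.1)).trans (?_ : _ ≤ 2*(P:ℝ)^2)))).trans ?_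
    · push_cast
      have hu : (u.1:ℝ) ≤ P := by exact_mod_cast u.2.le
      have hv : (v.1:ℝ) ≤ P := by exact_mod_cast v.2.le
      rw [sq]
      gcongr
    · simp only [sum_const, card_univ, Fintype.card_fin, nsmul_eq_mul]
      exact le_of_eq (by ring)
  have hcard : (((b - a : ℕ):ℕ):ℝ) ≤ 7*M := by
    rw [Nat.cast_sub hab]; linarith
  have hη0 : 0 < η := by positivity
  have tot : ‖S‖ ≤ 2*(P:ℝ)^2 + 7*M*(64*η+7*x⁻¹) := by
    have h1 : ‖∑ n ∈ Ico a b, ∑ u : Fin P, ∑ v : Fin P, f (n + u.1*v.1)‖ ≤ 7*M*((P:ℝ)^2*(64*η+7*x⁻¹)) := by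
      refine (norm_sum_le_of_le _ inner).trans ?_
      simp only [sum_const, Nat.card_Ico, nsmul_eq_mul]
      gcongr
    have h2 : (P:ℝ)^2*‖S‖ ≤ (P:ℝ)^2*(2*(P:ℝ)^2 + 7*M*(64*η+7*x⁻¹)) := by
      have h3 : ‖(P:ℂ)^2*S‖ = (P:ℝ)^2*‖S‖ := by simp
      have h4 := norm_sub_norm_le ((P:ℂ)^2 * S) (∑ n ∈ Ico a b, ∑ u : Fin P, ∑ v : Fin P, f (n + u.1*v.1))
      rw [h3] at h4
      nlinarith
    exact le_of_mul_le_mul_left h2 (by positivity)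
  have hxη : x⁻¹ ≤ η := by
    rw [hx, hη, ← Real.rpow_neg hM0.le]
    apply Real.rpow_le_rpow_of_exponent_le hM1
    have hk1 : (1:ℝ) ≤ k := by
      have : 0 < k := by exact_mod_cast hk0
      exact_mod_cast this
    rw [neg_le_neg_iff, div_le_div_iff₀ (by positivity) (by norm_num)]
    nlinarith
  have hP2M : (P:ℝ)^2 ≤ M*x⁻¹ := by
    calc (P:ℝ)^2 ≤ x^2 := by gcongr
      _ = M*x⁻¹ := by rw [← hx3]; field_simp
  have h600 : ‖S‖ ≤ 600*M*η := by
    have : M*x⁻¹ ≤ M*η := by gcongr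
    have : 0 ≤ M*η := by positivity
    have e : 7*M*(64*η+7*x⁻¹) = 448*(M*η) + 49*(M*x⁻¹) := by ring
    rw [e] at tot
    linarith
  refine h600.trans ?_
  have : η ≤ Real.exp (-((Real.log M)^3/(15000000*(Real.log Y)^2))) := by
    rw [hη, Real.rpow_def_of_pos hM0]
    apply Real.exp_le_exp.2
    rw [mul_neg, neg_le_neg_iff]
    have hkY : (k:ℝ)*Real.log M ≤ 5*Real.log Y := by
      have : t * Real.log M = Real.log Y - Real.log M := by rw [ht]; field_simp
      nlinarith
    have hlY0 : 0 < Real.log Y := by linarith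
    rw [mul_one_div, div_le_div_iff₀ (by positivity) (by positivity)]
    have h2 : ((k:ℝ)*Real.log M)^2 ≤ (5*Real.log Y)^2 := by gcongr
    nlinarith
  gcongr

end VK

namespace VK

open Finset

lemma abel_c (f c : ℕ → ℂ) (hf : ∀ n, ‖f n‖ ≤ 1) (a b : ℕ) (hab : a ≤ b) :
    ‖∑ n ∈ Ico a b, (f n - f (n+1)) * c n + f b * c b‖ ≤ ‖c a‖ + ∑ n ∈ Ico a b, ‖c (n+1) - c n‖ := by
  induction b, hab using Nat.le_induction with
  | base => 
    simp only [Ico_self, sum_empty, zero_add, add_zero, norm_mul]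
    nlinarith [hf a, norm_nonneg (c a)]
  | succ b hb ih =>
    rw [sum_Ico_succ_top hb, sum_Ico_succ_top hb]
    have : ∑ n ∈ Ico a b, (f n - f (n+1)) * c n + (f b - f (b+1)) * c b + f (b+1) * c (b+1) =
      (∑ n ∈ Ico a b, (f n - f (n+1)) * c n + f b * c b) + f (b+1) * (c (b+1) - c b) := by ring
    rw [this]
    refine (norm_add_le _ _).trans ?_
    have h2 : ‖f (b+1) * (c (b+1) - c b)‖ ≤ ‖c (b+1) - c b‖ := by
      rw [norm_mul]
      nlinarith [hf (b+1), norm_nonneg (c (b+1) - c b)]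
    linarith

lemma norm_one_sub_ee (δ : ℝ) (h0 : 0 ≤ δ) (h1 : δ ≤ 1/2) : 4*δ ≤ ‖1 - ee (-δ)‖ := by
  have h := norm_ee_sub_one (-δ)
  have : nd (-δ) = δ := by
    rcases h1.lt_or_eq with h2 | h2
    · have : round (-δ) = 0 := by
        rw [round_eq_zero_iff]; constructor <;> [linarith; linarith]
      rw [nd, this]; simp [abs_of_nonneg h0]
    · rw [h2]
      apply le_antisymm
      · exact nd_le_half _
      · unfold nd
        have h3 : round (-(1/2:ℝ)) = 0 := by
          rw [round_eq_zero_iff]; constructor <;> norm_num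
        rw [h3]; norm_num
  rw [this, norm_sub_rev] at h
  exact h

lemma ES1 (M Y : ℝ) (hM : 2 ≤ M) (hY0 : 0 < Y) (hY : Y ≤ M^2/2) (a b : ℕ) (hab : a ≤ b) (ha : M ≤ a) (hb : b ≤ 8*M) :
    ‖∑ m ∈ Ico a b, ee (Y/m)‖ ≤ 2950 * M * (M/Y) := by
  have hM0 : 0 < M := by linarith
  set f : ℕ → ℂ := fun n => ee (Y/n) with hf
  set δ : ℕ → ℝ := fun n => Y/((n:ℝ)*(n+1)) with hδ
  set c : ℕ → ℂ := fun n => (1 - ee (-δ n))⁻¹ with hc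
  set κ := Y/(81*M^2) with hκ
  have hκ0 : 0 < κ := by positivity
  have hδu : ∀ n, a ≤ n → δ n ≤ Y/M^2 := by
    intro n hn
    have hn' : M ≤ n := ha.trans (by exact_mod_cast hn)
    simp only [hδ]
    rw [sq]
    gcongr
    linarith
  have hδh : ∀ n, a ≤ n → δ n ≤ 1/2 := by
    intro n hn
    refine (hδu n hn).trans ?_
    rw [div_le_div_iff₀ (by positivity) (by norm_num)]; linarith
  have hδl : ∀ n, a ≤ n → n ≤ b → κ ≤ δ n := by
    intro n hn hnb
    have hn' : M ≤ n := ha.trans (by exact_mod_cast hn)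
    have hn'' : (n:ℝ) ≤ 8*M := le_trans (by exact_mod_cast hnb) hb
    simp only [hδ, hκ]
    have : (n:ℝ)*(n+1) ≤ 81*M^2 := by nlinarith
    have : (0:ℝ) < n*(n+1) := by nlinarith
    gcongr
  have hlow : ∀ n, a ≤ n → n ≤ b → 4*κ ≤ ‖1 - ee (-δ n)‖ := by
    intro n hn hnb
    have := hδl n hn hnb
    have := norm_one_sub_ee (δ n) (by linarith) (hδh n hn)
    linarith
  have hne : ∀ n, a ≤ n → n ≤ b → 1 - ee (-δ n) ≠ 0 := by
    intro n hn hnb h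
    have := hlow n hn hnb
    rw [h, norm_zero] at this
    linarith
  have hcn : ∀ n, a ≤ n → n ≤ b → ‖c n‖ ≤ 1/(4*κ) := by
    intro n hn hnb
    simp only [hc]
    rw [norm_inv, ← one_div]
    have := hlow n hn hnb
    gcongr
  have hcd : ∀ n ∈ Ico a b, ‖c (n+1) - c n‖ ≤ 7/(16*κ^2) * (δ n - δ (n+1)) ∨ n + 1 = b + 1 := by
    intro n hn
    rw [mem_Ico] at hn
    left
    have h1 := hne n hn.1 hn.2.le
    have h2 := hne (n+1) (by omega) (by omega)
    have h3 : c (n+1) - c n = (1 - ee (-δ (n+1)))⁻¹ * (1 - ee (-δ n))⁻¹ * (ee (-δ (n+1)) - ee (-δ n)) := by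
      simp only [hc]; field_simp; ring
    have hmono : δ (n+1) ≤ δ n := by
      simp only [hδ]
      have hn' : M ≤ n := ha.trans (by exact_mod_cast hn.1)
      have : (0:ℝ) < n := by linarith
      push_cast
      apply div_le_div_of_nonneg_left hY0.le (by positivity)
      nlinarith
    have h4 := norm_ee_sub_le (-δ (n+1)) (-δ n)
    rw [show -δ (n+1) - -δ n = δ n - δ (n+1) by ring, abs_of_nonneg (by linarith)] at h4
    rw [h3, norm_mul, norm_mul]
    have h5 := hcn n hn.1 hn.2.le
    have h6 := hcn (n+1) (by omega) (by omega)
    simp only [hc] at h5 h6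
    calc _ ≤ (1/(4*κ)) * (1/(4*κ)) * (2*Real.pi*(δ n - δ (n+1))) := by gcongr
      _ ≤ (1/(4*κ)) * (1/(4*κ)) * (7*(δ n - δ (n+1))) := by
        have hpi : 2*Real.pi ≤ 7 := by linarith [Real.pi_lt_d2]
        gcongr
      _ = _ := by field_simp; ring
  have hterm : ∀ n ∈ Ico a b, f n = (f n - f (n+1)) * c n := by
    intro n hn
    rw [mem_Ico] at hn
    have h1 := hne n hn.1 hn.2.le
    have h2 : f (n+1) = f n * ee (-δ n) := by
      simp only [hf, hδ]
      rw [← ee_add]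
      congr 1
      have hn' : M ≤ n := ha.trans (by exact_mod_cast hn.1)
      have : (0:ℝ) < n := by linarith
      push_cast
      field_simp
      ring
    simp only [hc]
    rw [h2]; field_simp
  have hS : ∑ m ∈ Ico a b, f m = ∑ n ∈ Ico a b, (f n - f (n+1)) * c n := sum_congr rfl hterm
  have hab' := abel_c f c (fun n => by simp [hf]) a b hab
  have hsum : ∑ n ∈ Ico a b, ‖c (n+1) - c n‖ ≤ 7/(16*κ^2) * (Y/M^2) := by
    calc _ ≤ ∑ n ∈ Ico a b, 7/(16*κ^2) * (δ n - δ (n+1)) := by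
          apply sum_le_sum
          intro n hn
          rcases hcd n hn with h | h
          · exact h
          · rw [mem_Ico] at hn; omega
      _ = 7/(16*κ^2) * (δ a - δ b) := by
          rw [← mul_sum]
          congr 1
          have := Finset.sum_Ico_sub δ hab
          have h2 : ∑ n ∈ Ico a b, (δ n - δ (n+1)) = - ∑ n ∈ Ico a b, (δ (n+1) - δ n) := by
            rw [← sum_neg_distrib]; apply sum_congr rfl; intros; ring
          rw [h2, this]; ring
      _ ≤ _ := by
          have h1 := hδu a le_rfl
          have h2 := hδl b hab le_rfl
          gcongr
          linarith
  have hfin : ‖∑ m ∈ Ico a b, f m‖ ≤ 1/(4*κ) + (1/(4*κ) + 7/(16*κ^2) * (Y/M^2)) := by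
    rw [hS]
    have e : ∑ n ∈ Ico a b, (f n - f (n+1)) * c n = (∑ n ∈ Ico a b, (f n - f (n+1)) * c n + f b * c b) - f b * c b := by ring
    rw [e]
    refine (norm_sub_le _ _).trans ?_
    have h1 : ‖f b * c b‖ ≤ 1/(4*κ) := by
      rw [norm_mul]
      have : ‖f b‖ = 1 := by simp [hf]
      rw [this, one_mul]
      exact hcn b hab le_rfl
    linarith [hcn a le_rfl hab]
  refine hfin.trans ?_
  rw [hκ]
  have e : 1/(4*(Y/(81*M^2))) + (1/(4*(Y/(81*M^2))) + 7/(16*(Y/(81*M^2))^2) * (Y/M^2)) = (81/2 + 7*81^2/16) * (M^2/Y) := by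
    field_simp; ring
  rw [e, show 2950*M*(M/Y) = 2950*(M^2/Y) by ring]
  have h0 : 0 ≤ M^2/Y := by positivity
  gcongr
  norm_num

/-- The combined exponential sum bound. -/
theorem ES (M Y : ℝ) (hM : 2 ≤ M) (hY : Y ≠ 0) (a b : ℕ) (ha : M ≤ a) (hb : b ≤ 8*M) :
    ‖∑ m ∈ Ico a b, ee (Y/m)‖ ≤ 3000 * M * (M/|Y| + Real.exp (-((Real.log M)^3/(15000000*(Real.log |Y|)^2)))) := by
  have hM0 : 0 < M := by linarith
  have main : ∀ Y : ℝ, 0 < Y → ‖∑ m ∈ Ico a b, ee (Y/m)‖ ≤ 3000 * M * (M/Y + Real.exp (-((Real.log M)^3/(15000000*(Real.log Y)^2)))) := by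
    intro Y hY
    have hE := Real.exp_pos (-((Real.log M)^3/(15000000*(Real.log Y)^2)))
    set E := Real.exp (-((Real.log M)^3/(15000000*(Real.log Y)^2))) with hEd
    have hMY : 0 < M/Y := by positivity
    rcases lt_or_ge b a with hab | hab
    · rw [Ico_eq_empty_of_le hab.le]; simp; positivity
    rcases le_or_gt (M^((3:ℝ)/2)) Y with h | h
    · refine (ES2 M Y hM h a b hab ha hb).trans ?_
      rw [← hEd]
      have : 0 < M*E := by positivity
      have : 0 < M*(M/Y) := by positivity
      nlinarith
    · have h1 : 2950*M*(M/Y) ≤ 3000 * M * (M/Y + E) := by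
        have : 0 < M*E := by positivity
        have : 0 < M*(M/Y) := by positivity
        nlinarith
      refine le_trans ?_ h1
      rcases le_or_gt 4 M with h4 | h4
      · apply ES1 M Y hM hY _ a b hab ha hb
        refine h.le.trans ?_
        have h5 : M^((3:ℝ)/2) * M^((1:ℝ)/2) = M^2 := by
          rw [← Real.rpow_add hM0]; norm_num
        have h6 : 2 ≤ M^((1:ℝ)/2) := by
          rw [← Real.sqrt_eq_rpow]
          apply Real.le_sqrt_of_sq_le; linarith
        have h7 : 0 < M^((3:ℝ)/2) := by positivity
        nlinarith
      · have h5 : ‖∑ m ∈ Ico a b, ee (Y/m)‖ ≤ 7*M := by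
          refine (norm_sum_le_of_le _ (fun n _ => (norm_ee _).le)).trans ?_
          simp only [sum_const, Nat.card_Ico, nsmul_eq_mul, mul_one]
          rw [Nat.cast_sub hab]; linarith
        have h6 : Y ≤ M^2 := by
          refine h.le.trans ?_
          rw [← Real.rpow_natCast]
          apply Real.rpow_le_rpow_of_exponent_le (by linarith); norm_num
        have h7 : 1/4 ≤ M/Y := by
          rw [div_le_div_iff₀ (by norm_num) hY]; nlinarith
        nlinarith
  rcases lt_or_gt_of_ne hY with h | h
  · have := main (-Y) (by linarith)
    rw [abs_of_neg h]
    refine le_trans (le_of_eq ?_) this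
    rw [← Complex.norm_conj, map_sum]
    congr 1
    apply sum_congr rfl
    intro m _
    rw [← ee_neg, neg_div]
  · rw [abs_of_pos h]; exact main Y h

end VK

namespace VK

open Finset

/-- The sawtooth function. -/
noncomputable def psi (x : ℝ) : ℝ := Int.fract x - 1/2

lemma abs_psi_le (x : ℝ) : |psi x| ≤ 1/2 := by
  have h0 := Int.fract_nonneg x
  have h1 := Int.fract_lt_one x
  rw [psi, abs_le]; constructor <;> linarith

/-- periodic second Bernoulli function -/
noncomputable def BB (x : ℝ) : ℝ := (Int.fract x)^2 - Int.fract x + 1/6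

lemma BB_le (z y : ℝ) (n : ℤ) (h : y = z + n) : BB z ≤ y^2 - y + 1/6 := by
  subst h
  have h0 := Int.fract_nonneg z
  have h1 := Int.fract_lt_one z
  have e : z = ⌊z⌋ + Int.fract z := (Int.floor_add_fract z).symm
  unfold BB
  set f := Int.fract z
  have e2 : z + n = f + ((⌊z⌋ + n : ℤ):ℝ) := by push_cast; linarith
  rw [e2]
  set m : ℤ := ⌊z⌋ + n
  rcases le_or_gt 1 m with hm | hm
  · have : (1:ℝ) ≤ m := by exact_mod_cast hm
    nlinarith
  · rcases le_or_gt 0 m with hm' | hm'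
    · have : m = 0 := by omega
      rw [this]; simp
    · have : (m:ℝ) ≤ -1 := by exact_mod_cast (by omega : m ≤ -1)
      nlinarith

lemma psi_low (x δ : ℝ) : BB (x+δ) - BB x ≤ 2*δ*psi x + δ^2 := by
  have := BB_le (x+δ) (Int.fract x + δ) (-⌊x⌋) (by push_cast; rw [Int.fract]; ring)
  have e : BB x = (Int.fract x)^2 - Int.fract x + 1/6 := rfl
  rw [e, psi]; linarith

lemma psi_high (x δ : ℝ) : 2*δ*psi x - δ^2 ≤ BB x - BB (x-δ) := by
  have := BB_le (x-δ) (Int.fract x - δ) (-⌊x⌋) (by push_cast; rw [Int.fract]; ring)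
  have e : BB x = (Int.fract x)^2 - Int.fract x + 1/6 := rfl
  rw [e, psi]; linarith

lemma BB_hasSum (x : ℝ) : HasSum (fun n : ℕ => 1/(n:ℝ)^2 * (ee (n*x)).re) (Real.pi^2 * BB x) := by
  have h := hasSum_one_div_nat_pow_mul_cos (k := 1) one_ne_zero (x := Int.fract x) ⟨Int.fract_nonneg x, (Int.fract_lt_one x).le⟩
  have e1 : ∀ n : ℕ, 1/(n:ℝ)^(2*1) * Real.cos (2*Real.pi*n*Int.fract x) = 1/(n:ℝ)^2 * (ee (n*x)).re := by
    intro n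
    rw [mul_one]
    congr 1
    have : ee (n*x) = ee (n*Int.fract x) := by
      have e : (n:ℝ)*x = n*Int.fract x + ((n*⌊x⌋:ℤ):ℝ) := by
        push_cast; rw [Int.fract]; ring
      rw [e, ee_add, ee_int, mul_one]
    rw [this, ee, Complex.exp_ofReal_mul_I_re]
    congr 1; ring
  simp only [e1] at h
  convert h using 1
  have b2 : Polynomial.bernoulli 2 = Polynomial.X^2 - Polynomial.X + Polynomial.C (1/6) := by
    rw [Polynomial.bernoulli, sum_range_succ, sum_range_succ, sum_range_succ, sum_range_zero]
    have hb1 : bernoulli 1 = -1/2 := by rw [bernoulli_one]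
    have hb2 : bernoulli 2 = 1/6 := by rw [bernoulli_two]; norm_num
    norm_num [hb1, hb2, bernoulli_zero, Polynomial.monomial_zero_left, Polynomial.monomial_one_one_eq_X]
    rw [← Polynomial.X_pow_eq_monomial]
    ring
  simp only [BB, mul_one, b2]
  simp only [Polynomial.map_add, Polynomial.map_sub, Polynomial.map_pow, Polynomial.map_X, Polynomial.map_C,
    Polynomial.eval_add, Polynomial.eval_sub, Polynomial.eval_pow, Polynomial.eval_X, Polynomial.eval_C]
  have : ((algebraMap ℚ ℝ) (1/6)) = 1/6 := by simp
  rw [this]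
  simp only [Nat.factorial]
  push_cast
  ring

lemma sumBB (ι : Type*) (s : Finset ι) (v x : ι → ℝ) (V E : ℝ) (H : ℕ) (hH : 1 ≤ H) (hE0 : 0 ≤ E)
    (hV : ∀ i ∈ s, 0 ≤ v i) (hVs : ∑ i ∈ s, v i ≤ V)
    (hE : ∀ h : ℕ, 1 ≤ h → h ≤ H → ‖∑ i ∈ s, (v i:ℂ) * ee (h * x i)‖ ≤ E) (θ : ℝ) :
    |∑ i ∈ s, v i * BB (x i + θ)| ≤ (E + V/H)/2 := by
  have h1 : HasSum (fun n : ℕ => ∑ i ∈ s, v i * (1/(n:ℝ)^2 * (ee (n*(x i + θ))).re)) (∑ i ∈ s, v i * (Real.pi^2 * BB (x i + θ))) :=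
    hasSum_sum (fun i _ => (BB_hasSum (x i + θ)).mul_left (v i))
  have hV0 : 0 ≤ V := (sum_nonneg hV).trans hVs
  have hHr : (1:ℝ) ≤ H := by exact_mod_cast hH
  have e1 : ∀ n : ℕ, |∑ i ∈ s, v i * (1/(n:ℝ)^2 * (ee (n*(x i + θ))).re)| ≤ ((n:ℝ)^2)⁻¹ * ‖∑ i ∈ s, (v i:ℂ) * ee (n * x i)‖ := by
    intro n
    have : ∑ i ∈ s, v i * (1/(n:ℝ)^2 * (ee (n*(x i + θ))).re) = ((n:ℝ)^2)⁻¹ * (ee (n*θ) * ∑ i ∈ s, (v i:ℂ) * ee (n * x i)).re := by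
      rw [mul_sum, Complex.re_sum, mul_sum]
      apply sum_congr rfl
      intro i _
      rw [mul_add, ee_add]
      have : ee (n*θ) * ((v i:ℂ) * ee (n*x i)) = (v i:ℂ) * (ee (n*x i) * ee (n*θ)) := by ring
      rw [this, Complex.re_ofReal_mul]
      ring
    rw [this, abs_mul, abs_of_nonneg (by positivity)]
    gcongr
    refine (Complex.abs_re_le_norm _).trans ?_
    rw [norm_mul, norm_ee, one_mul]
  have e2 : ∀ n : ℕ, ‖∑ i ∈ s, (v i:ℂ) * ee (n * x i)‖ ≤ V := by
    intro n
    refine (norm_sum_le _ _).trans (le_trans (le_of_eq ?_) hVs)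
    apply sum_congr rfl
    intro i hi
    rw [norm_mul, norm_ee, mul_one, Complex.norm_real, Real.norm_eq_abs, abs_of_nonneg (hV i hi)]
  have part : ∀ N : ℕ, |∑ n ∈ range N, ∑ i ∈ s, v i * (1/(n:ℝ)^2 * (ee (n*(x i + θ))).re)| ≤ 2*E + 2*V/H := by
    intro N
    refine (abs_sum_le_sum_abs _ _).trans ?_
    have e3 : ∀ n ∈ range N, |∑ i ∈ s, v i * (1/(n:ℝ)^2 * (ee (n*(x i + θ))).re)| ≤
        (if n ∈ Ioo 0 N then ((n:ℝ)^2)⁻¹ * E else 0) + (if n ∈ Ioo H N then ((n:ℝ)^2)⁻¹ * V else 0) := by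
      intro n hn
      rw [mem_range] at hn
      refine (e1 n).trans ?_
      rcases Nat.eq_zero_or_pos n with h0 | h0
      · subst h0; simp
      · rcases le_or_gt n H with h2 | h2
        · rw [if_pos (by simp; omega), if_neg (by simp; omega), add_zero]
          gcongr
          exact hE n h0 h2
        · rw [if_pos (by simp; omega), if_pos (by simp; omega)]
          have := e2 n
          have : 0 ≤ ((n:ℝ)^2)⁻¹ * E := by positivity
          have : ((n:ℝ)^2)⁻¹ * ‖∑ i ∈ s, (v i:ℂ) * ee (n * x i)‖ ≤ ((n:ℝ)^2)⁻¹ * V := by gcongr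
          linarith
    refine (sum_le_sum e3).trans ?_
    rw [sum_add_distrib, ← sum_filter, ← sum_filter, ← sum_mul, ← sum_mul]
    have f1 : (range N).filter (fun n => n ∈ Ioo 0 N) = Ioo 0 N := by ext; simp
    have f2 : (range N).filter (fun n => n ∈ Ioo H N) = Ioo H N := by ext; simp
    rw [f1, f2]
    have g1 : ∑ i ∈ Ioo 0 N, ((i:ℝ)^2)⁻¹ ≤ 2 := by
      have := sum_Ioo_inv_sq_le (α := ℝ) 0 N; simpa using this
    have g2 : ∑ i ∈ Ioo H N, ((i:ℝ)^2)⁻¹ ≤ 2/H := by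
      have := sum_Ioo_inv_sq_le (α := ℝ) H N
      refine this.trans ?_
      gcongr; linarith
    calc _ ≤ 2*E + (2/H)*V := by gcongr
      _ = _ := by ring
  have lim := h1.tendsto_sum_nat
  have hb : |∑ i ∈ s, v i * (Real.pi^2 * BB (x i + θ))| ≤ 2*E + 2*V/H :=
    le_of_tendsto lim.abs (Filter.Eventually.of_forall part)
  have e4 : ∑ i ∈ s, v i * (Real.pi^2 * BB (x i + θ)) = Real.pi^2 * ∑ i ∈ s, v i * BB (x i + θ) := by
    rw [mul_sum]; apply sum_congr rfl; intros; ring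
  rw [e4, abs_mul, abs_of_pos (by positivity)] at hb
  have hpi : 9 ≤ Real.pi^2 := by nlinarith [Real.pi_gt_three]
  have e5 : 2*V/H = 2*(V/H) := by ring
  rw [e5] at hb
  have : 0 ≤ V/H := by positivity
  have h9 : 9*|∑ i ∈ s, v i * BB (x i + θ)| ≤ Real.pi^2*|∑ i ∈ s, v i * BB (x i + θ)| := by gcongr
  linarith

lemma psi_pos (ι : Type*) (s : Finset ι) (v x : ι → ℝ) (V E δ : ℝ) (H : ℕ) (hH : 1 ≤ H) (hE0 : 0 ≤ E) (hδ : 0 < δ)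
    (hV : ∀ i ∈ s, 0 ≤ v i) (hVs : ∑ i ∈ s, v i ≤ V)
    (hE : ∀ h : ℕ, 1 ≤ h → h ≤ H → ‖∑ i ∈ s, (v i:ℂ) * ee (h * x i)‖ ≤ E) :
    |∑ i ∈ s, v i * psi (x i)| ≤ (E + V/H)/δ + δ*V := by
  have hb := sumBB ι s v x V E H hH hE0 hV hVs hE
  have hV0 : 0 ≤ V := (sum_nonneg hV).trans hVs
  set S := ∑ i ∈ s, v i * psi (x i) with hS
  have b0 := abs_le.1 (hb 0)
  have b1 := abs_le.1 (hb δ)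
  have b2 := abs_le.1 (hb (-δ))
  have l1 : ∑ i ∈ s, v i * BB (x i + δ) - ∑ i ∈ s, v i * BB (x i + 0) ≤ 2*δ*S + δ^2*V := by
    have : δ^2*∑ i ∈ s, v i ≤ δ^2*V := by gcongr
    refine le_trans ?_ (add_le_add_right this _)
    rw [hS, mul_sum, mul_sum, ← sum_sub_distrib, ← sum_add_distrib]
    apply sum_le_sum
    intro i hi
    have h2 := psi_low (x i) δ
    rw [add_zero]
    nlinarith [mul_le_mul_of_nonneg_left h2 (hV i hi)]
  have l2 : 2*δ*S - δ^2*V ≤ ∑ i ∈ s, v i * BB (x i + 0) - ∑ i ∈ s, v i * BB (x i + -δ) := by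
    have : δ^2*∑ i ∈ s, v i ≤ δ^2*V := by gcongr
    refine le_trans (sub_le_sub_left this _) ?_
    rw [hS, mul_sum, mul_sum, ← sum_sub_distrib, ← sum_sub_distrib]
    apply sum_le_sum
    intro i hi
    have h2 := psi_high (x i) δ
    rw [add_zero, ← sub_eq_add_neg]
    nlinarith [mul_le_mul_of_nonneg_left h2 (hV i hi)]
  have e : (E + V/H)/δ + δ*V = ((E+V/H) + δ^2*V)/δ := by field_simp
  have : 0 ≤ V/H := by positivity
  have : 0 ≤ δ^2*V := by positivity
  rw [e, abs_le, le_div_iff₀ hδ, ← neg_div, div_le_iff₀ hδ]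
  constructor <;> linarith

/-- The sawtooth lemma for signed weights. -/
theorem psi_weighted (ι : Type*) (s : Finset ι) (w x : ι → ℝ) (W E δ : ℝ) (H : ℕ) (hH : 1 ≤ H) (hE0 : 0 ≤ E) (hδ : 0 < δ)
    (hW0 : 0 ≤ W) (hW : ∀ i ∈ s, |w i| ≤ W)
    (hE1 : ∀ h : ℕ, 1 ≤ h → h ≤ H → ‖∑ i ∈ s, (w i:ℂ) * ee (h * x i)‖ ≤ E)
    (hE2 : ∀ h : ℕ, 1 ≤ h → h ≤ H → W*‖∑ i ∈ s, ee (h * x i)‖ ≤ E) :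
    |∑ i ∈ s, w i * psi (x i)| ≤ 3*((E + W*#s/H)/δ + δ*W*#s) := by
  have p1 := psi_pos ι s (fun i => w i + W) x (2*W*#s) (2*E) δ H hH (by linarith) hδ
    (fun i hi => by have := (abs_le.1 (hW i hi)).1; linarith)
    (by
      refine (sum_le_sum (fun i hi => (by have := (abs_le.1 (hW i hi)).2; linarith : w i + W ≤ 2*W))).trans ?_
      simp; apply le_of_eq; ring)
    (by
      intro h h1 h2
      have e : ∑ i ∈ s, ((w i + W : ℝ):ℂ) * ee (h*x i) = ∑ i ∈ s, (w i:ℂ) * ee (h * x i) + (W:ℂ) * ∑ i ∈ s, ee (h*x i) := by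
        rw [mul_sum, ← sum_add_distrib]; apply sum_congr rfl; intros; push_cast; ring
      rw [e]
      refine (norm_add_le _ _).trans ?_
      rw [norm_mul, Complex.norm_real, Real.norm_eq_abs, abs_of_nonneg hW0]
      linarith [hE1 h h1 h2, hE2 h h1 h2])
  have p2 := psi_pos ι s (fun i => W) x (W*#s) E δ H hH hE0 hδ (fun _ _ => hW0) (by simp; apply le_of_eq; ring)
    (by
      intro h h1 h2
      rw [← mul_sum, norm_mul, Complex.norm_real, Real.norm_eq_abs, abs_of_nonneg hW0]
      exact hE2 h h1 h2)
  have e : ∑ i ∈ s, w i * psi (x i) = ∑ i ∈ s, (w i + W) * psi (x i) - ∑ i ∈ s, W * psi (x i) := by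
    rw [← sum_sub_distrib]; apply sum_congr rfl; intros; ring
  rw [e]
  refine (abs_sub _ _).trans ?_
  refine (add_le_add p1 p2).trans (le_of_eq ?_)
  ring

end VK

namespace VK

open Finset

/-- the truncated kernel -/
noncomputable def gk (N X : ℕ) (Z : ℝ) (a b : ℕ) : ℂ := if N ≤ a*b ∧ a*b < X then ee (Z/((a:ℝ)*b)) else 0

lemma gk_mul (N X : ℕ) (Z : ℝ) (a a' b : ℕ) (ha : a ≠ 0) (ha' : a' ≠ 0):
    gk N X Z a b * (starRingEnd ℂ) (gk N X Z a' b) =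
      if (N ≤ a*b ∧ a*b < X) ∧ (N ≤ a'*b ∧ a'*b < X) then ee ((Z/a - Z/a')/b) else 0 := by
  unfold gk
  by_cases h1 : N ≤ a*b ∧ a*b < X <;> by_cases h2 : N ≤ a'*b ∧ a'*b < X
  · simp only [h1, h2, and_self, if_true]
    rw [← ee_neg, ← ee_add]
    congr 1
    rcases Nat.eq_zero_or_pos b with hb | hb
    · subst hb; simp
    · field_simp; ring
  all_goals simp [h1, h2]

lemma filt_eq (N X : ℕ) (a a' : ℕ) (ha : 0 < a) (ha' : 0 < a') (B : Finset ℕ)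
    (hB : ∀ b, (N ≤ a*b ∧ a*b < X) → b ∈ B) :
    B.filter (fun b => (N ≤ a*b ∧ a*b < X) ∧ (N ≤ a'*b ∧ a'*b < X)) =
      Ico (max (N ⌈/⌉ a) (N ⌈/⌉ a')) (min (X ⌈/⌉ a) (X ⌈/⌉ a')) := by
  ext b
  have e1 : ∀ c : ℕ, 0 < c → ∀ W : ℕ, (W ⌈/⌉ c ≤ b ↔ W ≤ c*b) := by
    intro c hc W
    rw [ceilDiv_le_iff_le_mul hc]
  have e2 : ∀ c : ℕ, 0 < c → ∀ W : ℕ, (b < W ⌈/⌉ c ↔ c*b < W) := by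
    intro c hc W
    rw [← not_le, e1 c hc, not_le]
  simp only [mem_filter, mem_Ico, max_le_iff, lt_min_iff, e1 a ha, e1 a' ha', e2 a ha, e2 a' ha']
  constructor
  · rintro ⟨_, ⟨h1, h2⟩, h3, h4⟩; exact ⟨⟨h1, h3⟩, h2, h4⟩
  · rintro ⟨⟨h1, h3⟩, h2, h4⟩
    exact ⟨hB b ⟨h1, by omega⟩, ⟨h1, h2⟩, h3, h4⟩

lemma near_count (A : ℕ) (a : ℕ) (r : ℝ) (hr : 0 ≤ r) :
    (#((Ico A (2*A)).filter (fun a' : ℕ => |(a:ℝ) - a'| ≤ r)) : ℝ) ≤ 2*r+1 := by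
  have h := card_real_interval (((Ico A (2*A)).filter (fun a' : ℕ => |(a:ℝ) - a'| ≤ r)).image (fun n : ℕ => (n:ℤ))) (a - r) (a + r) (by linarith)
    (by
      intro m hm
      rw [mem_image] at hm
      obtain ⟨n, hn, rfl⟩ := hm
      rw [mem_filter] at hn
      have := abs_le.1 hn.2
      push_cast
      constructor <;> linarith)
  rw [card_image_of_injective _ Nat.cast_injective] at h
  linarith

set_option maxHeartbeats 1000000 in
/-- The bilinear estimate. -/
theorem bilinear (N X A : ℕ) (Z τ : ℝ) (hA : 1 ≤ A) (hNA : 4*A ≤ N) (hX : X ≤ 2*N) (hτ : 0 < τ)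
    (hZ : 8*A ≤ Z*τ) (hZ1 : 1 ≤ Z) (α β : ℕ → ℝ) (hα : ∀ a, |α a| ≤ 1) (hβ : ∀ b, |β b| ≤ 1) :
    ‖∑ a ∈ Ico A (2*A), ∑ b ∈ Ico 1 X, (α a:ℂ) * β b * gk N X Z a b‖^2 ≤
      6000*(N:ℝ)^2*(τ + 1/A + N/(Z*τ) + Real.exp (-((Real.log (N/(2*A)))^3/(15000000*(Real.log Z)^2)))) := by
  set M : ℝ := N/(2*A) with hM
  have hA0 : (1:ℝ) ≤ A := by exact_mod_cast hA
  have hNA' : 4*(A:ℝ) ≤ N := by exact_mod_cast hNA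
  have hM2 : 2 ≤ M := by rw [hM, le_div_iff₀ (by positivity)]; linarith
  have hMA : M*A = N/2 := by rw [hM]; field_simp
  set B := Icc ⌈M⌉₊ ⌊4*M⌋₊ with hB
  have hXr : (X:ℝ) ≤ 2*N := by exact_mod_cast hX
  have hBmem : ∀ a ∈ Ico A (2*A), ∀ b, (N ≤ a*b ∧ a*b < X) → b ∈ B := by
    intro a ha b hb
    rw [mem_Ico] at ha
    have a1 : (A:ℝ) ≤ a := by exact_mod_cast ha.1
    have a2 : (a:ℝ) ≤ 2*A := by exact_mod_cast ha.2.le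
    have b1 : (N:ℝ) ≤ a*b := by exact_mod_cast hb.1
    have b2 : (a:ℝ)*b ≤ X := by exact_mod_cast hb.2.le
    have b0 : (0:ℝ) ≤ b := by positivity
    rw [hB, mem_Icc]
    constructor
    · rw [Nat.ceil_le, hM, div_le_iff₀ (by positivity)]
      nlinarith
    · apply Nat.le_floor
      have : (b:ℝ)*A ≤ 4*M*A := by
        rw [mul_assoc, hMA]; nlinarith
      exact le_of_mul_le_mul_right this (by linarith)
  have hBc : (#B:ℝ) ≤ 4*M := by
    rw [hB, Nat.card_Icc]
    have h1 : (⌊4*M⌋₊:ℝ) ≤ 4*M := Nat.floor_le (by linarith)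
    have h2 : M ≤ ⌈M⌉₊ := Nat.le_ceil _
    rcases le_or_gt ⌈M⌉₊ (⌊4*M⌋₊+1) with h | h
    · rw [Nat.cast_sub h]; push_cast; linarith
    · rw [Nat.sub_eq_zero_of_le h.le]; push_cast; linarith
  -- restrict b to B
  have hres : ∀ a ∈ Ico A (2*A), ∑ b ∈ Ico 1 X, (α a:ℂ) * β b * gk N X Z a b = ∑ b ∈ B, (α a:ℂ) * β b * gk N X Z a b := by
    intro a ha
    have ha' := mem_Ico.1 ha
    have q1 : ∀ s : Finset ℕ, (∀ b, (N ≤ a*b ∧ a*b < X) → b ∈ s) →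
      ∑ b ∈ s, (α a:ℂ) * β b * gk N X Z a b = ∑ b ∈ range X with (N ≤ a*b ∧ a*b < X), (α a:ℂ) * β b * gk N X Z a b := by
      intro s hs
      symm
      apply sum_subset_zero_on_sdiff
      · intro b hb
        rw [mem_filter] at hb
        exact hs b hb.2
      · intro b hb
        rw [mem_sdiff, mem_filter, not_and] at hb
        have : ¬ (N ≤ a*b ∧ a*b < X) := by
          intro hc
          apply hb.2 _ hc
          rw [mem_range]
          calc b ≤ a*b := Nat.le_mul_of_pos_left _ (by omega)
            _ < X := hc.2
        simp [gk, this]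
      · intros; rfl
    rw [q1 _ (fun b hb => ?_), q1 B (hBmem a ha)]
    rw [mem_Ico]
    constructor
    · rcases Nat.eq_zero_or_pos b with h | h
      · subst h; omega
      · exact h
    · exact lt_of_le_of_lt (Nat.le_mul_of_pos_left _ (by omega)) hb.2
  rw [sum_congr rfl hres, sum_comm]
  set u : ℕ → ℂ := fun b => ∑ a ∈ Ico A (2*A), (α a:ℂ) * gk N X Z a b with hu
  have s1 : ∑ b ∈ B, ∑ a ∈ Ico A (2*A), (α a:ℂ) * β b * gk N X Z a b = ∑ b ∈ B, (β b:ℂ) * u b := by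
    apply sum_congr rfl
    intro b _
    rw [hu, mul_sum]
    apply sum_congr rfl
    intros; ring
  rw [s1]
  have s2 : ‖∑ b ∈ B, (β b:ℂ) * u b‖^2 ≤ #B * ∑ b ∈ B, ‖u b‖^2 := by
    have h1 : ‖∑ b ∈ B, (β b:ℂ) * u b‖ ≤ ∑ b ∈ B, ‖u b‖ := by
      apply norm_sum_le_of_le
      intro b _
      rw [norm_mul, Complex.norm_real, Real.norm_eq_abs]
      nlinarith [hβ b, norm_nonneg (u b)]
    calc _ ≤ (∑ b ∈ B, ‖u b‖)^2 := by gcongr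
      _ ≤ _ := sq_sum_le_card_mul_sum_sq
  -- inner sums
  set K : ℕ → ℕ → ℂ := fun a a' => ∑ b ∈ B, gk N X Z a b * (starRingEnd ℂ) (gk N X Z a' b) with hK
  have s3 : ((∑ b ∈ B, ‖u b‖^2 : ℝ):ℂ) = ∑ a ∈ Ico A (2*A), ∑ a' ∈ Ico A (2*A), (α a:ℂ) * α a' * K a a' := by
    push_cast
    have : ∀ b ∈ B, ((‖u b‖:ℂ))^2 = ∑ a ∈ Ico A (2*A), ∑ a' ∈ Ico A (2*A), (α a:ℂ) * α a' * (gk N X Z a b * (starRingEnd ℂ) (gk N X Z a' b)) := by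
      intro b _
      rw [← Complex.mul_conj', hu, map_sum, sum_mul_sum]
      apply sum_congr rfl; intro a _
      apply sum_congr rfl; intro a' _
      rw [map_mul, Complex.conj_ofReal]
      ring
    rw [sum_congr rfl this, sum_comm]
    apply sum_congr rfl; intro a _
    rw [sum_comm]
    apply sum_congr rfl; intro a' _
    rw [hK, mul_sum]
  have s4 : ∑ b ∈ B, ‖u b‖^2 ≤ ∑ a ∈ Ico A (2*A), ∑ a' ∈ Ico A (2*A), ‖K a a'‖ := by
    have h1 : ‖((∑ b ∈ B, ‖u b‖^2 : ℝ):ℂ)‖ = ∑ b ∈ B, ‖u b‖^2 := by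
      rw [Complex.norm_real, Real.norm_eq_abs, abs_of_nonneg (by positivity)]
    rw [← h1, s3]
    apply norm_sum_le_of_le; intro a _
    apply norm_sum_le_of_le; intro a' _
    rw [norm_mul, norm_mul, Complex.norm_real, Complex.norm_real, Real.norm_eq_abs, Real.norm_eq_abs]
    have h2 : |α a| * |α a'| ≤ 1 := mul_le_one₀ (hα a) (abs_nonneg _) (hα a')
    nlinarith [norm_nonneg (K a a')]
  set E := Real.exp (-((Real.log M)^3/(15000000*(Real.log Z)^2))) with hE
  have hE0 : 0 < E := Real.exp_pos _
  have hZ0 : 0 < Z := by linarith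
  have hKeq : ∀ a ∈ Ico A (2*A), ∀ a' ∈ Ico A (2*A), K a a' = ∑ b ∈ B with ((N ≤ a*b ∧ a*b < X) ∧ (N ≤ a'*b ∧ a'*b < X)), ee ((Z/a - Z/a')/b) := by
    intro a ha a' ha'
    rw [mem_Ico] at ha ha'
    rw [sum_filter]
    apply sum_congr rfl
    intro b _
    exact gk_mul N X Z a a' b (by omega) (by omega)
  have hKtriv : ∀ a ∈ Ico A (2*A), ∀ a' ∈ Ico A (2*A), ‖K a a'‖ ≤ 4*M := by
    intro a ha a' ha'
    rw [hKeq a ha a' ha']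
    refine (norm_sum_le_of_le _ (fun n _ => (norm_ee _).le)).trans ?_
    rw [sum_const, nsmul_eq_mul, mul_one]
    refine le_trans ?_ hBc
    exact_mod_cast card_filter_le _ _
  have hKes : ∀ a ∈ Ico A (2*A), ∀ a' ∈ Ico A (2*A), τ*A < |(a:ℝ) - a'| → ‖K a a'‖ ≤ 3000*M*(2*N/(Z*τ) + E) := by
    intro a ha a' ha' hd
    rw [hKeq a ha a' ha', filt_eq N X a a' (by rw [mem_Ico] at ha; omega) (by rw [mem_Ico] at ha'; omega) B (hBmem a ha)]
    set c0 := max (N ⌈/⌉ a) (N ⌈/⌉ a') with hc0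
    set c1 := min (X ⌈/⌉ a) (X ⌈/⌉ a') with hc1
    rcases le_or_gt c1 c0 with hc | hc
    · rw [Ico_eq_empty_of_le hc]; simp; positivity
    rw [mem_Ico] at ha ha'
    have a1 : (A:ℝ) ≤ a := by exact_mod_cast ha.1
    have a2 : (a:ℝ) ≤ 2*A := by exact_mod_cast ha.2.le
    have a1' : (A:ℝ) ≤ a' := by exact_mod_cast ha'.1
    have a2' : (a':ℝ) ≤ 2*A := by exact_mod_cast ha'.2.le
    have ap : (0:ℝ) < a := by linarith
    have ap' : (0:ℝ) < a' := by linarith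
    have hc0M : M ≤ c0 := by
      have h1 : N ⌈/⌉ a ≤ c0 := le_max_left _ _
      rw [ceilDiv_le_iff_le_mul (by omega)] at h1
      have h2 : (N:ℝ) ≤ a*c0 := by exact_mod_cast h1
      rw [hM, div_le_iff₀ (by positivity)]
      have : (0:ℝ) ≤ c0 := by positivity
      nlinarith
    have hc1M : (c1:ℝ) ≤ 8*M := by
      have h1 : c1 ≤ X ⌈/⌉ a := min_le_left _ _
      have h2 : ¬ (X ⌈/⌉ a ≤ c1 - 1) := by omega
      rw [ceilDiv_le_iff_le_mul (by omega), not_le] at h2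
      have h3 : (a:ℝ)*((c1-1:ℕ):ℝ) ≤ X := by exact_mod_cast h2.le
      rw [Nat.cast_sub (by omega)] at h3
      push_cast at h3
      have : (c1-1:ℝ)*A ≤ 4*M*A := by
        rw [mul_assoc, hMA]
        have : (0:ℝ) ≤ c1-1 := by
          have : (1:ℝ) ≤ c1 := by exact_mod_cast (by omega : 1 ≤ c1)
          linarith
        nlinarith
      have := le_of_mul_le_mul_right this (by linarith : (0:ℝ) < A)
      linarith
    have hY : |Z/a - Z/a'| = Z * |(a:ℝ) - a'| / (a*a') := by
      have : Z/a - Z/a' = Z*((a':ℝ)-a)/(a*a') := by field_simp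
      rw [this, abs_div, abs_mul, abs_of_pos hZ0, abs_of_pos (by positivity : (0:ℝ) < a*a'), abs_sub_comm]
    have hYl : Z*τ/(4*A) ≤ |Z/a - Z/a'| := by
      rw [hY, div_le_div_iff₀ (by positivity) (by positivity)]
      have h1 : (a:ℝ)*a' ≤ (2*A)*(2*A) := by gcongr
      have h2 : Z*τ*((a:ℝ)*a') ≤ Z*τ*((2*A)*(2*A)) := by gcongr
      have h3 : Z*(τ*A)*(4*A) ≤ Z * |(a:ℝ) - a'| * (4*A) := by gcongr
      nlinarith
    have hY2 : 2 ≤ |Z/a - Z/a'| := by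
      refine le_trans ?_ hYl
      rw [le_div_iff₀ (by positivity)]; linarith
    have hYu : |Z/a - Z/a'| ≤ Z := by
      rw [hY, div_le_iff₀ (by positivity)]
      gcongr
      have : |(a:ℝ) - a'| ≤ A := by rw [abs_le]; constructor <;> linarith
      nlinarith
    have hes := ES M (Z/a - Z/a') hM2 (by intro h; rw [h] at hY2; simp at hY2; linarith) c0 c1 hc0M hc1M
    refine hes.trans ?_
    have t1 : M/|Z/a - Z/a'| ≤ 2*N/(Z*τ) := by
      calc M/|Z/a - Z/a'| ≤ M/(Z*τ/(4*A)) := by gcongr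
        _ = 4*(M*A)/(Z*τ) := by field_simp
        _ = _ := by rw [hMA]; ring
    have hl0 : 0 < Real.log |Z/a - Z/a'| := Real.log_pos (by linarith)
    have t2 : Real.exp (-((Real.log M)^3/(15000000*(Real.log |Z/a - Z/a'|)^2))) ≤ E := by
      rw [hE]
      apply Real.exp_le_exp.2
      rw [neg_le_neg_iff]
      have : Real.log |Z/a - Z/a'| ≤ Real.log Z := Real.log_le_log (by linarith) hYu
      have : 0 ≤ Real.log M := Real.log_nonneg (by linarith)
      gcongr
    gcongr
  have s5 : ∀ a ∈ Ico A (2*A), ∑ a' ∈ Ico A (2*A), ‖K a a'‖ ≤ (2*(τ*A)+1)*(4*M) + A*(3000*M*(2*N/(Z*τ) + E)) := by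
    intro a ha
    have hpos : 0 ≤ 3000*M*(2*N/(Z*τ) + E) := by positivity
    calc ∑ a' ∈ Ico A (2*A), ‖K a a'‖ ≤ ∑ a' ∈ Ico A (2*A), ((if |(a:ℝ) - a'| ≤ τ*A then 4*M else 0) + 3000*M*(2*N/(Z*τ) + E)) := by
          apply sum_le_sum
          intro a' ha'
          split_ifs with h
          · have := hKtriv a ha a' ha'; linarith
          · have := hKes a ha a' ha' (by linarith); linarith
      _ = #((Ico A (2*A)).filter (fun a' : ℕ => |(a:ℝ) - a'| ≤ τ*A)) * (4*M) + A*(3000*M*(2*N/(Z*τ) + E)) := by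
          rw [sum_add_distrib, ← sum_filter, sum_const, sum_const, nsmul_eq_mul, nsmul_eq_mul, Nat.card_Ico,
            show 2*A - A = A by omega]
      _ ≤ _ := by
          gcongr
          exact near_count A a (τ*A) (by positivity)
  have s6 : ∑ b ∈ B, ‖u b‖^2 ≤ A*((2*(τ*A)+1)*(4*M) + A*(3000*M*(2*N/(Z*τ) + E))) := by
    refine s4.trans ((sum_le_sum s5).trans ?_)
    rw [sum_const, nsmul_eq_mul, Nat.card_Ico, show 2*A - A = A by omega]
  have s7 : ‖∑ b ∈ B, (β b:ℂ) * u b‖^2 ≤ 4*M*(A*((2*(τ*A)+1)*(4*M) + A*(3000*M*(2*N/(Z*τ) + E)))) := by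
    refine s2.trans ?_
    gcongr
  refine s7.trans ?_
  have e : 4*M*(A*((2*(τ*A)+1)*(4*M) + A*(3000*M*(2*N/(Z*τ) + E)))) = (M*A)^2*(16*(2*τ+1/A) + 12000*(2*(N/(Z*τ))+E)) := by
    field_simp; ring
  rw [e, hMA]
  have p1 : 0 < 1/(A:ℝ) := by positivity
  have p2 : 0 ≤ (N:ℝ)/(Z*τ) := by positivity
  have p3 : (0:ℝ) ≤ (N:ℝ)^2 := by positivity
  have : (16*(2*τ+1/A) + 12000*(2*(N/(Z*τ))+E)) ≤ 24000*(τ + 1/A + N/(Z*τ) + E) := by linarith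
  calc ((N:ℝ)/2)^2*(16*(2*τ+1/A) + 12000*(2*(N/(Z*τ))+E)) ≤ ((N:ℝ)/2)^2*(24000*(τ + 1/A + N/(Z*τ) + E)) := by gcongr
    _ = _ := by ring

end VK

namespace VK

open Finset

lemma mu_log (n : ℕ) : (ArithmeticFunction.moebius n : ℝ) * Real.log n =
    - ∑ p ∈ n.divisorsAntidiagonal, ArithmeticFunction.vonMangoldt p.1 * (ArithmeticFunction.moebius p.2 : ℝ) := by
  set f : ArithmeticFunction ℝ := ⟨fun n => (ArithmeticFunction.moebius n : ℝ) * Real.log n, by simp⟩ with hf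
  have h1 : f * (ArithmeticFunction.zeta : ArithmeticFunction ℝ) = - ArithmeticFunction.vonMangoldt := by
    ext n
    rw [ArithmeticFunction.coe_mul_zeta_apply]
    have := ArithmeticFunction.sum_moebius_mul_log_eq (n := n)
    simp only [ArithmeticFunction.log_apply] at this
    rw [ArithmeticFunction.neg_apply, ← this]
    rfl
  have h2 : f = - ArithmeticFunction.vonMangoldt * (ArithmeticFunction.moebius : ArithmeticFunction ℝ) := by
    rw [← h1, mul_assoc, ArithmeticFunction.coe_zeta_mul_coe_moebius, mul_one]
  have h3 : f n = (- ArithmeticFunction.vonMangoldt * (ArithmeticFunction.moebius : ArithmeticFunction ℝ)) n := by rw [← h2]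
  rw [ArithmeticFunction.mul_apply] at h3
  have h4 : f n = (ArithmeticFunction.moebius n : ℝ) * Real.log n := rfl
  rw [← h4, h3, ← sum_neg_distrib]
  apply sum_congr rfl
  intro p _
  simp [ArithmeticFunction.neg_apply]

lemma pair_sum {E : Type*} [AddCommMonoid E] (N X : ℕ) (hN : 1 ≤ N) (G : ℕ → ℕ → E) :
    ∑ n ∈ Ico N X, ∑ p ∈ n.divisorsAntidiagonal, G p.1 p.2 =
      ∑ a ∈ Ico 1 X, ∑ b ∈ Ico 1 X, if N ≤ a*b ∧ a*b < X then G a b else 0 := by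
  rw [← sum_product', ← sum_filter, sum_sigma']
  refine sum_nbij' (fun x => x.2) (fun p => ⟨p.1*p.2, p⟩) ?_ ?_ ?_ ?_ ?_
  · rintro ⟨n, a, b⟩ h
    simp only [mem_sigma, mem_Ico, Nat.mem_divisorsAntidiagonal] at h
    obtain ⟨⟨h1, h2⟩, rfl, h3⟩ := h
    have ha : a ≠ 0 := by rintro rfl; simp at h3
    have hb : b ≠ 0 := by rintro rfl; simp at h3
    simp only [mem_filter, mem_product, mem_Ico]
    have : a ≤ a*b := Nat.le_mul_of_pos_right _ (by omega)
    have : b ≤ a*b := Nat.le_mul_of_pos_left _ (by omega)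
    refine ⟨⟨⟨by omega, by omega⟩, by omega, by omega⟩, h1, h2⟩
  · rintro ⟨a, b⟩ h
    simp only [mem_filter, mem_product, mem_Ico] at h
    simp only [mem_sigma, mem_Ico, Nat.mem_divisorsAntidiagonal]
    exact ⟨h.2, trivial, by omega⟩
  · rintro ⟨n, a, b⟩ h
    simp only [mem_sigma, mem_Ico, Nat.mem_divisorsAntidiagonal] at h
    obtain ⟨⟨h1, h2⟩, rfl, h3⟩ := h
    rfl
  · rintro ⟨a, b⟩ h; rfl
  · rintro ⟨n, a, b⟩ h; rfl

lemma dyadic_split (h : ℕ → ℂ) (A I : ℕ) (B : ℝ) 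
    (hb : ∀ i < I, ‖∑ a ∈ Ico (A*2^i) (2*(A*2^i)), h a‖ ≤ B) :
    ‖∑ a ∈ Ico A (A*2^I), h a‖ ≤ I*B := by
  induction I with
  | zero => simp
  | succ I ih =>
    have e : A*2^(I+1) = 2*(A*2^I) := by rw [pow_succ]; ring
    have h1 : A ≤ A*2^I := Nat.le_mul_of_pos_right _ (by positivity)
    rw [e, ← sum_Ico_consecutive h h1 (by omega : A*2^I ≤ 2*(A*2^I))]
    refine (norm_add_le _ _).trans ?_
    have := ih (fun i hi => hb i (by omega))
    have := hb I (by omega)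
    push_cast
    linarith

lemma dyadic (N X A0 R I : ℕ) (Z τ q : ℝ) (hA0 : 1 ≤ A0) (hR : 4*R ≤ N) (hR1 : 1 ≤ R) (hNX : N ≤ X) (hX : X ≤ 2*N) (hτ : 0 < τ)
    (hZ : 8*R ≤ Z*τ) (hZ1 : 1 ≤ Z) (α β : ℕ → ℝ) (hα : ∀ a, |α a| ≤ 1) (hβ : ∀ b, |β b| ≤ 1)
    (hsupp : ∀ a, α a ≠ 0 → A0 ≤ a ∧ a ≤ R) (hI : R < A0*2^I) (q1 : τ ≤ q) (q2 : 1/(A0:ℝ) ≤ q) (q3 : N/(Z*τ) ≤ q)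
    (q4 : Real.exp (-((Real.log (N/(2*R)))^3/(15000000*(Real.log Z)^2))) ≤ q) :
    ‖∑ a ∈ Ico 1 X, ∑ b ∈ Ico 1 X, (α a:ℂ) * β b * gk N X Z a b‖ ≤ I*(N*Real.sqrt (24000*q)) := by
  set h : ℕ → ℂ := fun a => ∑ b ∈ Ico 1 X, (α a:ℂ) * β b * gk N X Z a b with hh
  have hzero : ∀ a, ¬ (A0 ≤ a ∧ a ≤ R) → h a = 0 := by
    intro a ha
    have : α a = 0 := by by_contra hc; exact ha (hsupp a hc)
    simp [hh, this]
  have e1 : ∑ a ∈ Ico 1 X, h a = ∑ a ∈ Ico A0 (A0*2^I), h a := by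
    have f1 : ∑ a ∈ Icc A0 R, h a = ∑ a ∈ Ico 1 X, h a := by
      apply sum_subset
      · intro a ha; rw [mem_Icc] at ha; rw [mem_Ico]; omega
      · intro a _ ha; rw [mem_Icc] at ha; exact hzero a ha
    have f2 : ∑ a ∈ Icc A0 R, h a = ∑ a ∈ Ico A0 (A0*2^I), h a := by
      apply sum_subset
      · intro a ha; rw [mem_Icc] at ha; rw [mem_Ico]; omega
      · intro a _ ha; rw [mem_Icc] at ha; exact hzero a ha
    rw [← f1, f2]
  change ‖∑ a ∈ Ico 1 X, h a‖ ≤ _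
  rw [e1]
  apply dyadic_split
  intro i _
  rcases le_or_gt (A0*2^i) R with hi | hi
  · set A := A0*2^i with hA
    have hA1 : A0 ≤ A := Nat.le_mul_of_pos_right _ (by positivity)
    have hAr : (A:ℝ) ≤ R := by exact_mod_cast hi
    have hA1r : (A0:ℝ) ≤ A := by exact_mod_cast hA1
    have hA0r : (1:ℝ) ≤ A0 := by exact_mod_cast hA0
    have hRr : (1:ℝ) ≤ R := by exact_mod_cast hR1
    have hRN : 4*(R:ℝ) ≤ N := by exact_mod_cast hR
    have hb := bilinear N X A Z τ (by omega) (by omega) hX hτ (by linarith) hZ1 α β hα hβ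
    have hE : Real.exp (-((Real.log (N/(2*A)))^3/(15000000*(Real.log Z)^2))) ≤ q := by
      refine le_trans (Real.exp_le_exp.2 ?_) q4
      rw [neg_le_neg_iff]
      have h1 : (1:ℝ) ≤ N/(2*R) := by rw [le_div_iff₀ (by positivity)]; linarith
      have h2 : Real.log (N/(2*R)) ≤ Real.log (N/(2*A)) := by
        apply Real.log_le_log (by linarith)
        gcongr
      have h3 : 0 ≤ Real.log (N/(2*R)) := Real.log_nonneg h1
      gcongr
    have hA' : 1/(A:ℝ) ≤ q := le_trans (by gcongr) q2
    have hq : 0 ≤ 24000*q := by linarith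
    apply le_of_sq_le_sq _ (by positivity)
    rw [mul_pow, Real.sq_sqrt hq]
    refine hb.trans ?_
    calc _ ≤ 6000*(N:ℝ)^2*(q+q+q+q) := by gcongr
      _ = _ := by ring
  · rw [sum_eq_zero]
    · simp; positivity
    · intro a ha
      rw [mem_Ico] at ha
      exact hzero a (by omega)

end VK

namespace VK

open Finset


lemma abs_mu_le (n : ℕ) : |((ArithmeticFunction.moebius n : ℤ) : ℝ)| ≤ 1 := by
  have := ArithmeticFunction.abs_moebius_le_one (n := n)
  exact_mod_cast this

lemma sum_inv_le (A : ℕ) (hA : 1 ≤ A) : ∑ a ∈ Ico 1 A, (1:ℝ)/a ≤ 1 + Real.log A := by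
  have h := harmonic_le_one_add_log A
  rw [harmonic_eq_sum_Icc] at h
  push_cast at h
  refine le_trans ?_ h
  simp only [one_div]
  apply sum_le_sum_of_subset_of_nonneg
  · intro a ha; simp only [mem_Ico, mem_Icc] at *; omega
  · intro i _ _; positivity

lemma count_mult (a X : ℕ) (ha : 1 ≤ a) : (#((Ico 1 X).filter (fun b => a*b < X)) : ℝ) ≤ X/a := by
  have h1 : (Ico 1 X).filter (fun b => a*b < X) ⊆ Icc 1 (X/a) := by
    intro b hb
    simp only [mem_filter, mem_Ico, mem_Icc] at *
    refine ⟨hb.1.1, ?_⟩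
    rw [Nat.le_div_iff_mul_le (by omega)]
    nlinarith [hb.2]
  have h2 := card_le_card h1
  rw [Nat.card_Icc] at h2
  calc (#((Ico 1 X).filter (fun b => a*b < X)) : ℝ) ≤ ((X/a : ℕ):ℝ) := by
        have h3 : #((Ico 1 X).filter (fun b => a*b < X)) ≤ X/a := by
          refine h2.trans ?_
          simp
        exact_mod_cast h3
    _ ≤ X/a := Nat.cast_div_le

lemma cheb_mult (b X : ℕ) (hb : 1 ≤ b) : ∑ a ∈ (Ico 1 X).filter (fun a => a*b < X), (ArithmeticFunction.vonMangoldt : ArithmeticFunction ℝ) a ≤ 6*X/b := by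
  have h1 : ∑ a ∈ (Ico 1 X).filter (fun a => a*b < X), (ArithmeticFunction.vonMangoldt : ArithmeticFunction ℝ) a ≤ Chebyshev.psi ((X:ℝ)/b) := by
    rw [Chebyshev.psi]
    apply sum_le_sum_of_subset_of_nonneg
    · intro a ha
      simp only [mem_filter, mem_Ico, mem_Ioc] at *
      refine ⟨by omega, ?_⟩
      apply Nat.le_floor
      rw [le_div_iff₀ (by exact_mod_cast hb)]
      exact_mod_cast ha.2.le
    · intro i _ _; exact ArithmeticFunction.vonMangoldt_nonneg
  have h2 := Chebyshev.psi_le_const_mul_self (x := (X:ℝ)/b) (by positivity)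
  have h3 : Real.log 4 ≤ 2 := by
    rw [show (4:ℝ) = 2^2 by norm_num, Real.log_pow]
    have := Real.log_two_lt_d9
    push_cast; linarith
  calc _ ≤ _ := h1.trans h2
    _ ≤ 6*((X:ℝ)/b) := by
      apply mul_le_mul_of_nonneg_right (by linarith) (by positivity)
    _ = _ := by ring

lemma triv_pairs (N X A0 : ℕ) (hA : 1 ≤ A0) :
    ∑ a ∈ Ico 1 X, ∑ b ∈ Ico 1 X, (if N ≤ a*b ∧ a*b < X then (if A0 ≤ a ∧ A0 ≤ b then 0 else (ArithmeticFunction.vonMangoldt : ArithmeticFunction ℝ) a) else 0)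
      ≤ X*(Real.log A0 + 6)*(1+Real.log A0) := by
  have hlog : 0 ≤ Real.log A0 := Real.log_natCast_nonneg _
  have key : ∀ a ∈ Ico 1 X, ∀ b ∈ Ico 1 X,
      (if N ≤ a*b ∧ a*b < X then (if A0 ≤ a ∧ A0 ≤ b then 0 else (ArithmeticFunction.vonMangoldt : ArithmeticFunction ℝ) a) else 0) ≤
      (if a < A0 then (if a*b < X then (ArithmeticFunction.vonMangoldt : ArithmeticFunction ℝ) a else 0) else 0) + (if b < A0 then (if a*b < X then (ArithmeticFunction.vonMangoldt : ArithmeticFunction ℝ) a else 0) else 0) := by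
    intro a _ b _
    have := ArithmeticFunction.vonMangoldt_nonneg (n := a)
    split_ifs <;> first | linarith | (exfalso; omega)
  refine (sum_le_sum fun a ha => sum_le_sum fun b hb => key a ha b hb).trans ?_
  simp only [sum_add_distrib]
  have e1 : ∑ a ∈ Ico 1 X, ∑ b ∈ Ico 1 X, (if a < A0 then (if a*b < X then (ArithmeticFunction.vonMangoldt : ArithmeticFunction ℝ) a else 0) else 0) ≤
      X*Real.log A0*(1+Real.log A0) := by
    have : ∀ a ∈ Ico 1 X, ∑ b ∈ Ico 1 X, (if a < A0 then (if a*b < X then (ArithmeticFunction.vonMangoldt : ArithmeticFunction ℝ) a else 0) else 0) ≤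
        if a < A0 then X*Real.log A0*(1/(a:ℝ)) else 0 := by
      intro a ha
      simp only [mem_Ico] at ha
      split_ifs with h
      · rw [← sum_filter, sum_const, nsmul_eq_mul]
        have h1 := count_mult a X ha.1
        have h2 : (ArithmeticFunction.vonMangoldt : ArithmeticFunction ℝ) a ≤ Real.log A0 := ArithmeticFunction.vonMangoldt_le_log.trans
          (Real.log_le_log (by exact_mod_cast ha.1) (by exact_mod_cast h.le))
        calc _ ≤ (X/a:ℝ)*Real.log A0 := mul_le_mul h1 h2 ArithmeticFunction.vonMangoldt_nonneg (by positivity)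
          _ = _ := by ring
      · simp
    refine (sum_le_sum this).trans ?_
    rw [← sum_filter, ← mul_sum]
    apply mul_le_mul_of_nonneg_left _ (by positivity)
    refine le_trans ?_ (sum_inv_le A0 hA)
    apply sum_le_sum_of_subset_of_nonneg
    · intro a ha; simp only [mem_filter, mem_Ico] at *; omega
    · intro i _ _; positivity
  have e2 : ∑ a ∈ Ico 1 X, ∑ b ∈ Ico 1 X, (if b < A0 then (if a*b < X then (ArithmeticFunction.vonMangoldt : ArithmeticFunction ℝ) a else 0) else 0) ≤
      X*6*(1+Real.log A0) := by
    rw [sum_comm]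
    have : ∀ b ∈ Ico 1 X, ∑ a ∈ Ico 1 X, (if b < A0 then (if a*b < X then (ArithmeticFunction.vonMangoldt : ArithmeticFunction ℝ) a else 0) else 0) ≤
        if b < A0 then X*6*(1/(b:ℝ)) else 0 := by
      intro b hb
      simp only [mem_Ico] at hb
      split_ifs with h
      · rw [← sum_filter]
        refine (cheb_mult b X hb.1).trans (le_of_eq (by ring))
      · simp
    refine (sum_le_sum this).trans ?_
    rw [← sum_filter, ← mul_sum]
    apply mul_le_mul_of_nonneg_left _ (by positivity)
    refine le_trans ?_ (sum_inv_le A0 hA)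
    apply sum_le_sum_of_subset_of_nonneg
    · intro a ha; simp only [mem_filter, mem_Ico] at *; omega
    · intro i _ _; positivity
  calc _ ≤ X*Real.log A0*(1+Real.log A0) + X*6*(1+Real.log A0) := add_le_add e1 e2
    _ = _ := by ring

noncomputable def wgt (A0 n : ℕ) : ℝ :=
  ∑ p ∈ n.divisorsAntidiagonal, if A0 ≤ p.1 ∧ A0 ≤ p.2 then (ArithmeticFunction.vonMangoldt : ArithmeticFunction ℝ) p.1 * (ArithmeticFunction.moebius p.2 : ℝ) else 0

lemma abs_wgt_le (A0 n : ℕ) : |wgt A0 n| ≤ Real.log n := by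
  unfold wgt
  refine (abs_sum_le_sum_abs _ _).trans ?_
  rw [← ArithmeticFunction.vonMangoldt_sum (n := n), ← Nat.sum_divisorsAntidiagonal (f := fun i _ => (ArithmeticFunction.vonMangoldt : ArithmeticFunction ℝ) i)]
  apply sum_le_sum
  intro p _
  have h := ArithmeticFunction.vonMangoldt_nonneg (n := p.1)
  split_ifs
  · rw [abs_mul, abs_of_nonneg h]
    exact mul_le_of_le_one_right h (abs_mu_le _)
  · simpa using h

lemma block_triv (N X A0 : ℕ) (T : ℝ) (hA : 1 ≤ A0) (hN : 1 ≤ N) :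
    |∑ n ∈ Ico N X, (ArithmeticFunction.moebius n : ℝ) * Real.log n * psi (T/n)| ≤
      |∑ n ∈ Ico N X, wgt A0 n * psi (T/n)| + X*(Real.log A0 + 6)*(1+Real.log A0) := by
  have hd : ∑ n ∈ Ico N X, (ArithmeticFunction.moebius n : ℝ) * Real.log n * psi (T/n) = -∑ n ∈ Ico N X, wgt A0 n * psi (T/n) -
      ∑ n ∈ Ico N X, ∑ p ∈ n.divisorsAntidiagonal, (if A0 ≤ p.1 ∧ A0 ≤ p.2 then 0 else (ArithmeticFunction.vonMangoldt : ArithmeticFunction ℝ) p.1 * (ArithmeticFunction.moebius p.2 : ℝ)) * psi (T/n) := by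
    rw [← sum_neg_distrib, ← sum_sub_distrib]
    apply sum_congr rfl
    intro n _
    rw [mu_log, ← sum_mul, wgt, ← neg_mul, ← sub_mul, ← sum_neg_distrib, ← sum_neg_distrib, ← sum_sub_distrib]
    congr 1
    apply sum_congr rfl
    intro p _
    split_ifs <;> simp
  have hr : |∑ n ∈ Ico N X, ∑ p ∈ n.divisorsAntidiagonal, (if A0 ≤ p.1 ∧ A0 ≤ p.2 then 0 else (ArithmeticFunction.vonMangoldt : ArithmeticFunction ℝ) p.1 * (ArithmeticFunction.moebius p.2 : ℝ)) * psi (T/n)|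
      ≤ X*(Real.log A0 + 6)*(1+Real.log A0) := by
    refine le_trans ?_ (triv_pairs N X A0 hA)
    rw [← pair_sum N X hN (fun a b => if A0 ≤ a ∧ A0 ≤ b then 0 else (ArithmeticFunction.vonMangoldt : ArithmeticFunction ℝ) a)]
    refine (abs_sum_le_sum_abs _ _).trans (sum_le_sum fun n _ => ?_)
    refine (abs_sum_le_sum_abs _ _).trans (sum_le_sum fun p _ => ?_)
    have h := ArithmeticFunction.vonMangoldt_nonneg (n := p.1)
    split_ifs
    · simp
    · rw [abs_mul, abs_mul, abs_of_nonneg h, mul_assoc]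
      apply mul_le_of_le_one_right h
      have h1 := abs_mu_le p.2
      have h2 := abs_psi_le (T/n)
      have h3 := abs_nonneg (psi (T/n))
      nlinarith [abs_nonneg (ArithmeticFunction.moebius p.2 : ℝ)]
  rw [hd, sub_eq_add_neg]
  refine (abs_add_le _ _).trans ?_
  rw [abs_neg, abs_neg]
  linarith

lemma gk_comm (N X : ℕ) (Z : ℝ) (a b : ℕ) : gk N X Z a b = gk N X Z b a := by
  unfold gk
  rw [mul_comm a b, mul_comm (a:ℝ) b]

/-- exponential sums with the weight -/
lemma wgt_sum (N X A0 R I : ℕ) (Z τ q B : ℝ) (hA0 : 1 ≤ A0) (hR : 4*R ≤ N) (hR1 : 1 ≤ R) (hNX : N ≤ X) (hX : X ≤ 2*N)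
    (hRR : 2*N < (R+1)*(R+1))
    (hτ : 0 < τ) (hZ : 8*R ≤ Z*τ) (hZ1 : 1 ≤ Z) (hB : 0 < B) (hB1 : Real.log (2*N) ≤ B)
    (hI : R < A0*2^I) (q1 : τ ≤ q) (q2 : 1/(A0:ℝ) ≤ q) (q3 : N/(Z*τ) ≤ q)
    (q4 : Real.exp (-((Real.log (N/(2*R)))^3/(15000000*(Real.log Z)^2))) ≤ q) :
    ‖∑ n ∈ Ico N X, (wgt A0 n : ℂ) * ee (Z/n)‖ ≤ 2*B*(I*(N*Real.sqrt (24000*q))) := by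
  have hN : 1 ≤ N := by omega
  set α1 : ℕ → ℝ := fun a => if A0 ≤ a ∧ a ≤ R then (ArithmeticFunction.vonMangoldt : ArithmeticFunction ℝ) a / B else 0 with hα1
  set β1 : ℕ → ℝ := fun b => if A0 ≤ b then (ArithmeticFunction.moebius b : ℝ) else 0 with hβ1
  set α2 : ℕ → ℝ := fun b => if A0 ≤ b ∧ b ≤ R then (ArithmeticFunction.moebius b : ℝ) else 0 with hα2
  set β2 : ℕ → ℝ := fun a => if A0 ≤ a ∧ R < a ∧ a < X then (ArithmeticFunction.vonMangoldt : ArithmeticFunction ℝ) a / B else 0 with hβ2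
  have hΛ : ∀ a, 1 ≤ a → a < X → |(ArithmeticFunction.vonMangoldt : ArithmeticFunction ℝ) a / B| ≤ 1 := by
    intro a ha haX
    rw [abs_of_nonneg (div_nonneg ArithmeticFunction.vonMangoldt_nonneg hB.le), div_le_one hB]
    refine ArithmeticFunction.vonMangoldt_le_log.trans (le_trans ?_ hB1)
    apply Real.log_le_log (by exact_mod_cast ha)
    exact_mod_cast (by omega : a ≤ 2*N)
  have d1 := dyadic N X A0 R I Z τ q hA0 hR hR1 hNX hX hτ hZ hZ1 α1 β1
    (by
      intro a; rw [hα1]; simp only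
      split_ifs with h
      · exact hΛ a (by omega) (by omega)
      · simp)
    (by
      intro a; rw [hβ1]; simp only
      split_ifs with h
      · exact abs_mu_le a
      · simp)
    (by
      intro a; rw [hα1]; simp only
      intro h
      by_contra hc
      rw [if_neg hc] at h
      exact h rfl) hI q1 q2 q3 q4
  have d2 := dyadic N X A0 R I Z τ q hA0 hR hR1 hNX hX hτ hZ hZ1 α2 β2
    (by
      intro a; rw [hα2]; simp only
      split_ifs with h
      · exact abs_mu_le a
      · simp)
    (by
      intro a; rw [hβ2]; simp only
      split_ifs with h
      · exact hΛ a (by omega) (by omega)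
      · simp)
    (by
      intro a; rw [hα2]; simp only
      intro h
      by_contra hc
      rw [if_neg hc] at h
      exact h rfl) hI q1 q2 q3 q4
  have hs : ∑ n ∈ Ico N X, (wgt A0 n : ℂ) * ee (Z/n) =
      B * (∑ a ∈ Ico 1 X, ∑ b ∈ Ico 1 X, (α1 a:ℂ) * β1 b * gk N X Z a b) +
      B * (∑ a ∈ Ico 1 X, ∑ b ∈ Ico 1 X, (α2 a:ℂ) * β2 b * gk N X Z a b) := by
    have : ∀ n ∈ Ico N X, (wgt A0 n : ℂ) * ee (Z/n) = ∑ p ∈ n.divisorsAntidiagonal,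
        ((if A0 ≤ p.1 ∧ A0 ≤ p.2 then (ArithmeticFunction.vonMangoldt : ArithmeticFunction ℝ) p.1 * (ArithmeticFunction.moebius p.2 : ℝ) else 0 : ℝ) : ℂ) * ee (Z/((p.1:ℝ)*p.2)) := by
      intro n _
      unfold wgt
      rw [Complex.ofReal_sum, sum_mul]
      apply sum_congr rfl
      intro p hp
      rw [Nat.mem_divisorsAntidiagonal] at hp
      rw [← hp.1]
      push_cast
      rfl
    rw [sum_congr rfl this, pair_sum N X hN (fun a b => ((if A0 ≤ a ∧ A0 ≤ b then (ArithmeticFunction.vonMangoldt : ArithmeticFunction ℝ) a * (ArithmeticFunction.moebius b : ℝ) else 0 : ℝ) : ℂ) * ee (Z/((a:ℝ)*b)))]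
    rw [sum_comm (f := fun a b => (α2 a:ℂ) * β2 b * gk N X Z a b)]
    rw [← mul_add, ← sum_add_distrib, mul_sum]
    apply sum_congr rfl
    intro a ha
    rw [← sum_add_distrib, mul_sum]
    apply sum_congr rfl
    intro b hb
    rw [gk_comm N X Z b a]
    simp only [mem_Ico] at ha hb
    unfold gk
    by_cases hc : N ≤ a*b ∧ a*b < X
    · rw [if_pos hc, if_pos hc, ← add_mul, ← mul_assoc]
      congr 1
      have : (if A0 ≤ a ∧ A0 ≤ b then (ArithmeticFunction.vonMangoldt : ArithmeticFunction ℝ) a * (ArithmeticFunction.moebius b : ℝ) else 0 : ℝ) = B*(α1 a*β1 b + α2 b*β2 a) := by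
        have hBne := hB.ne'
        by_cases hA : A0 ≤ a ∧ A0 ≤ b
        · rw [if_pos hA]
          by_cases haR : a ≤ R
          · have e1 : α1 a = (ArithmeticFunction.vonMangoldt : ArithmeticFunction ℝ) a / B := by rw [hα1]; simp only; rw [if_pos ⟨hA.1, haR⟩]
            have e2 : β1 b = ArithmeticFunction.moebius b := by rw [hβ1]; simp only; rw [if_pos hA.2]
            have e3 : β2 a = 0 := by rw [hβ2]; simp only; rw [if_neg (by omega)]
            rw [e1, e2, e3]; field_simp; ring
          · have hbR : b ≤ R := by
              by_contra hbR
              have : (R+1)*(R+1) ≤ a*b := Nat.mul_le_mul (by omega) (by omega)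
              omega
            have e1 : α1 a = 0 := by rw [hα1]; simp only; rw [if_neg (by omega)]
            have e2 : α2 b = ArithmeticFunction.moebius b := by rw [hα2]; simp only; rw [if_pos ⟨hA.2, hbR⟩]
            have e3 : β2 a = (ArithmeticFunction.vonMangoldt : ArithmeticFunction ℝ) a / B := by rw [hβ2]; simp only; rw [if_pos (by omega)]
            rw [e1, e2, e3]; field_simp; ring
        · rw [if_neg hA]
          by_cases haA : A0 ≤ a
          · have e1 : β1 b = 0 := by rw [hβ1]; simp only; rw [if_neg (by omega)]
            have e2 : α2 b = 0 := by rw [hα2]; simp only; rw [if_neg (by omega)]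
            rw [e1, e2]; ring
          · have e1 : α1 a = 0 := by rw [hα1]; simp only; rw [if_neg (by omega)]
            have e2 : β2 a = 0 := by rw [hβ2]; simp only; rw [if_neg (by omega)]
            rw [e1, e2]; ring
      rw [this]
      push_cast
      ring
    · rw [if_neg hc, if_neg hc]; ring
  rw [hs]
  refine (norm_add_le _ _).trans ?_
  rw [norm_mul, norm_mul]
  have hBn : ‖(B:ℂ)‖ = B := by rw [Complex.norm_real, Real.norm_of_nonneg hB.le]
  rw [hBn]
  have := mul_le_mul_of_nonneg_left d1 hB.le
  have := mul_le_mul_of_nonneg_left d2 hB.le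
  linarith

end VK

namespace VK

open Finset

lemma log_third (N R : ℕ) (hN : 512 ≤ N) (hR1 : 1 ≤ R) (hR : R*R ≤ 2*N) : Real.log N / 3 ≤ Real.log (N/(2*R)) := by
  have hNr : (512:ℝ) ≤ N := by exact_mod_cast hN
  have hRr : (1:ℝ) ≤ R := by exact_mod_cast hR1
  have hRR : (R:ℝ)^2 ≤ 2*N := by rw [sq]; exact_mod_cast hR
  have h1 : (N:ℝ) ≤ (N/(2*R))^3 := by
    rw [div_pow, le_div_iff₀ (by positivity)]
    have h2 : ((2*(R:ℝ))^3)^2 ≤ ((N:ℝ)^2)^2 := by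
      have : ((R:ℝ)^2)^3 ≤ (2*N)^3 := pow_le_pow_left₀ (by positivity) hRR 3
      nlinarith [pow_pos (by linarith : (0:ℝ) < N) 3]
    have h3 := abs_le_of_sq_le_sq h2 (by positivity)
    have h4 := (le_abs_self _).trans h3
    nlinarith
  have h2 := Real.log_le_log (by linarith) h1
  rw [Real.log_pow] at h2
  push_cast at h2
  linarith

lemma exp_mono_aux {u v w w' : ℝ} (hu : 0 ≤ u) (huv : u ≤ v) (hw : 0 < w) (hw' : w ≤ w') :
    Real.exp (-(v^3/(15000000*w^2))) ≤ Real.exp (-(u^3/(15000000*w'^2))) := by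
  apply Real.exp_le_exp.2
  apply neg_le_neg
  have h1 : u^3 ≤ v^3 := pow_le_pow_left₀ hu huv 3
  have h2 : w^2 ≤ w'^2 := pow_le_pow_left₀ hw.le hw' 2
  have : 0 ≤ v^3 := by have := hu.trans huv; positivity
  apply div_le_div₀ this h1 (by positivity)
  linarith

lemma exp_ge_cube (L : ℝ) (hL : 100000000 ≤ L) : 100*L^2 ≤ Real.exp L := by
  have h := Real.pow_div_factorial_le_exp L (by linarith) 3
  have : L^3/(Nat.factorial 3) = L^3/6 := by norm_num [Nat.factorial]
  rw [this] at h
  nlinarith [sq_nonneg L]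

set_option maxHeartbeats 1000000 in
theorem block_w (T L : ℝ) (hT0 : 0 < T) (hL : Real.log T = L) (hL1 : 100000000 ≤ L) (N X : ℕ) (hN : 512 ≤ N)
    (hNX : N ≤ X) (hX : X ≤ 2*N) (h1 : N*L^14 ≤ T)
    (h2 : Real.exp (-((Real.log N/3)^3/(15000000*(2*L)^2))) ≤ 1/L^7) :
    |∑ n ∈ Ico N X, wgt ⌈L^7⌉₊ n * psi (T/n)| ≤ 9*N := by
  have hL0 : 0 < L := by linarith
  have hTe : T = Real.exp L := by rw [← hL, Real.exp_log hT0]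
  have hT1 : 100*L^2 ≤ T := hTe ▸ exp_ge_cube L hL1
  have hNr : (512:ℝ) ≤ N := by exact_mod_cast hN
  have hNT : (N:ℝ) ≤ T := by
    have : 1 ≤ L^14 := one_le_pow₀ (by linarith)
    nlinarith
  set A0 := ⌈L^7⌉₊ with hA0
  have hA0L : L^7 ≤ A0 := Nat.le_ceil _
  have hL7 : 1 ≤ L^7 := one_le_pow₀ (by linarith)
  have hA01 : 1 ≤ A0 := by exact_mod_cast hL7.trans hA0L
  set R := Nat.sqrt (2*N) with hR
  have hRle : R*R ≤ 2*N := Nat.sqrt_le _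
  have hRlt : 2*N < (R+1)*(R+1) := Nat.lt_succ_sqrt _
  have hR1 : 1 ≤ R := by nlinarith
  have hR4 : 4*R ≤ N := by nlinarith
  set I := Nat.log 2 R + 1 with hI
  have hI1 : R < A0*2^I := by
    have := Nat.lt_pow_succ_log_self (b := 2) (by norm_num) R
    calc R < 2^I := this
      _ ≤ A0*2^I := Nat.le_mul_of_pos_left _ hA01
  have hI2 : (I:ℝ) ≤ 3*L := by
    have h3 : (2:ℝ)^(Nat.log 2 R) ≤ T := by
      have : 2^(Nat.log 2 R) ≤ R := Nat.pow_log_le_self 2 (by omega)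
      have h4 : 2^(Nat.log 2 R) ≤ N := by omega
      calc (2:ℝ)^(Nat.log 2 R) ≤ N := by exact_mod_cast h4
        _ ≤ T := hNT
    have h4 := Real.log_le_log (by positivity) h3
    rw [Real.log_pow, hL] at h4
    have := Real.log_two_gt_d9
    rw [hI]; push_cast
    have h5 : (0:ℝ) ≤ (Nat.log 2 R:ℕ) := by positivity
    nlinarith
  set H := ⌈4*L^2⌉₊ with hH
  have hH1 : 4*L^2 ≤ H := Nat.le_ceil _
  have hH2 : (H:ℝ) ≤ 4*L^2+1 := (Nat.ceil_lt_add_one (by positivity)).le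
  have hHpos : 1 ≤ H := by
    have : (1:ℝ) ≤ H := by nlinarith
    exact_mod_cast this
  have hHT : (H:ℝ) ≤ T := by nlinarith
  have hlogh : ∀ h : ℕ, 1 ≤ h → h ≤ H → 0 < Real.log (h*T) ∧ Real.log (h*T) ≤ 2*L := by
    intro h hh hh'
    have a1 : (1:ℝ) ≤ h := by exact_mod_cast hh
    have a2 : (h:ℝ) ≤ T := le_trans (by exact_mod_cast hh') hHT
    constructor
    · apply Real.log_pos; nlinarith
    · rw [Real.log_mul (by positivity) (by positivity), hL]
      have := Real.log_le_log (by positivity) a2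
      rw [hL] at this; linarith
  have hlogN : 0 ≤ Real.log N := Real.log_natCast_nonneg _
  have hB : Real.log (2*N) ≤ 2*L := by
    rw [Real.log_mul (by norm_num) (by positivity)]
    have := Real.log_le_log (by positivity) hNT
    rw [hL] at this
    have := Real.log_two_lt_d9
    linarith
  have hcard : (#(Ico N X):ℝ) ≤ N := by
    rw [Nat.card_Ico]
    exact_mod_cast (by omega : X - N ≤ N)
  set q : ℝ := 1/L^7 with hq
  have hq0 : 0 < q := by positivity
  have hqL : q*L^7 = 1 := by rw [hq]; field_simp
  have hNT' : (N:ℝ) ≤ T*q*q := by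
    have : (N:ℝ)*L^14*(q*q) ≤ T*(q*q) := mul_le_mul_of_nonneg_right h1 (by positivity)
    calc (N:ℝ) = N*((q*L^7)*(q*L^7)) := by rw [hqL]; ring
      _ = N*L^14*(q*q) := by ring
      _ ≤ _ := this
      _ = _ := by ring
  have hq1 : q ≤ 1 := by rw [hq, div_le_one (by positivity)]; exact hL7
  have hmain := psi_weighted ℕ (s := Ico N X) (w := fun n => wgt A0 n) (x := fun n => T/n) (W := 2*L) (E := N/(2*L))
    (δ := 1/(2*L)) (H := H) hHpos (by positivity) (by positivity) (by positivity)
    (by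
      intro n hn
      simp only [mem_Ico] at hn
      refine (abs_wgt_le A0 n).trans (le_trans ?_ hB)
      apply Real.log_le_log
      · exact_mod_cast (by omega : 0 < n)
      · exact_mod_cast (by omega : n ≤ 2*N))
    (by
      intro h hh hh'
      have a1 : (1:ℝ) ≤ h := by exact_mod_cast hh
      have hZT : T ≤ h*T := by nlinarith
      have key := wgt_sum N X A0 R I (h*T) q q (2*L) hA01 hR4 hR1 hNX hX hRlt hq0
        (by
          have : 8*(R:ℝ) ≤ 2*N := by exact_mod_cast (by omega : 8*R ≤ 2*N)
          have h3 : (N:ℝ)*L^7 ≤ T*q := by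
            calc (N:ℝ)*L^7 ≤ T*q*q*L^7 := mul_le_mul_of_nonneg_right hNT' (by positivity)
              _ = T*q*(q*L^7) := by ring
              _ = T*q := by rw [hqL, mul_one]
          have h4 : T*q ≤ h*T*q := mul_le_mul_of_nonneg_right hZT hq0.le
          have h5 : 2 ≤ L^7 := by
            calc (2:ℝ) ≤ L^1 := by linarith
              _ ≤ L^7 := pow_le_pow_right₀ (by linarith) (by norm_num)
          nlinarith)
        (by nlinarith) (by positivity) hB hI1 le_rfl
        (by
          rw [hq]
          exact one_div_le_one_div_of_le (by positivity) hA0L)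
        (by
          rw [div_le_iff₀ (by positivity)]
          have : T*q*q ≤ h*T*q*q := by
            apply mul_le_mul_of_nonneg_right _ hq0.le
            exact mul_le_mul_of_nonneg_right hZT hq0.le
          linarith)
        (by
          refine le_trans ?_ h2
          obtain ⟨l1, l2⟩ := hlogh h hh hh'
          exact exp_mono_aux (by positivity) (log_third N R hN hR1 hRle) l1 l2)
      have e : ∀ n ∈ Ico N X, ((wgt A0 n : ℝ):ℂ) * ee (h*(T/n)) = (wgt A0 n : ℂ) * ee (h*T/n) := by
        intro n _; rw [mul_div_assoc]
      rw [sum_congr rfl e]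
      refine key.trans ?_
      have hs : Real.sqrt (24000*q) ≤ 1/(24*L^3) := by
        rw [Real.sqrt_le_left (by positivity), hq, div_pow, mul_one_div, div_le_div_iff₀ (by positivity) (by positivity)]
        have : 0 < L^6 := by positivity
        nlinarith
      rw [le_div_iff₀ (by positivity)]
      have hIs : (I:ℝ)*Real.sqrt (24000*q) ≤ 3*L*(1/(24*L^3)) :=
        mul_le_mul hI2 hs (Real.sqrt_nonneg _) (by positivity)
      calc 2*(2*L)*(I*(N*Real.sqrt (24000*q)))*(2*L) = 8*L^2*N*(I*Real.sqrt (24000*q)) := by ring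
        _ ≤ 8*L^2*N*(3*L*(1/(24*L^3))) := mul_le_mul_of_nonneg_left hIs (by positivity)
        _ = N := by field_simp; norm_num)
    (by
      intro h hh hh'
      have a1 : (1:ℝ) ≤ h := by exact_mod_cast hh
      have hZT : T ≤ h*T := by nlinarith
      have hpos : 0 < h*T := by positivity
      have key := ES N (h*T) (by exact_mod_cast (by omega : 2 ≤ N)) hpos.ne' N X (le_refl _) (by exact_mod_cast (by omega : X ≤ 8*N))
      rw [abs_of_pos hpos] at key
      have e : ∀ n ∈ Ico N X, ee (h*(T/n)) = ee (h*T/n) := by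
        intro n _; rw [mul_div_assoc]
      rw [sum_congr rfl e]
      obtain ⟨l1, l2⟩ := hlogh h hh hh'
      have k1 : Real.exp (-((Real.log N)^3/(15000000*(Real.log (h*T))^2))) ≤ q := by
        refine le_trans ?_ h2
        exact exp_mono_aux (by positivity) (by linarith) l1 l2
      have k2 : (N:ℝ)/(h*T) ≤ q := by
        rw [div_le_iff₀ hpos]
        have : T*q*q ≤ T*q := by
          have : 0 ≤ T*q := by positivity
          nlinarith
        have : T*q ≤ h*T*q := mul_le_mul_of_nonneg_right hZT hq0.le
        linarith
      have k3 : 3000*(N:ℝ)*(N/(h*T) + Real.exp (-((Real.log N)^3/(15000000*(Real.log (h*T))^2)))) ≤ 3000*N*(2*q) := by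
        apply mul_le_mul_of_nonneg_left (by linarith) (by positivity)
      rw [le_div_iff₀ (by positivity)]
      have k4 : 24000*q*L^2 ≤ 1 := by
        rw [hq, mul_one_div, div_mul_eq_mul_div, div_le_one (by positivity)]
        calc 24000*L^2 ≤ L*L^2 := by nlinarith [sq_nonneg L]
          _ = L^3 := by ring
          _ ≤ L^7 := pow_le_pow_right₀ (by linarith) (by norm_num)
      calc 2*L*‖∑ n ∈ Ico N X, ee (h*T/n)‖*(2*L) = 4*L^2*‖∑ n ∈ Ico N X, ee (h*T/n)‖ := by ring
        _ ≤ 4*L^2*(3000*N*(2*q)) := mul_le_mul_of_nonneg_left (key.trans k3) (by positivity)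
        _ = N*(24000*q*L^2) := by ring
        _ ≤ N*1 := mul_le_mul_of_nonneg_left k4 (by positivity)
        _ = N := mul_one _)
  refine hmain.trans ?_
  have hc0 : (0:ℝ) ≤ #(Ico N X) := Nat.cast_nonneg _
  have f1 : 2*L*#(Ico N X)/H ≤ N/(2*L) := by
    rw [div_le_div_iff₀ (by positivity) (by positivity)]
    calc 2*L*#(Ico N X)*(2*L) = #(Ico N X)*(4*L^2) := by ring
      _ ≤ N*H := mul_le_mul hcard hH1 (by positivity) (Nat.cast_nonneg _)
  have f2 : (N/(2*L) + 2*L*#(Ico N X)/H)/(1/(2*L)) ≤ 2*N := by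
    rw [div_le_iff₀ (by positivity)]
    calc _ ≤ N/(2*L) + N/(2*L) := by linarith
      _ = _ := by ring
  have f3 : 1/(2*L)*(2*L)*#(Ico N X) ≤ N := by
    rw [one_div, inv_mul_cancel₀ (by positivity), one_mul]; exact hcard
  linarith

theorem block (T L : ℝ) (hT0 : 0 < T) (hL : Real.log T = L) (hL1 : 100000000 ≤ L) (N X : ℕ) (hN : 512 ≤ N)
    (hNX : N ≤ X) (hX : X ≤ 2*N) (h1 : N*L^14 ≤ T)
    (h2 : Real.exp (-((Real.log N/3)^3/(15000000*(2*L)^2))) ≤ 1/L^7) :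
    |∑ n ∈ Ico N X, (ArithmeticFunction.moebius n : ℝ) * Real.log n * psi (T/n)| ≤ 300*N*(Real.log L)^2 := by
  have hL0 : 0 < L := by linarith
  have hl1 : 1 ≤ Real.log L := by
    rw [Real.le_log_iff_exp_le hL0]
    have := Real.exp_one_lt_d9
    linarith
  have hL7 : 1 ≤ L^7 := one_le_pow₀ (by linarith)
  have hA0L : L^7 ≤ ⌈L^7⌉₊ := Nat.le_ceil _
  have hA01 : 1 ≤ ⌈L^7⌉₊ := by exact_mod_cast hL7.trans hA0L
  have b1 := block_triv N X ⌈L^7⌉₊ T hA01 (by omega)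
  have b2 := block_w T L hT0 hL hL1 N X hN hNX hX h1 h2
  have hlogA : Real.log ⌈L^7⌉₊ ≤ 7*Real.log L + 1 := by
    have h3 : (⌈L^7⌉₊:ℝ) ≤ L^7*2 := by
      have := Nat.ceil_lt_add_one (show 0 ≤ L^7 by positivity)
      linarith
    have h4 := Real.log_le_log (by exact_mod_cast hA01) h3
    rw [Real.log_mul (by positivity) (by norm_num), Real.log_pow] at h4
    have := Real.log_two_lt_d9
    push_cast at h4
    linarith
  have hA00 : 0 ≤ Real.log ⌈L^7⌉₊ := Real.log_natCast_nonneg _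
  have hXr : (X:ℝ) ≤ 2*N := by exact_mod_cast hX
  set ℓ := Real.log L
  have f : (Real.log ⌈L^7⌉₊ + 6)*(1+Real.log ⌈L^7⌉₊) ≤ (14*ℓ)*(9*ℓ) :=
    mul_le_mul (by linarith) (by linarith) (by linarith) (by linarith)
  have f2 : (X:ℝ)*((Real.log ⌈L^7⌉₊ + 6)*(1+Real.log ⌈L^7⌉₊)) ≤ 2*N*((14*ℓ)*(9*ℓ)) :=
    mul_le_mul hXr f (by positivity) (by positivity)
  have f3 : (N:ℝ)*1 ≤ N*ℓ^2 := mul_le_mul_of_nonneg_left (one_le_pow₀ hl1) (by positivity)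
  have f4 : (0:ℝ) ≤ N := by positivity
  calc _ ≤ _ := b1
    _ ≤ 9*N + (X:ℝ)*((Real.log ⌈L^7⌉₊ + 6)*(1+Real.log ⌈L^7⌉₊)) := by rw [← mul_assoc]; linarith
    _ ≤ 300*N*ℓ^2 := by nlinarith

end VK

namespace VK

open Finset

lemma abel_r (c g : ℕ → ℝ) (P : ℝ) (a b : ℕ) (hab : a ≤ b)
    (hP : ∀ k, a ≤ k → k ≤ b → |∑ n ∈ Ico a k, c n| ≤ P)
    (hg : ∀ n, a ≤ n → g (n+1) ≤ g n) (hg0 : ∀ n, a ≤ n → 0 ≤ g n) :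
    |∑ n ∈ Ico a b, c n * g n| ≤ P * g a := by
  have main : ∀ k, a ≤ k → k ≤ b → |∑ n ∈ Ico a k, c n * g n - (∑ n ∈ Ico a k, c n) * g k| ≤ P * (g a - g k) := by
    intro k hk
    induction k, hk using Nat.le_induction with
    | base => intro _; simp
    | succ k hk ih =>
      intro hkb
      have i1 := ih (by omega)
      rw [sum_Ico_succ_top hk]
      have e : ∑ n ∈ Ico a k, c n * g n + c k * g k - (∑ n ∈ Ico a (k+1), c n) * g (k+1) =
        (∑ n ∈ Ico a k, c n * g n - (∑ n ∈ Ico a k, c n) * g k) + (∑ n ∈ Ico a (k+1), c n) * (g k - g (k+1)) := by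
        rw [sum_Ico_succ_top hk]; ring
      rw [e]
      refine (abs_add_le _ _).trans ?_
      have h2 := hP (k+1) (by omega) hkb
      have h3 := hg k hk
      rw [abs_mul, abs_of_nonneg (by linarith : 0 ≤ g k - g (k+1))]
      have h4 := mul_le_mul_of_nonneg_right h2 (by linarith : 0 ≤ g k - g (k+1))
      linarith
  have h1 := main b hab le_rfl
  have h2 := hP b hab le_rfl
  have h3 := hg0 b hab
  have h4 : |(∑ n ∈ Ico a b, c n) * g b| ≤ P * g b := by
    rw [abs_mul, abs_of_nonneg h3]; exact mul_le_mul_of_nonneg_right h2 h3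
  have := abs_add_le (∑ n ∈ Ico a b, c n * g n - (∑ n ∈ Ico a b, c n) * g b) ((∑ n ∈ Ico a b, c n) * g b)
  rw [sub_add_cancel] at this
  linarith

lemma tail_inv (a b : ℕ) (ha : 1 ≤ a) (hab : a ≤ b) : ∑ n ∈ Ico a (b+1), (1:ℝ)/n ≤ 1 + Real.log b - Real.log a := by
  induction b, hab using Nat.le_induction with
  | base =>
    have : (1:ℝ) ≤ a := by exact_mod_cast ha
    simp only [Nat.Ico_succ_singleton, sum_singleton]
    rw [div_le_iff₀ (by linarith)]
    linarith
  | succ b hb ih =>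
    rw [sum_Ico_succ_top (by omega)]
    have hb0 : (1:ℝ) ≤ b := by exact_mod_cast (by omega : 1 ≤ b)
    have h1 := Real.log_le_sub_one_of_pos (x := (b:ℝ)/(b+1)) (by positivity)
    rw [Real.log_div (by positivity) (by positivity)] at h1
    have h2 : (b:ℝ)/(b+1) - 1 = -(1/(b+1)) := by field_simp; ring
    push_cast
    linarith

lemma abs_term_le (T : ℝ) (n : ℕ) : |(ArithmeticFunction.moebius n : ℝ)/n * psi (T/n)| ≤ 1/n := by
  rw [abs_mul, abs_div, Nat.abs_cast]
  have h1 := abs_mu_le n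
  have h2 := abs_psi_le (T/n)
  have h3 : |(ArithmeticFunction.moebius n : ℝ)|/n ≤ 1/n := by gcongr
  have h4 : (0:ℝ) ≤ 1/n := by positivity
  calc _ ≤ (1:ℝ)/n*1 := mul_le_mul h3 (by linarith) (abs_nonneg _) h4
    _ = _ := mul_one _

lemma block_inv (T L Y : ℝ) (hT0 : 0 < T) (hL : Real.log T = L) (hL1 : 100000000 ≤ L) (hY0 : 0 < Y) (N X : ℕ) (hN : 512 ≤ N)
    (hNX : N ≤ X) (hX : X ≤ 2*N) (h1 : N*L^14 ≤ T) (hY : Y ≤ Real.log N)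
    (h2 : Real.exp (-((Y/3)^3/(15000000*(2*L)^2))) ≤ 1/L^7) :
    |∑ n ∈ Ico N X, (ArithmeticFunction.moebius n : ℝ)/n * psi (T/n)| ≤ 300*(Real.log L)^2/Y := by
  have h2' : Real.exp (-((Real.log N/3)^3/(15000000*(2*L)^2))) ≤ 1/L^7 := by
    refine le_trans ?_ h2
    exact exp_mono_aux (by positivity) (by linarith) (by linarith) le_rfl
  have hNr : (512:ℝ) ≤ N := by exact_mod_cast hN
  have key := abel_r (fun n => (ArithmeticFunction.moebius n : ℝ) * Real.log n * psi (T/n)) (fun n => 1/((n:ℝ)*Real.log n))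
    (300*N*(Real.log L)^2) N X hNX
    (by
      intro k hk hkX
      exact block T L hT0 hL hL1 N k hN hk (by omega) h1 h2')
    (by
      intro n hn
      have hn2 : (2:ℝ) ≤ n := by exact_mod_cast (by omega : 2 ≤ n)
      have hl : 0 < Real.log n := Real.log_pos (by linarith)
      push_cast
      apply one_div_le_one_div_of_le (by positivity)
      apply mul_le_mul (by linarith) _ hl.le (by linarith)
      apply Real.log_le_log (by linarith) (by linarith))
    (by
      intro n hn
      have := Real.log_natCast_nonneg n
      positivity)
  have e : ∑ n ∈ Ico N X, (ArithmeticFunction.moebius n : ℝ)/n * psi (T/n) =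
    ∑ n ∈ Ico N X, (ArithmeticFunction.moebius n : ℝ) * Real.log n * psi (T/n) * (1/((n:ℝ)*Real.log n)) := by
    apply sum_congr rfl
    intro n hn
    simp only [mem_Ico] at hn
    have hn2 : (2:ℝ) ≤ n := by exact_mod_cast (by omega : 2 ≤ n)
    have hl : 0 < Real.log n := Real.log_pos (by linarith)
    field_simp
  rw [e]
  refine key.trans ?_
  have hl : 0 < Real.log N := by linarith
  calc 300*N*(Real.log L)^2*(1/(N*Real.log N)) = 300*(Real.log L)^2/Real.log N := by field_simp
    _ ≤ _ := by gcongr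

lemma mid_sum (T L Y : ℝ) (hT0 : 0 < T) (hL : Real.log T = L) (hL1 : 100000000 ≤ L) (hY0 : 0 < Y) (U : ℕ) (hU : 512 ≤ U)
    (hY : Y ≤ Real.log U)
    (h2 : Real.exp (-((Y/3)^3/(15000000*(2*L)^2))) ≤ 1/L^7) (k : ℕ) :
    ∀ X : ℕ, U ≤ X → (X:ℝ) ≤ T/L^14+1 → X ≤ 2^k*U →
    |∑ n ∈ Ico U X, (ArithmeticFunction.moebius n : ℝ)/n * psi (T/n)| ≤ k*(300*(Real.log L)^2/Y) := by
  induction k with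
  | zero =>
    intro X hX _ h
    have : X = U := by omega
    subst this
    simp
  | succ k ih =>
    intro X hX hXT h
    have hnn : 0 ≤ 300*(Real.log L)^2/Y := by positivity
    push_cast
    by_cases hc : X ≤ 2^k*U
    · have := ih X hX hXT hc
      linarith
    · push Not at hc
      have hpk : 1 ≤ 2^k := Nat.one_le_two_pow
      have hU2 : U ≤ 2^k*U := by nlinarith
      have hNr : ((2^k*U:ℕ):ℝ)+1 ≤ X := by exact_mod_cast hc
      have i1 := ih (2^k*U) hU2 (by linarith) le_rfl
      have i2 := block_inv T L Y hT0 hL hL1 hY0 (2^k*U) X (by omega) hc.le (by rw [pow_succ] at h; linarith)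
        (by
          rw [← le_div_iff₀ (by positivity)]
          linarith)
        (hY.trans (Real.log_le_log (by exact_mod_cast (by omega : 0 < U)) (by exact_mod_cast hU2))) h2
      rw [← sum_Ico_consecutive _ hU2 hc.le]
      refine (abs_add_le _ _).trans ?_
      linarith

lemma rpow_third (L : ℝ) (hL : 0 < L) : L^((2:ℝ)/3) = (L^((1:ℝ)/3))^2 ∧ L = (L^((1:ℝ)/3))^3 := by
  constructor
  · rw [← Real.rpow_natCast, ← Real.rpow_mul hL.le]; norm_num
  · rw [← Real.rpow_natCast, ← Real.rpow_mul hL.le]; norm_num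

set_option maxHeartbeats 1000000 in
theorem walfisz (T : ℕ) (L ℓ : ℝ) (hL : L = Real.log T) (hℓ : ℓ = Real.log L) (h : 110000 ≤ ℓ) :
    |∑ n ∈ Ico 1 (T+1), (ArithmeticFunction.moebius n : ℝ)/n * psi (T/n)| ≤ 3000*(L^((2:ℝ)/3)*ℓ) := by
  have hL00 : 0 ≤ L := by rw [hL]; exact Real.log_natCast_nonneg _
  have hL0 : 0 < L := by
    rcases hL00.eq_or_lt with h' | h'
    · rw [← h', Real.log_zero] at hℓ; linarith
    · exact h'
  have hLe : L = Real.exp ℓ := by rw [hℓ, Real.exp_log hL0]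
  have hL1 : 100000000 ≤ L := by
    have := Real.pow_div_factorial_le_exp ℓ (by linarith) 2
    rw [← hLe] at this
    have e : ℓ^2/(Nat.factorial 2) = ℓ^2/2 := by norm_num [Nat.factorial]
    rw [e] at this
    nlinarith
  have hT0 : 0 < (T:ℝ) := by
    rcases Nat.eq_zero_or_pos T with h' | h'
    · rw [h', Nat.cast_zero, Real.log_zero] at hL; linarith
    · exact_mod_cast h'
  obtain ⟨r2, r3⟩ := rpow_third L hL0
  set z := L^((1:ℝ)/3) with hz
  have hz0 : 0 < z := by positivity
  have hz1 : 1 ≤ z := by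
    by_contra hc
    push Not at hc
    have : z^3 ≤ 1 := pow_le_one₀ hz0.le hc.le
    linarith
  have hlz : ℓ ≤ 3*z := by
    have h1 : Real.log z ≤ z - 1 := Real.log_le_sub_one_of_pos hz0
    have h2 : ℓ = 3*Real.log z := by
      rw [hℓ, hz, Real.log_rpow hL0]; ring
    linarith
  rw [r2]
  set Y := z^2*ℓ with hY
  have hY1 : 110000 ≤ Y := by
    have : 1 ≤ z^2 := one_le_pow₀ hz1
    nlinarith
  have hY0 : 0 < Y := by linarith
  set U := ⌈Real.exp Y⌉₊ with hU
  have hUe : Real.exp Y ≤ U := Nat.le_ceil _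
  have hUY : (512:ℝ) ≤ U := by
    have := Real.add_one_le_exp Y
    linarith
  have hU512 : 512 ≤ U := by exact_mod_cast hUY
  have hYU : Y ≤ Real.log U := by
    rw [Real.le_log_iff_exp_le (by linarith)]; exact hUe
  have hUY2 : Real.log U ≤ Y + 1 := by
    have h1 : (U:ℝ) ≤ Real.exp Y * 2 := by
      have := Nat.ceil_lt_add_one (Real.exp_pos Y).le
      have := Real.add_one_le_exp Y
      linarith
    have h2 := Real.log_le_log (by linarith) h1
    rw [Real.log_mul (Real.exp_pos Y).ne' (by norm_num), Real.log_exp] at h2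
    have := Real.log_two_lt_d9
    linarith
  have hexp : Real.exp (-((Y/3)^3/(15000000*(2*L)^2))) ≤ 1/L^7 := by
    have e1 : 1/L^7 = Real.exp (-(7*ℓ)) := by
      rw [Real.exp_neg, mul_comm, Real.exp_mul, ← hLe, one_div]
      norm_cast
    rw [e1]
    apply Real.exp_le_exp.2
    apply neg_le_neg
    rw [le_div_iff₀ (by positivity), r3, hY]
    have h3 : 0 < z^6*ℓ := by positivity
    have h4 : 12100000000 ≤ ℓ^2 := by nlinarith
    have h5 := mul_le_mul_of_nonneg_left h4 h3.le
    calc 7*ℓ*(15000000*(2*z^3)^2) = 420000000*(z^6*ℓ) := by ring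
      _ ≤ z^6*ℓ*12100000000/27 := by linarith
      _ ≤ z^6*ℓ*ℓ^2/27 := by linarith
      _ = _ := by ring
  have triv : ∀ a b : ℕ, |∑ n ∈ Ico a b, (ArithmeticFunction.moebius n : ℝ)/n * psi (T/n)| ≤ ∑ n ∈ Ico a b, (1:ℝ)/n :=
    fun a b => (abs_sum_le_sum_abs _ _).trans (sum_le_sum fun n _ => abs_term_le T n)
  have low : ∑ n ∈ Ico 1 U, (1:ℝ)/n ≤ 2 + Y := (sum_inv_le U (by omega)).trans (by linarith)
  by_cases hTU : T+1 ≤ U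
  · refine (triv _ _).trans ?_
    have : ∑ n ∈ Ico 1 (T+1), (1:ℝ)/n ≤ ∑ n ∈ Ico 1 U, (1:ℝ)/n := by
      apply sum_le_sum_of_subset_of_nonneg
      · exact Ico_subset_Ico_right hTU
      · intro i _ _; positivity
    linarith
  push Not at hTU
  set V := ⌊(T:ℝ)/L^14⌋₊ with hV
  have hL14 : 1 ≤ L^14 := one_le_pow₀ (by linarith)
  have hV1 : (V:ℝ) ≤ T/L^14 := Nat.floor_le (by positivity)
  have hV2 : (T:ℝ)/L^14 < V+1 := Nat.lt_floor_add_one _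
  have hVT : V ≤ T := by
    have : (V:ℝ) ≤ T := hV1.trans (div_le_self hT0.le hL14)
    exact_mod_cast this
  set V' := max U (V+1) with hV'
  rw [← sum_Ico_consecutive _ (by omega : 1 ≤ U) (by omega : U ≤ T+1),
    ← sum_Ico_consecutive _ (le_max_left U (V+1)) (by omega : max U (V+1) ≤ T+1)]
  have hmid : |∑ n ∈ Ico U (max U (V+1)), (ArithmeticFunction.moebius n : ℝ)/n * psi (T/n)| ≤ 1800*Y := by
    rcases le_total (V+1) U with hc | hc
    · rw [max_eq_left hc]; simp; linarith
    rw [max_eq_right hc]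
    set k := Nat.log 2 T + 1 with hk
    have hTpos : 0 < T := by exact_mod_cast hT0
    have hk1 : T < 2^k := Nat.lt_pow_succ_log_self (b := 2) (by norm_num) T
    have hk2 : (k:ℝ) ≤ 2*L := by
      have h3 : (2:ℝ)^(Nat.log 2 T) ≤ T := by exact_mod_cast Nat.pow_log_le_self 2 (by omega)
      have h4 := Real.log_le_log (by positivity) h3
      rw [Real.log_pow, ← hL] at h4
      have := Real.log_two_gt_d9
      rw [hk]; push_cast
      have h5 : (0:ℝ) ≤ (Nat.log 2 T:ℕ) := by positivity
      nlinarith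
    have m := mid_sum T L Y hT0 hL.symm hL1 hY0 U hU512 hYU hexp k (V+1) hc (by push_cast; linarith) (by nlinarith)
    refine m.trans ?_
    rw [← hℓ]
    calc (k:ℝ)*(300*ℓ^2/Y) ≤ 2*L*(300*ℓ^2/Y) := mul_le_mul_of_nonneg_right hk2 (by positivity)
      _ = 600*(z*ℓ) := by rw [hY]; nth_rewrite 1 [r3]; field_simp; norm_num
      _ ≤ 1800*Y := by
        rw [hY]
        have : 0 < z*ℓ := by positivity
        nlinarith
  have hhigh : ∑ n ∈ Ico (max U (V+1)) (T+1), (1:ℝ)/n ≤ 1 + 14*ℓ := by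
    have h1 : ∑ n ∈ Ico (max U (V+1)) (T+1), (1:ℝ)/n ≤ ∑ n ∈ Ico (V+1) (T+1), (1:ℝ)/n := by
      apply sum_le_sum_of_subset_of_nonneg
      · exact Ico_subset_Ico_left (le_max_right _ _)
      · intro i _ _; positivity
    refine h1.trans ?_
    rcases Nat.lt_or_ge T (V+1) with hc | hc
    · rw [Ico_eq_empty (by omega)]; simp; linarith
    refine (tail_inv (V+1) T (by omega) hc).trans ?_
    have h2 := Real.log_le_log (by positivity) hV2.le
    rw [Real.log_div (by positivity) (by positivity), Real.log_pow, ← hℓ] at h2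
    push_cast at h2 ⊢
    linarith
  have hℓY : ℓ ≤ Y := by
    have : 1 ≤ z^2 := one_le_pow₀ hz1
    nlinarith
  have t1 := abs_add_le (∑ n ∈ Ico 1 U, (ArithmeticFunction.moebius n : ℝ)/n * psi (T/n))
    (∑ n ∈ Ico U (max U (V+1)), (ArithmeticFunction.moebius n : ℝ)/n * psi (T/n) +
      ∑ n ∈ Ico (max U (V+1)) (T+1), (ArithmeticFunction.moebius n : ℝ)/n * psi (T/n))
  have t2 := abs_add_le (∑ n ∈ Ico U (max U (V+1)), (ArithmeticFunction.moebius n : ℝ)/n * psi (T/n))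
     (∑ n ∈ Ico (max U (V+1)) (T+1), (ArithmeticFunction.moebius n : ℝ)/n * psi (T/n))
  have t3 := triv 1 U
  have t4 := triv (max U (V+1)) (T+1)
  linarith

end VK

namespace VK

open Finset

/-- Coprime pairs describing the Farey fractions. -/
def PP (T : ℕ) : Finset (ℕ × ℕ) := ((range (T + 1)) ×ˢ (range (T + 1))).filter
    (fun p => p.1 < p.2 ∧ Nat.gcd p.1 p.2 = 1)

def HH (T : ℕ) : Finset (ℕ × ℕ) := (PP T).filter (fun p => 2*p.1 ≤ p.2)

noncomputable def Phi (T : ℕ) : ℝ := ∑ d ∈ Ico 1 (T+1), (Nat.totient d : ℝ)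

noncomputable def Rx (T : ℕ) (x : ℝ) : ℝ := ∑ d ∈ Ico 1 (T+1), ∑ p ∈ d.divisorsAntidiagonal,
  (ArithmeticFunction.moebius p.1 : ℝ) * psi (x * p.2)

lemma mem_PP {T : ℕ} {p : ℕ × ℕ} : p ∈ PP T ↔ p.1 < p.2 ∧ p.2 ≤ T ∧ Nat.gcd p.1 p.2 = 1 := by
  unfold PP
  simp only [mem_filter, mem_product, mem_range]
  constructor
  · rintro ⟨⟨h1, h2⟩, h3, h4⟩; exact ⟨h3, by omega, h4⟩
  · rintro ⟨h1, h2, h3⟩; exact ⟨⟨by omega, by omega⟩, h1, h3⟩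

lemma inj_PP (T : ℕ) : Set.InjOn (fun p : ℕ × ℕ => (p.1 : ℚ) / (p.2 : ℚ)) (PP T) := by
  rintro ⟨a, b⟩ hp ⟨c, d⟩ hq h
  rw [mem_coe, mem_PP] at hp hq
  simp only at hp hq h
  have hb : (b:ℚ) ≠ 0 := by exact_mod_cast (by omega : b ≠ 0)
  have hd : (d:ℚ) ≠ 0 := by exact_mod_cast (by omega : d ≠ 0)
  rw [div_eq_div_iff hb hd] at h
  have h' : a*d = c*b := by exact_mod_cast h
  have h1 : b ∣ d := by
    have : b ∣ a*d := ⟨c, by rw [h']; ring⟩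
    exact (Nat.Coprime.symm hp.2.2).dvd_of_dvd_mul_left this
  have h2 : d ∣ b := by
    have : d ∣ c*b := ⟨a, by rw [← h']; ring⟩
    exact (Nat.Coprime.symm hq.2.2).dvd_of_dvd_mul_left this
  have h3 := Nat.dvd_antisymm h1 h2
  subst h3
  have : a = c := Nat.eq_of_mul_eq_mul_right (by omega) h'
  rw [this]

lemma C_eq (T : ℕ) : C T = ∑ p ∈ HH T, #((PP T).filter (fun q => 1 - ((p.1:ℝ)/p.2)^2 ≤ (q.1:ℝ)/q.2)) := by
  have hf : farey T = (PP T).image (fun p : ℕ × ℕ => (p.1 : ℚ) / (p.2 : ℚ)) := rfl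
  have hh : fareyHalf T = (HH T).image (fun p : ℕ × ℕ => (p.1 : ℚ) / (p.2 : ℚ)) := by
    unfold fareyHalf HH
    rw [hf, filter_image]
    congr 1
    apply filter_congr
    intro p hp
    rw [mem_PP] at hp
    rw [div_le_div_iff₀ (by exact_mod_cast (by omega : 0 < p.2)) (by norm_num)]
    constructor
    · intro h; have : ((p.1*2 : ℕ):ℚ) ≤ (1*p.2 : ℕ) := by push_cast; exact h
      have := Nat.cast_le.1 this; omega
    · intro h; have : ((p.1*2 : ℕ):ℚ) ≤ (1*p.2 : ℕ) := Nat.cast_le.2 (by omega)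
      push_cast at this; exact this
  unfold C
  rw [hh, sum_image ((inj_PP T).mono (by unfold HH; intro p hp; exact (mem_filter.1 hp).1))]
  apply sum_congr rfl
  intro p hp
  rw [hf, filter_image, card_image_of_injOn ((inj_PP T).mono (by intro p hp; exact (mem_filter.1 hp).1))]
  congr 1
  apply filter_congr
  intro q hq
  rw [mem_PP] at hq
  constructor
  · intro h
    have := h.1
    have h2 : ((1 - ((p.1:ℚ)/p.2)^2 : ℚ):ℝ) ≤ (((q.1:ℚ)/q.2 : ℚ) : ℝ) := by exact_mod_cast this
    push_cast at h2; exact h2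
  · intro h
    constructor
    · have h2 : ((1 - ((p.1:ℚ)/p.2)^2 : ℚ):ℝ) ≤ (((q.1:ℚ)/q.2 : ℚ) : ℝ) := by push_cast; exact h
      exact_mod_cast h2
    · rw [div_le_one (by exact_mod_cast (by omega : 0 < q.2))]
      exact_mod_cast hq.1.le

lemma sum_mu_divisors (n : ℕ) : ∑ e ∈ n.divisors, (ArithmeticFunction.moebius e : ℝ) = if n = 1 then 1 else 0 := by
  have h := ArithmeticFunction.coe_mul_zeta_apply (f := ArithmeticFunction.moebius) (x := n)
  rw [ArithmeticFunction.moebius_mul_coe_zeta, ArithmeticFunction.one_apply] at h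
  have : ((∑ e ∈ n.divisors, ArithmeticFunction.moebius e : ℤ) : ℝ) = ((if n = 1 then 1 else 0 : ℤ) : ℝ) := by rw [← h]
  push_cast at this
  exact this

lemma sum_mu_anti (n : ℕ) : ∑ p ∈ n.divisorsAntidiagonal, (ArithmeticFunction.moebius p.1 : ℝ) = if n = 1 then 1 else 0 := by
  rw [Nat.sum_divisorsAntidiagonal (f := fun i _ => (ArithmeticFunction.moebius i : ℝ)), sum_mu_divisors]

lemma sum_mu_totient (n : ℕ) (hn : 1 ≤ n) : ∑ p ∈ n.divisorsAntidiagonal, (ArithmeticFunction.moebius p.1 : ℝ) * p.2 = Nat.totient n := by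
  have h := (ArithmeticFunction.sum_eq_iff_sum_mul_moebius_eq (R := ℝ) (f := fun n => (Nat.totient n:ℝ)) (g := fun n => (n:ℝ))).1
    (by
      intro n _
      exact_mod_cast Nat.sum_totient n)
  exact h n hn

lemma cop_sum (d n : ℕ) (hd : 1 ≤ d) (f : ℕ → ℝ) :
    ∑ c ∈ (Icc 1 n).filter (fun c => Nat.Coprime c d), f c =
    ∑ p ∈ d.divisorsAntidiagonal, (ArithmeticFunction.moebius p.1 : ℝ) * ∑ k ∈ Icc 1 (n/p.1), f (p.1*k) := by
  rw [Nat.sum_divisorsAntidiagonal (f := fun i _ => (ArithmeticFunction.moebius i : ℝ) * ∑ k ∈ Icc 1 (n/i), f (i*k))]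
  have h1 : ∀ e ∈ d.divisors, (ArithmeticFunction.moebius e : ℝ) * ∑ k ∈ Icc 1 (n/e), f (e*k) =
      ∑ c ∈ Icc 1 n, if e ∣ c then (ArithmeticFunction.moebius e : ℝ) * f c else 0 := by
    intro e he
    have he1 : 1 ≤ e := Nat.pos_of_mem_divisors he
    rw [mul_sum, ← sum_filter]
    refine sum_nbij' (fun k => e*k) (fun c => c/e) ?_ ?_ ?_ ?_ ?_
    · intro k hk
      simp only [mem_Icc, mem_filter] at *
      refine ⟨⟨Nat.mul_pos he1 hk.1, ?_⟩, Dvd.intro _ rfl⟩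
      have := (Nat.le_div_iff_mul_le he1).1 hk.2
      linarith
    · intro c hc
      simp only [mem_Icc, mem_filter] at *
      exact ⟨Nat.div_pos (Nat.le_of_dvd hc.1.1 hc.2) he1, Nat.div_le_div_right hc.1.2⟩
    · intro k hk; exact Nat.mul_div_cancel_left k he1
    · intro c hc
      simp only [mem_Icc, mem_filter] at hc
      exact Nat.mul_div_cancel' hc.2
    · intro k hk; rfl
  rw [sum_congr rfl h1, sum_comm, sum_filter]
  apply sum_congr rfl
  intro c hc
  rw [← sum_filter, ← sum_mul]
  have h2 : d.divisors.filter (fun e => e ∣ c) = (Nat.gcd c d).divisors := by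
    ext e
    simp only [mem_filter, Nat.mem_divisors, Nat.dvd_gcd_iff]
    constructor
    · rintro ⟨⟨a, b⟩, c'⟩; exact ⟨⟨c', a⟩, Nat.gcd_ne_zero_right b⟩
    · rintro ⟨⟨a, b⟩, c'⟩; exact ⟨⟨b, by omega⟩, a⟩
  rw [h2, sum_mu_divisors]
  unfold Nat.Coprime
  split_ifs <;> simp

lemma floor_psi (y : ℝ) (hy : 0 ≤ y) : (⌊y⌋₊ : ℝ) = y - psi y - 1/2 := by
  unfold psi
  rw [natCast_floor_eq_intCast_floor hy]
  have := Int.self_sub_floor y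
  linarith

lemma cop_sub (c d : ℕ) (h : c ≤ d) (hc : Nat.Coprime c d) : Nat.Coprime (d - c) d := by
  have h1 : Nat.Coprime (d - c) c := (Nat.coprime_sub_self_left h).2 hc.symm
  have h2 : d = c + (d - c) := by omega
  rw [h2, Nat.add_sub_cancel_left]
  exact (Nat.coprime_add_self_right).2 h1

lemma count_x (T : ℕ) (x : ℝ) (hx0 : 0 ≤ x) (hx1 : x < 1) :
    #((PP T).filter (fun q => 1 - x ≤ (q.1:ℝ)/q.2)) =
      ∑ d ∈ Ico 1 (T+1), #((Icc 1 ⌊x*d⌋₊).filter (fun c => Nat.Coprime c d)) := by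
  rw [← card_sigma]
  refine card_nbij' (fun q => ⟨q.2, q.2 - q.1⟩) (fun s => (s.1 - s.2, s.1)) ?_ ?_ ?_ ?_
  · rintro ⟨c, d⟩ h
    simp only [coe_filter, Set.mem_ofPred_eq, mem_PP, coe_sigma, Set.mem_sigma_iff, mem_coe, mem_Ico, mem_filter, mem_Icc] at h ⊢
    obtain ⟨⟨h1, h2, h3⟩, h4⟩ := h
    have hd : (0:ℝ) < d := by exact_mod_cast (by omega : 0 < d)
    refine ⟨⟨by omega, by omega⟩, ⟨by omega, ?_⟩, ?_⟩
    · apply Nat.le_floor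
      rw [Nat.cast_sub h1.le]
      rw [le_div_iff₀ hd] at h4
      linarith
    · exact cop_sub c d h1.le h3
  · rintro ⟨d, c⟩ h
    simp only [coe_filter, Set.mem_ofPred_eq, mem_PP, coe_sigma, Set.mem_sigma_iff, mem_coe, mem_Ico, mem_filter, mem_Icc] at h ⊢
    obtain ⟨⟨h1, h2⟩, ⟨h3, h4⟩, h5⟩ := h
    have hd : (0:ℝ) < d := by exact_mod_cast (by omega : 0 < d)
    have h6 : (c:ℝ) ≤ x*d := (Nat.le_floor_iff (by positivity)).1 h4
    have h7 : c < d := by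
      have : (c:ℝ) < d := by nlinarith
      exact_mod_cast this
    refine ⟨⟨by omega, by omega, ?_⟩, ?_⟩
    · exact cop_sub c d h7.le h5
    · rw [le_div_iff₀ hd, Nat.cast_sub h7.le]
      linarith
  · rintro ⟨c, d⟩ h
    simp only [coe_filter, Set.mem_ofPred_eq, mem_PP] at h
    simp only [Prod.mk.injEq, and_true]
    omega
  · rintro ⟨d, c⟩ h
    simp only [coe_sigma, Set.mem_sigma_iff, mem_coe, mem_Ico, mem_filter, mem_Icc] at h
    obtain ⟨⟨h1, h2⟩, ⟨h3, h4⟩, h5⟩ := h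
    have hd : (0:ℝ) < d := by exact_mod_cast (by omega : 0 < d)
    have h6 : (c:ℝ) ≤ x*d := (Nat.le_floor_iff (by positivity)).1 h4
    have h7 : c < d := by
      have : (c:ℝ) < d := by nlinarith
      exact_mod_cast this
    have : d - (d - c) = c := by omega
    simp only [this]

lemma count_x' (T : ℕ) (hT : 1 ≤ T) (x : ℝ) (hx0 : 0 ≤ x) (hx1 : x < 1) :
    (#((PP T).filter (fun q => 1 - x ≤ (q.1:ℝ)/q.2)) : ℝ) = x * Phi T - 1/2 - Rx T x := by
  rw [count_x T x hx0 hx1]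
  push_cast
  have h1 : ∀ d ∈ Ico 1 (T+1), (#((Icc 1 ⌊x*d⌋₊).filter (fun c => Nat.Coprime c d)) : ℝ) =
      x * Nat.totient d - (if d = 1 then 1 else 0) * (1/2) - ∑ p ∈ d.divisorsAntidiagonal,
        (ArithmeticFunction.moebius p.1 : ℝ) * psi (x * p.2) := by
    intro d hd
    simp only [mem_Ico] at hd
    have h2 := cop_sum d ⌊x*d⌋₊ hd.1 (fun _ => 1)
    rw [sum_const, nsmul_eq_mul, mul_one] at h2
    rw [h2, ← sum_mu_totient d hd.1, ← sum_mu_anti d, mul_sum, sum_mul, ← sum_sub_distrib, ← sum_sub_distrib]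
    apply sum_congr rfl
    intro p hp
    rw [Nat.mem_divisorsAntidiagonal] at hp
    have hp1 : p.1 ≠ 0 := by intro h; rw [h] at hp; simp at hp; omega
    rw [sum_const, nsmul_eq_mul, mul_one, Nat.card_Icc, Nat.add_sub_cancel, ← Nat.floor_div_natCast]
    have e : x*d/(p.1:ℝ) = x*p.2 := by
      rw [← hp.1]; push_cast
      have : (p.1:ℝ) ≠ 0 := by exact_mod_cast hp1
      field_simp
    rw [e, floor_psi _ (by positivity)]
    ring
  rw [sum_congr rfl h1, sum_sub_distrib, sum_sub_distrib, ← mul_sum, ← sum_mul]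
  unfold Phi Rx
  rw [sum_ite_eq' (Ico 1 (T+1)) 1, if_pos (by simp; omega)]
  ring

lemma C_formula (T : ℕ) (hT : 1 ≤ T) : (C T : ℝ) =
    Phi T * ∑ p ∈ HH T, ((p.1:ℝ)/p.2)^2 - #(HH T) * (1/2) - ∑ p ∈ HH T, Rx T (((p.1:ℝ)/p.2)^2) := by
  rw [C_eq]
  push_cast
  rw [mul_sum]
  have : ∀ p ∈ HH T, (#((PP T).filter (fun q => 1 - ((p.1:ℝ)/p.2)^2 ≤ (q.1:ℝ)/q.2)) : ℝ) =
      Phi T * ((p.1:ℝ)/p.2)^2 - 1/2 - Rx T (((p.1:ℝ)/p.2)^2) := by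
    intro p hp
    unfold HH at hp
    rw [mem_filter, mem_PP] at hp
    rw [count_x' T hT _ (by positivity)]
    · ring
    · have hb : (0:ℝ) < p.2 := by exact_mod_cast (by omega : 0 < p.2)
      have h1 : (p.1:ℝ)/p.2 < 1 := by
        rw [div_lt_one hb]; exact_mod_cast hp.1.1
      have h0 : (0:ℝ) ≤ (p.1:ℝ)/p.2 := by positivity
      nlinarith
  rw [sum_congr rfl this, sum_sub_distrib, sum_sub_distrib, sum_const, nsmul_eq_mul]

end VK

namespace VK

open Finset

lemma pair_div {E : Type*} [AddCommMonoid E] (T : ℕ) (G : ℕ → ℕ → E) :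
    ∑ d ∈ Ico 1 (T+1), ∑ p ∈ d.divisorsAntidiagonal, G p.1 p.2 =
      ∑ e ∈ Ico 1 (T+1), ∑ m ∈ Icc 1 (T/e), G e m := by
  rw [pair_sum 1 (T+1) le_rfl]
  apply sum_congr rfl
  intro e he
  simp only [mem_Ico] at he
  rw [← sum_filter]
  apply sum_congr _ (fun _ _ => rfl)
  ext m
  simp only [mem_filter, mem_Ico, mem_Icc]
  rw [Nat.le_div_iff_mul_le (by omega)]
  constructor
  · rintro ⟨⟨h1, h2⟩, h3, h4⟩
    refine ⟨h1, ?_⟩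
    rw [mul_comm]; omega
  · rintro ⟨h1, h2⟩
    refine ⟨⟨h1, ?_⟩, ?_, ?_⟩
    · nlinarith
    · nlinarith
    · rw [mul_comm]; omega

lemma gauss_sum (n : ℕ) : ∑ k ∈ Icc 1 n, (k:ℝ) = n*(n+1)/2 := by
  induction n with
  | zero => simp
  | succ n ih => rw [sum_Icc_succ_top (by omega), ih]; push_cast; ring

lemma gauss_sq (n : ℕ) : ∑ k ∈ Icc 1 n, (k:ℝ)^2 = n*(n+1)*(2*n+1)/6 := by
  induction n with
  | zero => simp
  | succ n ih => rw [sum_Icc_succ_top (by omega), ih]; push_cast; ring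

lemma sum_inv_sq (n : ℕ) : ∑ k ∈ Ico 1 (n+1), (1:ℝ)/(k:ℝ)^2 ≤ 2 := by
  have h : ∀ n : ℕ, ∑ k ∈ Ico 1 (n+1+1), (1:ℝ)/(k:ℝ)^2 ≤ 2 - 1/((n:ℝ)+1) := by
    intro n
    induction n with
    | zero => norm_num
    | succ n ih =>
      rw [sum_Ico_succ_top (by omega)]
      have : (1:ℝ)/((n+1+1:ℕ):ℝ)^2 ≤ 1/((n:ℝ)+1) - 1/((n:ℝ)+1+1) := by
        push_cast
        rw [div_sub_div _ _ (by positivity) (by positivity), div_le_div_iff₀ (by positivity) (by positivity)]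
        have : (0:ℝ) ≤ n := by positivity
        nlinarith
      rw [Nat.cast_succ n]
      exact (add_le_add ih this).trans (by linarith)
  rcases n with _ | n
  · simp
  · refine (h n).trans ?_
    have : (0:ℝ) ≤ 1/((n:ℝ)+1) := by positivity
    linarith

noncomputable def gg (m : ℕ) : ℝ := ∑ k ∈ Icc 1 (m/2), ((k:ℝ)/m)^2

lemma gg_est (m : ℕ) (hm : 1 ≤ m) : |gg m - (m/24 + (if 2 ∣ m then 1 else 0)/8)| ≤ 1/(12*m) := by
  have e : gg m = (∑ k ∈ Icc 1 (m/2), (k:ℝ)^2)/(m:ℝ)^2 := by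
    unfold gg; rw [sum_div]; apply sum_congr rfl; intro k _; rw [div_pow]
  rw [e, gauss_sq]
  rcases Nat.even_or_odd' m with ⟨n, h | h⟩
  · rw [if_pos ⟨n, h⟩]
    have h2 : m/2 = n := by omega
    rw [h2, h]
    have hn : (0:ℝ) < n := by exact_mod_cast (by omega : 0 < n)
    push_cast
    have : (n:ℝ)*(n+1)*(2*n+1)/6/(2*n)^2 - (2*n/24+1/8) = 1/(12*(2*n)) := by
      field_simp; ring
    rw [this, abs_of_pos (by positivity)]
  · rw [if_neg (by omega)]
    have h2 : m/2 = n := by omega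
    rw [h2, h]
    have hn : (0:ℝ) ≤ n := by positivity
    push_cast
    have : (n:ℝ)*(n+1)*(2*n+1)/6/(2*n+1)^2 - ((2*n+1)/24+0/8) = -(1/(24*(2*n+1))) := by
      field_simp; ring
    rw [this, abs_neg, abs_of_pos (by positivity)]
    apply one_div_le_one_div_of_le (by positivity)
    nlinarith

lemma parity (b : ℕ) (hb : 1 ≤ b) :
    ∑ p ∈ b.divisorsAntidiagonal, (ArithmeticFunction.moebius p.1 : ℝ) * (if 2 ∣ p.2 then 1 else 0) = if b = 2 then 1 else 0 := by
  by_cases h2 : 2 ∣ b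
  · obtain ⟨c, rfl⟩ := h2
    have e : ∑ p ∈ (2*c).divisorsAntidiagonal, (ArithmeticFunction.moebius p.1 : ℝ) * (if 2 ∣ p.2 then 1 else 0) =
        ∑ p ∈ c.divisorsAntidiagonal, (ArithmeticFunction.moebius p.1 : ℝ) := by
      simp only [mul_ite, mul_one, mul_zero]
      rw [← sum_filter]
      refine sum_nbij' (fun p => (p.1, p.2/2)) (fun p => (p.1, 2*p.2)) ?_ ?_ ?_ ?_ ?_
      · rintro ⟨x, y⟩ h
        simp only [mem_filter, Nat.mem_divisorsAntidiagonal] at *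
        obtain ⟨⟨h1, h3⟩, z, rfl⟩ := h
        refine ⟨?_, by omega⟩
        rw [Nat.mul_div_cancel_left z (by norm_num)]
        nlinarith
      · rintro ⟨x, y⟩ h
        simp only [mem_filter, Nat.mem_divisorsAntidiagonal] at *
        refine ⟨⟨?_, by omega⟩, Dvd.intro _ rfl⟩
        rw [← h.1]; ring
      · rintro ⟨x, y⟩ h
        simp only [mem_filter, Nat.mem_divisorsAntidiagonal] at h
        simp only [Prod.mk.injEq, true_and]
        omega
      · rintro ⟨x, y⟩ h
        simp
      · rintro ⟨x, y⟩ h; rfl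
    rw [e, sum_mu_anti]
    by_cases hc : c = 1
    · rw [if_pos hc, if_pos (by omega)]
    · rw [if_neg hc, if_neg (by omega)]
  · rw [if_neg (by rintro rfl; exact h2 (dvd_refl 2))]
    apply sum_eq_zero
    rintro ⟨x, y⟩ h
    rw [Nat.mem_divisorsAntidiagonal] at h
    rw [if_neg, mul_zero]
    intro h3
    exact h2 (h.1 ▸ h3.mul_left x)

lemma G_formula (T : ℕ) : ∑ p ∈ HH T, ((p.1:ℝ)/p.2)^2 =
    ∑ b ∈ Ico 1 (T+1), ∑ p ∈ b.divisorsAntidiagonal, (ArithmeticFunction.moebius p.1 : ℝ) * gg p.2 := by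
  have h1 : ∀ b ∈ Ico 1 (T+1), ∑ p ∈ b.divisorsAntidiagonal, (ArithmeticFunction.moebius p.1 : ℝ) * gg p.2 =
      ∑ a ∈ (Icc 1 (b/2)).filter (fun a => Nat.Coprime a b), ((a:ℝ)/b)^2 := by
    intro b hb
    simp only [mem_Ico] at hb
    rw [cop_sum b (b/2) hb.1 (fun a => ((a:ℝ)/b)^2)]
    apply sum_congr rfl
    intro p hp
    rw [Nat.mem_divisorsAntidiagonal] at hp
    have hp1 : 0 < p.1 := by rcases Nat.eq_zero_or_pos p.1 with h | h; (rw [h] at hp; simp at hp; omega); exact h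
    have e : b/2/p.1 = p.2/2 := by
      rw [Nat.div_div_eq_div_mul, mul_comm 2, ← Nat.div_div_eq_div_mul, ← hp.1, Nat.mul_div_cancel_left _ hp1]
    rw [e]
    unfold gg
    congr 1
    apply sum_congr rfl
    intro k _
    rw [← hp.1]
    push_cast
    rw [mul_div_mul_left _ _ (by positivity)]
  rw [sum_congr rfl h1, sum_sigma']
  have h2 : ∑ p ∈ HH T, ((p.1:ℝ)/p.2)^2 = ∑ p ∈ (HH T).filter (fun p => p.1 ≠ 0), ((p.1:ℝ)/p.2)^2 := by
    symm
    apply sum_filter_of_ne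
    intro p _ h h0
    apply h
    rw [h0]; simp
  rw [h2]
  refine sum_nbij' (fun p => ⟨p.2, p.1⟩) (fun s => (s.2, s.1)) ?_ ?_ ?_ ?_ ?_
  · rintro ⟨a, b⟩ h
    simp only [HH, mem_filter, mem_PP, mem_sigma, mem_Ico, mem_Icc] at h ⊢
    exact ⟨⟨by omega, by omega⟩, ⟨by omega, by omega⟩, h.1.1.2.2⟩
  · rintro ⟨b, a⟩ h
    simp only [HH, mem_filter, mem_PP, mem_sigma, mem_Ico, mem_Icc] at h ⊢
    obtain ⟨⟨h1, h2⟩, ⟨h3, h4⟩, h5⟩ := h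
    exact ⟨⟨⟨by omega, by omega, h5⟩, by omega⟩, by omega⟩
  · rintro ⟨a, b⟩ _; rfl
  · rintro ⟨b, a⟩ _; rfl
  · rintro ⟨a, b⟩ _; rfl

lemma Phi_formula (T : ℕ) : Phi T = ∑ b ∈ Ico 1 (T+1), ∑ p ∈ b.divisorsAntidiagonal, (ArithmeticFunction.moebius p.1 : ℝ) * p.2 := by
  unfold Phi
  apply sum_congr rfl
  intro d hd
  simp only [mem_Ico] at hd
  rw [sum_mu_totient d hd.1]

lemma swap_aux (b : ℕ) (f : ℕ → ℝ) : ∑ p ∈ b.divisorsAntidiagonal, f p.2 = ∑ p ∈ b.divisorsAntidiagonal, f p.1 := by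
  rw [Nat.sum_divisorsAntidiagonal' (f := fun _ j => f j), Nat.sum_divisorsAntidiagonal (f := fun i _ => f i)]

lemma G_est (T : ℕ) (hT : 1 ≤ T) : |∑ p ∈ HH T, ((p.1:ℝ)/p.2)^2 - Phi T/24| ≤ T := by
  have hTr : (1:ℝ) ≤ T := by exact_mod_cast hT
  have e : ∑ p ∈ HH T, ((p.1:ℝ)/p.2)^2 - Phi T/24 =
      (∑ b ∈ Ico 1 (T+1), if b = 2 then (1:ℝ) else 0)/8 + ∑ b ∈ Ico 1 (T+1), ∑ p ∈ b.divisorsAntidiagonal,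
        (ArithmeticFunction.moebius p.1 : ℝ) * (gg p.2 - (p.2/24 + (if 2 ∣ p.2 then 1 else 0)/8)) := by
    rw [G_formula, Phi_formula, sum_div, sum_div, ← sum_sub_distrib, ← sum_add_distrib]
    apply sum_congr rfl
    intro b hb
    simp only [mem_Ico] at hb
    rw [← parity b hb.1, sum_div, sum_div, ← sum_sub_distrib, ← sum_add_distrib]
    apply sum_congr rfl
    intro p _
    ring
  rw [e]
  refine (abs_add_le _ _).trans ?_
  have h1 : |(∑ b ∈ Ico 1 (T+1), if b = 2 then (1:ℝ) else 0)/8| ≤ 1/8 := by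
    rw [sum_ite_eq']
    split_ifs <;> norm_num
  have h2 : |∑ b ∈ Ico 1 (T+1), ∑ p ∈ b.divisorsAntidiagonal,
        (ArithmeticFunction.moebius p.1 : ℝ) * (gg p.2 - (p.2/24 + (if 2 ∣ p.2 then 1 else 0)/8))| ≤
      ∑ b ∈ Ico 1 (T+1), ∑ p ∈ b.divisorsAntidiagonal, 1/(12*(p.1:ℝ)) := by
    refine (abs_sum_le_sum_abs _ _).trans (sum_le_sum fun b hb => ?_)
    refine (abs_sum_le_sum_abs _ _).trans ?_
    rw [← swap_aux b (fun x => 1/(12*(x:ℝ)))]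
    apply sum_le_sum
    intro p hp
    rw [Nat.mem_divisorsAntidiagonal] at hp
    have hp1 : 1 ≤ p.2 := by rcases Nat.eq_zero_or_pos p.2 with h | h; (rw [h] at hp; simp at hp; omega); exact h
    rw [abs_mul]
    have a1 := gg_est p.2 hp1
    have a2 := abs_mu_le p.1
    calc _ ≤ 1*(1/(12*(p.2:ℝ))) := mul_le_mul a2 a1 (abs_nonneg _) (by norm_num)
      _ = _ := one_mul _
  rw [pair_div T (fun e _ => 1/(12*(e:ℝ)))] at h2
  have h3 : ∑ e ∈ Ico 1 (T+1), ∑ m ∈ Icc 1 (T/e), 1/(12*(e:ℝ)) ≤ T/12*∑ e ∈ Ico 1 (T+1), (1:ℝ)/(e:ℝ)^2 := by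
    rw [mul_sum]
    apply sum_le_sum
    intro e he
    simp only [mem_Ico] at he
    have he0 : (0:ℝ) < e := by exact_mod_cast he.1
    rw [sum_const, nsmul_eq_mul, Nat.card_Icc, Nat.add_sub_cancel]
    have : ((T/e:ℕ):ℝ) ≤ T/e := Nat.cast_div_le
    calc _ ≤ (T:ℝ)/e*(1/(12*(e:ℝ))) := mul_le_mul_of_nonneg_right this (by positivity)
      _ = _ := by field_simp
  have h4 := sum_inv_sq T
  have h5 : (T:ℝ)/12*∑ e ∈ Ico 1 (T+1), (1:ℝ)/(e:ℝ)^2 ≤ T/12*2 := mul_le_mul_of_nonneg_left h4 (by positivity)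
  linarith

lemma mu_sq_hasSum : HasSum (fun n : ℕ => (ArithmeticFunction.moebius n : ℝ)/(n:ℝ)^2) (6/Real.pi^2) := by
  have hs : (1:ℝ) < (2:ℂ).re := by norm_num
  have h1 := LSeries_one_mul_Lseries_moebius hs
  rw [LSeries_one_eq_riemannZeta hs, riemannZeta_two] at h1
  have h2 := (ArithmeticFunction.LSeriesSummable_moebius_iff.2 hs)
  have h3 : HasSum (LSeries.term (fun n => ((ArithmeticFunction.moebius n : ℤ) : ℂ)) 2) (((6/Real.pi^2 : ℝ)) : ℂ) := by
    have h4 := LSeriesSummable.LSeriesHasSum h2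
    have : LSeries (fun n => ((ArithmeticFunction.moebius n : ℤ) : ℂ)) 2 = ((6/Real.pi^2 : ℝ) : ℂ) := by
      have hpi : (Real.pi : ℂ) ≠ 0 := by exact_mod_cast Real.pi_ne_zero
      push_cast
      rw [eq_div_iff (by positivity)]
      linear_combination 6*h1
    rw [this] at h4
    exact h4
  have h5 : (LSeries.term (fun n => ((ArithmeticFunction.moebius n : ℤ) : ℂ)) 2) =
      fun n : ℕ => (((ArithmeticFunction.moebius n : ℝ)/(n:ℝ)^2 : ℝ) : ℂ) := by
    ext n
    rw [LSeries.term_def]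
    split_ifs with h
    · rw [h]; simp
    · push_cast
      congr 1
      exact_mod_cast Complex.cpow_natCast (n:ℂ) 2
  rw [h5] at h3
  exact Complex.hasSum_ofReal.1 h3

lemma mu_sq_tail (T : ℕ) (hT : 1 ≤ T) : |(∑ n ∈ Ico 1 (T+1), (ArithmeticFunction.moebius n : ℝ)/(n:ℝ)^2) - 6/Real.pi^2| ≤ (1:ℝ)/T := by
  have h := mu_sq_hasSum.tendsto_sum_nat
  have h0 : ∀ m, 1 ≤ m → ∑ n ∈ range m, (ArithmeticFunction.moebius n : ℝ)/(n:ℝ)^2 = ∑ n ∈ Ico 1 m, (ArithmeticFunction.moebius n : ℝ)/(n:ℝ)^2 := by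
    intro m hm
    rw [range_eq_Ico, sum_eq_sum_Ico_succ_bot (by omega)]
    simp
  have h1 := (h.const_sub (∑ n ∈ Ico 1 (T+1), (ArithmeticFunction.moebius n : ℝ)/(n:ℝ)^2)).abs
  refine le_of_tendsto h1 ?_
  filter_upwards [Filter.eventually_ge_atTop (T+1)] with m hm
  rw [h0 m (by omega), ← sum_Ico_consecutive _ (by omega : 1 ≤ T+1) hm, sub_add_cancel_left, abs_neg]
  refine (abs_sum_le_sum_abs _ _).trans ?_
  have h2 := sum_Ioc_inv_sq_le_sub (α := ℝ) (k := T) (n := m) (by omega) (by omega)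
  have h3 : ∑ n ∈ Ico (T+1) m, |(ArithmeticFunction.moebius n : ℝ)/(n:ℝ)^2| ≤ ∑ i ∈ Ioc T m, ((i:ℝ)^2)⁻¹ := by
    refine le_trans (sum_le_sum (g := fun n : ℕ => ((n:ℝ)^2)⁻¹) ?_) (sum_le_sum_of_subset_of_nonneg ?_ ?_)
    · intro n _
      rw [abs_div, abs_of_nonneg (by positivity : (0:ℝ) ≤ (n:ℝ)^2), ← one_div]
      exact div_le_div_of_nonneg_right (abs_mu_le n) (by positivity)
    · intro n hn; simp only [mem_Ico, mem_Ioc] at *; omega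
    · intro i _ _; positivity
  have h4 : (0:ℝ) ≤ (m:ℝ)⁻¹ := by positivity
  rw [one_div]
  linarith

lemma Phi_est (T : ℕ) (hT : 1 ≤ T) (E : ℝ)
    (hE : |∑ n ∈ Ico 1 (T+1), (ArithmeticFunction.moebius n : ℝ)/n * psi (T/n)| ≤ E) :
    |Phi T - 3/Real.pi^2*(T:ℝ)^2| ≤ T*E + T := by
  have hTr : (1:ℝ) ≤ T := by exact_mod_cast hT
  rw [Phi_formula, pair_div T (fun e m => (ArithmeticFunction.moebius e : ℝ) * m)]
  have h1 : ∀ e ∈ Ico 1 (T+1), ∑ m ∈ Icc 1 (T/e), (ArithmeticFunction.moebius e : ℝ) * m =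
      (T:ℝ)^2/2*((ArithmeticFunction.moebius e : ℝ)/(e:ℝ)^2) - T*((ArithmeticFunction.moebius e : ℝ)/e*psi (T/e)) +
      (ArithmeticFunction.moebius e : ℝ)*((psi (T/e))^2/2 - 1/8) := by
    intro e he
    simp only [mem_Ico] at he
    have he0 : (0:ℝ) < e := by exact_mod_cast he.1
    rw [← mul_sum, gauss_sum, ← Nat.floor_div_eq_div (K := ℝ), floor_psi _ (by positivity)]
    field_simp
    ring
  rw [sum_congr rfl h1, sum_add_distrib, sum_sub_distrib, ← mul_sum, ← mul_sum]
  have h2 := mu_sq_tail T hT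
  have h3 : |∑ e ∈ Ico 1 (T+1), (ArithmeticFunction.moebius e : ℝ)*((psi (T/e))^2/2 - 1/8)| ≤ (T:ℝ)*(1/8) := by
    refine (abs_sum_le_sum_abs _ _).trans ?_
    have : ∀ e ∈ Ico 1 (T+1), |(ArithmeticFunction.moebius e : ℝ)*((psi (T/e))^2/2 - 1/8)| ≤ 1/8 := by
      intro e _
      rw [abs_mul]
      have a1 := abs_mu_le e
      have a2 := abs_psi_le (T/e)
      have a3 : |(psi (T/e))^2/2 - 1/8| ≤ 1/8 := by
        have b1 : (psi (T/e))^2 ≤ (1/2)^2 := by rw [← sq_abs]; exact pow_le_pow_left₀ (abs_nonneg _) a2 2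
        have b2 := sq_nonneg (psi ((T:ℝ)/e))
        rw [abs_le]; constructor <;> linarith
      calc _ ≤ 1*(1/8:ℝ) := mul_le_mul a1 a3 (abs_nonneg _) (by norm_num)
        _ = _ := one_mul _
    refine (sum_le_sum this).trans ?_
    simp
  set S := ∑ n ∈ Ico 1 (T+1), (ArithmeticFunction.moebius n : ℝ)/(n:ℝ)^2
  set P := ∑ n ∈ Ico 1 (T+1), (ArithmeticFunction.moebius n : ℝ)/n * psi (T/n)
  set Q := ∑ e ∈ Ico 1 (T+1), (ArithmeticFunction.moebius e : ℝ)*((psi (T/e))^2/2 - 1/8)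
  have e : (T:ℝ)^2/2*S - T*P + Q - 3/Real.pi^2*(T:ℝ)^2 = (T:ℝ)^2/2*(S - 6/Real.pi^2) + (-(T*P)) + Q := by ring
  rw [e]
  have a1 : |(T:ℝ)^2/2*(S - 6/Real.pi^2)| ≤ (T:ℝ)/2 := by
    rw [abs_mul, abs_of_nonneg (by positivity)]
    calc _ ≤ (T:ℝ)^2/2*(1/T) := mul_le_mul_of_nonneg_left h2 (by positivity)
      _ = _ := by field_simp
  have a2 : |-(T*P)| ≤ T*E := by
    rw [abs_neg, abs_mul, Nat.abs_cast]
    exact mul_le_mul_of_nonneg_left hE (by positivity)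
  have := abs_add_three ((T:ℝ)^2/2*(S - 6/Real.pi^2)) (-(T*P)) Q
  linarith

end VK

namespace VK

open Finset

lemma cnt_one (b h : ℕ) (hb : 1 ≤ b) (hh : 1 ≤ h) (ρ κ : ℝ) (hρ : 0 ≤ ρ) (hκ : 2*κ ≤ ρ^2) :
    #((range (b+1)).filter (fun a : ℕ => nd ((h:ℝ) * (((a:ℝ)/b)^2)) < κ)) ≤ (⌊ρ*b⌋₊+1) * (h+1) := by
  have hb0 : (0:ℝ) < b := by exact_mod_cast hb
  have hh0 : (1:ℝ) ≤ h := by exact_mod_cast hh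
  have hc : #(Icc (0:ℤ) h) = h+1 := by simp
  rw [← hc]
  apply card_le_mul_card_image_of_maps_to (f := fun a : ℕ => round ((h:ℝ) * (((a:ℝ)/b)^2)))
  · intro a ha
    simp only [mem_filter, mem_range] at ha
    have h1 : (a:ℝ)/b ≤ 1 := by
      rw [div_le_one hb0]; exact_mod_cast Nat.lt_succ_iff.1 ha.1
    have h0 : 0 ≤ (a:ℝ)/b := by positivity
    have h2 : ((a:ℝ)/b)^2 ≤ 1 := pow_le_one₀ h0 h1
    have h3 : (h:ℝ)*((a:ℝ)/b)^2 ≤ h := by nlinarith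
    have h4 : 0 ≤ (h:ℝ)*((a:ℝ)/b)^2 := by positivity
    simp only [mem_Icc]
    constructor
    · rw [round_eq, Int.floor_nonneg]; linarith
    · rw [round_eq, ← Int.lt_add_one_iff, Int.floor_lt]; push_cast; linarith
  · intro j _
    set S := ((range (b+1)).filter (fun a : ℕ => nd ((h:ℝ) * (((a:ℝ)/b)^2)) < κ)).filter (fun a : ℕ => round ((h:ℝ) * (((a:ℝ)/b)^2)) = j) with hS
    rcases S.eq_empty_or_nonempty with he | hne
    · rw [he]; simp
    have hsub : S ⊆ Icc (S.min' hne) (S.min' hne + ⌊ρ*b⌋₊) := by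
      intro a ha
      have hm := S.min'_mem hne
      have hle := S.min'_le a ha
      set m := S.min' hne with hmd
      rw [hS] at ha hm
      simp only [mem_filter, mem_range] at ha hm
      rw [mem_Icc]
      refine ⟨hle, ?_⟩
      have a1 := ha.1.2
      have a2 := hm.1.2
      unfold nd at a1 a2
      rw [ha.2, abs_lt] at a1
      rw [hm.2, abs_lt] at a2
      have d : (h:ℝ)*(((a:ℝ)/b)^2 - ((m:ℝ)/b)^2) < 2*κ := by linarith
      have hler : (m:ℝ) ≤ a := by exact_mod_cast hle
      have d1 : ((a:ℝ)/b)^2 - ((m:ℝ)/b)^2 = ((a:ℝ)^2-(m:ℝ)^2)/(b:ℝ)^2 := by field_simp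
      have d2 : 0 ≤ ((a:ℝ)^2-(m:ℝ)^2)/(b:ℝ)^2 := by
        apply div_nonneg _ (by positivity); nlinarith [(Nat.cast_nonneg m : (0:ℝ) ≤ m)]
      rw [d1] at d
      have d3 : ((a:ℝ)^2-(m:ℝ)^2)/(b:ℝ)^2 ≤ ρ^2 := by nlinarith
      rw [div_le_iff₀ (by positivity)] at d3
      have d4 : ((a:ℝ)-m)^2 ≤ (ρ*b)^2 := by nlinarith [(Nat.cast_nonneg m : (0:ℝ) ≤ m)]
      have d5 : (a:ℝ)-m ≤ ρ*b := abs_le_of_sq_le_sq' d4 (by positivity) |>.2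
      have d6 : a - m ≤ ⌊ρ*b⌋₊ := by
        apply Nat.le_floor
        rw [Nat.cast_sub hle]; exact d5
      omega
    refine (card_le_card hsub).trans ?_
    simp only [Nat.card_Icc]; omega

open Classical in
lemma cnt_exc (T H : ℕ) (ρ κ : ℝ) (hρ : 0 ≤ ρ) (hκ : 2*κ ≤ ρ^2) :
    (#((HH T).filter (fun p : ℕ × ℕ => ∃ h ∈ Icc 1 H, nd ((h:ℝ) * (((p.1:ℝ)/p.2)^2)) < κ)) : ℝ) ≤
      H*(T*((ρ*T+1)*(H+1))) := by
  have hsub : (HH T).filter (fun p : ℕ × ℕ => ∃ h ∈ Icc 1 H, nd ((h:ℝ) * (((p.1:ℝ)/p.2)^2)) < κ) ⊆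
     (Icc 1 H).biUnion (fun h => (Icc 1 T).biUnion (fun b =>
       ((range (b+1)).filter (fun a : ℕ => nd ((h:ℝ) * (((a:ℝ)/b)^2)) < κ)).image (fun a => (a,b)))) := by
    rintro ⟨a, b⟩ hp
    simp only [HH, mem_filter, mem_PP] at hp
    obtain ⟨⟨⟨h1, h2, h3⟩, h4⟩, h, h5, h6⟩ := hp
    simp only [mem_biUnion, mem_image, mem_filter, mem_range, Prod.mk.injEq]
    exact ⟨h, h5, b, by simp only [mem_Icc]; omega, a, ⟨by omega, h6⟩, rfl, rfl⟩
  have h1 := (card_le_card hsub).trans card_biUnion_le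
  have h2 : (#((HH T).filter (fun p : ℕ × ℕ => ∃ h ∈ Icc 1 H, nd ((h:ℝ) * (((p.1:ℝ)/p.2)^2)) < κ)) : ℝ) ≤
     ∑ h ∈ Icc 1 H, (#((Icc 1 T).biUnion (fun b =>
       ((range (b+1)).filter (fun a : ℕ => nd ((h:ℝ) * (((a:ℝ)/b)^2)) < κ)).image (fun a => (a,b)))) : ℝ) := by
    exact_mod_cast h1
  refine h2.trans ?_
  have h3 : ∀ h ∈ Icc 1 H, (#((Icc 1 T).biUnion (fun b =>
       ((range (b+1)).filter (fun a : ℕ => nd ((h:ℝ) * (((a:ℝ)/b)^2)) < κ)).image (fun a => (a,b)))) : ℝ) ≤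
       T*((ρ*T+1)*(H+1)) := by
    intro h hh
    simp only [mem_Icc] at hh
    have k1 : (#((Icc 1 T).biUnion (fun b =>
       ((range (b+1)).filter (fun a : ℕ => nd ((h:ℝ) * (((a:ℝ)/b)^2)) < κ)).image (fun a => (a,b)))) : ℝ) ≤
       ∑ b ∈ Icc 1 T, (#(((range (b+1)).filter (fun a : ℕ => nd ((h:ℝ) * (((a:ℝ)/b)^2)) < κ)).image (fun a => (a,b))) : ℝ) := by
      exact_mod_cast card_biUnion_le
    refine k1.trans ?_
    have k2 : ∀ b ∈ Icc 1 T, (#(((range (b+1)).filter (fun a : ℕ => nd ((h:ℝ) * (((a:ℝ)/b)^2)) < κ)).image (fun a => (a,b))) : ℝ) ≤ (ρ*T+1)*(H+1) := by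
      intro b hb
      simp only [mem_Icc] at hb
      have l1 := (card_image_le (f := fun a => (a,b))).trans (cnt_one b h hb.1 hh.1 ρ κ hρ hκ)
      have l2 : (#(((range (b+1)).filter (fun a : ℕ => nd ((h:ℝ) * (((a:ℝ)/b)^2)) < κ)).image (fun a => (a,b))) : ℝ) ≤ ((⌊ρ*b⌋₊:ℝ)+1)*(h+1) := by
        exact_mod_cast l1
      refine l2.trans ?_
      have l3 : (⌊ρ*b⌋₊:ℝ) ≤ ρ*b := Nat.floor_le (by positivity)
      have l4 : ρ*b ≤ ρ*T := mul_le_mul_of_nonneg_left (by exact_mod_cast hb.2) hρ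
      have l5 : (h:ℝ) ≤ H := by exact_mod_cast hh.2
      apply mul_le_mul (by linarith) (by linarith) (by positivity) (by positivity)
    refine (sum_le_sum k2).trans ?_
    simp
  refine (sum_le_sum h3).trans ?_
  simp

lemma card_HH (T : ℕ) (hT : 1 ≤ T) : (#(HH T) : ℝ) ≤ 4*(T:ℝ)^2 := by
  have h1 : #(HH T) ≤ (T+1)*(T+1) := by
    have : HH T ⊆ range (T+1) ×ˢ range (T+1) := (filter_subset _ _).trans (filter_subset _ _)
    simpa using card_le_card this
  have h2 : (#(HH T) : ℝ) ≤ (T+1)*(T+1) := by exact_mod_cast h1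
  have h3 : (1:ℝ) ≤ T := by exact_mod_cast hT
  nlinarith

lemma psi_sum_triv (K : ℕ) (x : ℝ) : |∑ m ∈ Icc 1 K, psi (x*m)| ≤ K/2 := by
  refine (abs_sum_le_sum_abs _ _).trans ?_
  refine (sum_le_sum (fun (m:ℕ) _ => abs_psi_le (x*(m:ℝ)))).trans ?_
  simp; linarith

lemma psi_sum_good (K H : ℕ) (x L : ℝ) (hL : 1 ≤ L) (hH : L^2 ≤ H) (hK : L^14 ≤ K)
    (hx : ∀ h ∈ Icc 1 H, 1/(2*L^12) ≤ nd ((h:ℝ)*x)) :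
    |∑ m ∈ Icc 1 K, psi (x*m)| ≤ 9*K/L := by
  have hL0 : 0 < L := by linarith
  have hH1 : (1:ℝ) ≤ H := le_trans (one_le_pow₀ hL) hH
  have hg : ∀ h : ℕ, 1 ≤ h → h ≤ H → ‖∑ i ∈ Icc 1 K, ee (h*(x*(i:ℝ)))‖ ≤ L^12 := by
    intro h h1 h2
    have hn := hx h (by simp [h1, h2])
    have hpos : 0 < 1/(2*L^12) := by positivity
    have g := geom_bound ((h:ℝ)*x) 1 (K+1) (by linarith)
    have e : ∑ i ∈ Icc 1 K, ee (h*(x*(i:ℝ))) = ∑ l ∈ Ico (1:ℤ) (K+1), ee ((h:ℝ)*x*l) := by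
      refine sum_nbij (fun i : ℕ => (i:ℤ)) ?_ ?_ ?_ ?_
      · intro i hi; simp only [mem_Icc, mem_Ico] at *; omega
      · intro i _ j _ hij; simpa using hij
      · intro l hl
        simp only [coe_Ico, Set.mem_Ico] at hl
        refine ⟨l.toNat, ?_, ?_⟩
        · simp only [coe_Icc, Set.mem_Icc]; omega
        · simp only; omega
      · intro i _
        push_cast
        rw [mul_assoc]
    rw [e]
    refine g.trans ?_
    rw [div_le_iff₀ (by linarith)]
    have : L^12*(2*(1/(2*L^12))) = 1 := by field_simp
    have : L^12*(2*(1/(2*L^12))) ≤ L^12*(2*nd (h*x)) := by gcongr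
    linarith
  have hm := psi_weighted ℕ (s := Icc 1 K) (w := fun _ => 1) (x := fun m => x*m) (W := 1) (E := L^12) (δ := 1/L)
    (H := H) (by exact_mod_cast hH1) (by positivity) (by positivity) (by norm_num) (by simp)
    (by intro h h1 h2; simpa using hg h h1 h2) (by intro h h1 h2; simpa using hg h h1 h2)
  simp only [one_mul, Nat.card_Icc, Nat.add_sub_cancel] at hm
  refine hm.trans ?_
  have hK0 : (0:ℝ) ≤ K := Nat.cast_nonneg _
  have a1 : (K:ℝ)/H ≤ K/L^2 := div_le_div_of_nonneg_left hK0 (by positivity) hH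
  have a2 : L^12 ≤ K/L^2 := by
    rw [le_div_iff₀ (by positivity)]; rw [← pow_add]; exact hK
  have a3 : (L^12 + K/H)/(1/L) ≤ 2*K/L := by
    rw [div_div_eq_mul_div, div_one]
    calc (L^12 + K/H)*L ≤ (K/L^2+K/L^2)*L := by gcongr
      _ = _ := by field_simp; ring
  have a4 : (9:ℝ)*K/L = 3*(2*K/L + 1/L*K) := by ring
  rw [a4]
  linarith

end VK

namespace VK

open Finset

lemma Rx_eq (T : ℕ) (x : ℝ) : Rx T x = ∑ e ∈ Ico 1 (T+1), (ArithmeticFunction.moebius e : ℝ) * ∑ m ∈ Icc 1 (T/e), psi (x*m) := by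
  unfold Rx
  rw [pair_div T (fun e m => (ArithmeticFunction.moebius e : ℝ) * psi (x*m))]
  apply sum_congr rfl
  intro e _
  rw [mul_sum]

lemma basic_T (T : ℕ) (L ℓ : ℝ) (hL : L = Real.log T) (hℓ : ℓ = Real.log L) (h : 110000 ≤ ℓ) :
    100000000 ≤ L ∧ 0 < (T:ℝ) ∧ L^6 ≤ T ∧ 1 ≤ L^((2:ℝ)/3) := by
  have hL00 : 0 ≤ L := by rw [hL]; exact Real.log_natCast_nonneg _
  have hL0 : 0 < L := by
    rcases hL00.eq_or_lt with h' | h'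
    · rw [← h', Real.log_zero] at hℓ; linarith
    · exact h'
  have hLe : L = Real.exp ℓ := by rw [hℓ, Real.exp_log hL0]
  have hL1 : 100000000 ≤ L := by
    have := Real.pow_div_factorial_le_exp ℓ (by linarith) 2
    rw [← hLe] at this
    have e : ℓ^2/(Nat.factorial 2) = ℓ^2/2 := by norm_num [Nat.factorial]
    rw [e] at this
    nlinarith
  have hT0 : 0 < (T:ℝ) := by
    rcases Nat.eq_zero_or_pos T with h' | h'
    · rw [h', Nat.cast_zero, Real.log_zero] at hL; linarith
    · exact_mod_cast h'
  refine ⟨hL1, hT0, ?_, Real.one_le_rpow (by linarith) (by norm_num)⟩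
  have hTe : (T:ℝ) = Real.exp L := by rw [hL, Real.exp_log hT0]
  have := Real.pow_div_factorial_le_exp L hL00 7
  rw [← hTe] at this
  have e : L^7/(Nat.factorial 7) = L^6*(L/5040) := by norm_num [Nat.factorial]; ring
  rw [e] at this
  have h6 : 0 < L^6 := by positivity
  nlinarith

open Classical in
lemma good_e (T K : ℕ) (L : ℝ) (hT : 1 ≤ T) (hL : 100 ≤ L) (hTL : L^6 ≤ T) (hK : L^14 ≤ K) :
    ∑ p ∈ HH T, |∑ m ∈ Icc 1 K, psi (((p.1:ℝ)/p.2)^2*m)| ≤ 42*(T:ℝ)^2*K/L := by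
  have hL0 : 0 < L := by linarith
  have hK0 : (0:ℝ) ≤ K := Nat.cast_nonneg _
  have hTr : (1:ℝ) ≤ T := by exact_mod_cast hT
  set H := ⌈L^2⌉₊ with hH
  have hH1 : L^2 ≤ H := Nat.le_ceil _
  have hH2 : (H:ℝ) < L^2+1 := Nat.ceil_lt_add_one (by positivity)
  have hex := cnt_exc T H (1/L^6) (1/(2*L^12)) (by positivity) (by apply le_of_eq; field_simp)
  set P : ℕ × ℕ → Prop := fun p => ∃ h ∈ Icc 1 H, nd ((h:ℝ) * (((p.1:ℝ)/p.2)^2)) < 1/(2*L^12) with hP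
  rw [← sum_filter_add_sum_filter_not (HH T) P]
  have s1 : ∑ p ∈ (HH T).filter P, |∑ m ∈ Icc 1 K, psi (((p.1:ℝ)/p.2)^2*m)| ≤ (#((HH T).filter P):ℝ)*(K/2) := by
    refine (sum_le_sum fun p _ => psi_sum_triv K (((p.1:ℝ)/p.2)^2)).trans ?_
    simp
  have s2 : ∑ p ∈ (HH T).filter (fun p => ¬ P p), |∑ m ∈ Icc 1 K, psi (((p.1:ℝ)/p.2)^2*m)| ≤ (4*(T:ℝ)^2)*(9*K/L) := by
    have : ∀ p ∈ (HH T).filter (fun p => ¬ P p), |∑ m ∈ Icc 1 K, psi (((p.1:ℝ)/p.2)^2*m)| ≤ 9*K/L := by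
      intro p hp
      rw [mem_filter] at hp
      apply psi_sum_good K H _ L (by linarith) hH1 hK
      intro h hh
      by_contra hc
      push Not at hc
      exact hp.2 ⟨h, hh, hc⟩
    refine (sum_le_sum this).trans ?_
    rw [sum_const, nsmul_eq_mul]
    apply mul_le_mul_of_nonneg_right _ (by positivity)
    refine le_trans ?_ (card_HH T hT)
    exact_mod_cast card_le_card (filter_subset _ _)
  have hX : (#((HH T).filter P):ℝ) ≤ 12*(T:ℝ)^2/L := by
    have hex1 : (#((HH T).filter P):ℝ) ≤ H*(T*((1/L^6*T+1)*(H+1))) := by convert hex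
    refine hex1.trans ?_
    have hL2 : 1 ≤ L^2 := one_le_pow₀ (by linarith)
    have a1 : (H:ℝ) ≤ 2*L^2 := by linarith
    have a2 : (H:ℝ)+1 ≤ 3*L^2 := by linarith
    have a3 : 1/L^6*T+1 ≤ 2*(T/L^6) := by
      have : 1 ≤ T/L^6 := by rwa [le_div_iff₀ (by positivity), one_mul]
      have e : 1/L^6*T = T/L^6 := by ring
      linarith
    calc (H:ℝ)*(T*((1/L^6*T+1)*(H+1))) ≤ (2*L^2)*(T*((2*(T/L^6))*(3*L^2))) := by gcongr
      _ = 12*(T:ℝ)^2/L*(1/L) := by field_simp; norm_num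
      _ ≤ 12*(T:ℝ)^2/L*1 := by
        apply mul_le_mul_of_nonneg_left _ (by positivity)
        rw [div_le_one hL0]; linarith
      _ = _ := mul_one _
  have hX2 := mul_le_mul_of_nonneg_right hX (by positivity : (0:ℝ) ≤ K/2)
  have e : 42*(T:ℝ)^2*K/L = 12*(T:ℝ)^2/L*(K/2) + (4*(T:ℝ)^2)*(9*K/L) := by ring
  linarith

lemma triv_e (T K : ℕ) (hT : 1 ≤ T) :
    ∑ p ∈ HH T, |∑ m ∈ Icc 1 K, psi (((p.1:ℝ)/p.2)^2*m)| ≤ 2*(T:ℝ)^2*K := by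
  refine (sum_le_sum fun p _ => psi_sum_triv K (((p.1:ℝ)/p.2)^2)).trans ?_
  rw [sum_const, nsmul_eq_mul]
  have := mul_le_mul_of_nonneg_right (card_HH T hT) (by positivity : (0:ℝ) ≤ K/2)
  linarith

theorem R_est (T : ℕ) (L ℓ : ℝ) (hL : L = Real.log T) (hℓ : ℓ = Real.log L) (h : 110000 ≤ ℓ) :
    |∑ p ∈ HH T, Rx T (((p.1:ℝ)/p.2)^2)| ≤ 30*((T:ℝ)^3*ℓ) := by
  obtain ⟨hL1, hT0, hTL, -⟩ := basic_T T L ℓ hL hℓ h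
  have hT : 1 ≤ T := by exact_mod_cast hT0
  have hTr : (1:ℝ) ≤ T := by exact_mod_cast hT
  have hL0 : 0 < L := by linarith
  set f : ℕ → ℝ := fun e => ∑ p ∈ HH T, |∑ m ∈ Icc 1 (T/e), psi (((p.1:ℝ)/p.2)^2*m)| with hf
  have h1 : |∑ p ∈ HH T, Rx T (((p.1:ℝ)/p.2)^2)| ≤ ∑ e ∈ Ico 1 (T+1), f e := by
    refine (abs_sum_le_sum_abs _ _).trans ?_
    rw [hf, sum_comm]
    apply sum_le_sum
    intro p _
    rw [Rx_eq]
    refine (abs_sum_le_sum_abs _ _).trans (sum_le_sum ?_)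
    intro e _
    rw [abs_mul]
    exact mul_le_of_le_one_left (abs_nonneg _) (abs_mu_le e)
  refine h1.trans ?_
  set V := ⌊(T:ℝ)/(2*L^14)⌋₊ with hV
  have hL14 : 1 ≤ L^14 := one_le_pow₀ (by linarith)
  have hV1 : (V:ℝ) ≤ T/(2*L^14) := Nat.floor_le (by positivity)
  have hV2 : (T:ℝ)/(2*L^14) < V+1 := Nat.lt_floor_add_one _
  have hVT : V ≤ T := by
    have : (V:ℝ) ≤ T := hV1.trans (div_le_self hT0.le (by linarith))
    exact_mod_cast this
  rw [← sum_Ico_consecutive f (by omega : 1 ≤ V+1) (by omega : V+1 ≤ T+1)]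
  have lo : ∑ e ∈ Ico 1 (V+1), f e ≤ 84*(T:ℝ)^3 := by
    have : ∀ e ∈ Ico 1 (V+1), f e ≤ 42*(T:ℝ)^3/L*((1:ℝ)/e) := by
      intro e he
      simp only [mem_Ico] at he
      have he0 : (0:ℝ) < e := by exact_mod_cast he.1
      have heV : (e:ℝ) ≤ V := by exact_mod_cast (by omega : e ≤ V)
      have k1 : (T:ℝ)/e < (T/e : ℕ) + 1 := by
        have := Nat.lt_floor_add_one ((T:ℝ)/e)
        rwa [Nat.floor_div_eq_div] at this
      have k2 : 2*L^14 ≤ (T:ℝ)/e := by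
        rw [le_div_iff₀ he0]
        have := heV.trans hV1
        rw [le_div_iff₀ (by positivity)] at this
        linarith
      have g := good_e T (T/e) L hT (by linarith) hTL (by linarith)
      refine g.trans ?_
      have k3 : ((T/e : ℕ):ℝ) ≤ T/e := Nat.cast_div_le
      calc 42*(T:ℝ)^2*((T/e : ℕ):ℝ)/L ≤ 42*(T:ℝ)^2*(T/e)/L := by gcongr
        _ = _ := by ring
    refine (sum_le_sum this).trans ?_
    rw [← mul_sum]
    have k4 := sum_inv_le (V+1) (by omega)
    have k5 : Real.log ((V+1:ℕ):ℝ) ≤ L + 1 := by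
      have : ((V+1:ℕ):ℝ) ≤ T*Real.exp 1 := by
        have e1 := Real.add_one_le_exp (1:ℝ)
        have e2 : (V:ℝ) ≤ T := by exact_mod_cast hVT
        push_cast; nlinarith
      have := Real.log_le_log (by positivity) this
      rw [Real.log_mul (by positivity) (by positivity), Real.log_exp, ← hL] at this
      exact this
    calc 42*(T:ℝ)^3/L*∑ e ∈ Ico 1 (V+1), (1:ℝ)/e ≤ 42*(T:ℝ)^3/L*(2*L) := by
          apply mul_le_mul_of_nonneg_left _ (by positivity)
          linarith
      _ = _ := by field_simp; norm_num
  have hi : ∑ e ∈ Ico (V+1) (T+1), f e ≤ 2*(T:ℝ)^3*(2+14*ℓ) := by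
    have : ∀ e ∈ Ico (V+1) (T+1), f e ≤ 2*(T:ℝ)^3*((1:ℝ)/e) := by
      intro e he
      refine (triv_e T (T/e) hT).trans ?_
      have k3 : ((T/e : ℕ):ℝ) ≤ T/e := Nat.cast_div_le
      calc 2*(T:ℝ)^2*((T/e : ℕ):ℝ) ≤ 2*(T:ℝ)^2*(T/e) := by gcongr
        _ = _ := by ring
    refine (sum_le_sum this).trans ?_
    rw [← mul_sum]
    apply mul_le_mul_of_nonneg_left _ (by positivity)
    rcases Nat.lt_or_ge T (V+1) with hc | hc
    · rw [Ico_eq_empty (by omega)]; simp; linarith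
    refine (tail_inv (V+1) T (by omega) hc).trans ?_
    have h2 := Real.log_le_log (by positivity) hV2.le
    rw [Real.log_div (by positivity) (by positivity), Real.log_mul (by norm_num) (by positivity), Real.log_pow, ← hℓ] at h2
    have := Real.log_two_lt_d9
    push_cast at h2 ⊢
    linarith
  have : 0 < (T:ℝ)^3 := by positivity
  nlinarith

end VK

namespace VK

open Finset

lemma Phi_le (T : ℕ) : 0 ≤ Phi T ∧ Phi T ≤ (T:ℝ)^2 := by
  unfold Phi
  refine ⟨sum_nonneg fun _ _ => Nat.cast_nonneg _, ?_⟩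
  have : ∀ d ∈ Ico 1 (T+1), (Nat.totient d : ℝ) ≤ T := by
    intro d hd
    simp only [mem_Ico] at hd
    exact_mod_cast (Nat.totient_le d).trans (by omega)
  refine (sum_le_sum this).trans ?_
  simp [sq]

theorem large_T (T : ℕ) (L ℓ : ℝ) (hL : L = Real.log T) (hℓ : ℓ = Real.log L) (h : 110000 ≤ ℓ) :
    |(C T : ℝ) - 3 / (8 * Real.pi ^ 4) * (T : ℝ) ^ 4| ≤ 300*((T:ℝ)^3*(L^((2:ℝ)/3)*ℓ)) := by
  obtain ⟨hL1, hT0, hTL, hL23⟩ := basic_T T L ℓ hL hℓ h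
  have hT : 1 ≤ T := by exact_mod_cast hT0
  have hTr : (1:ℝ) ≤ T := by exact_mod_cast hT
  have hW := walfisz T L ℓ hL hℓ h
  have hR := R_est T L ℓ hL hℓ h
  have hP := Phi_est T hT _ hW
  have hG := G_est T hT
  have hC := C_formula T hT
  obtain ⟨hp0, hp1⟩ := Phi_le T
  have hH := card_HH T hT
  have hH0 : (0:ℝ) ≤ #(HH T) := Nat.cast_nonneg _
  have hYℓ : ℓ ≤ L^((2:ℝ)/3)*ℓ := le_mul_of_one_le_left (by linarith) hL23
  set Y := L^((2:ℝ)/3)*ℓ with hY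
  set c := 3/Real.pi^2 with hc
  have hc0 : 0 ≤ c := by positivity
  have hc1 : c ≤ 1 := by
    rw [hc, div_le_one (by positivity)]
    nlinarith [Real.pi_gt_three]
  have e : 3 / (8 * Real.pi ^ 4) = c^2/24 := by rw [hc]; field_simp; norm_num
  rw [e, hC]
  set g := ∑ p ∈ HH T, ((p.1:ℝ)/p.2)^2
  set R := ∑ p ∈ HH T, Rx T (((p.1:ℝ)/p.2)^2)
  have d : Phi T*g - (#(HH T):ℝ)*(1/2) - R - c^2/24*(T:ℝ)^4 =
      Phi T*(g - Phi T/24) + ((Phi T - c*(T:ℝ)^2)*((Phi T + c*(T:ℝ)^2)/24)) + (-((#(HH T):ℝ)*(1/2)) - R) := by ring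
  rw [d]
  have hT2 : 0 < (T:ℝ)^2 := by positivity
  have b1 : |Phi T*(g - Phi T/24)| ≤ (T:ℝ)^3 := by
    rw [abs_mul, abs_of_nonneg hp0]
    calc _ ≤ (T:ℝ)^2*T := mul_le_mul hp1 hG (abs_nonneg _) (by positivity)
      _ = _ := by ring
  have b2 : |(Phi T - c*(T:ℝ)^2)*((Phi T + c*(T:ℝ)^2)/24)| ≤ (T*(3000*Y)+T)*(2*(T:ℝ)^2/24) := by
    rw [abs_mul]
    apply mul_le_mul hP _ (abs_nonneg _) ((abs_nonneg _).trans hP)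
    have : 0 ≤ c*(T:ℝ)^2 := by positivity
    rw [abs_of_nonneg (by positivity)]
    have : c*(T:ℝ)^2 ≤ (T:ℝ)^2 := mul_le_of_le_one_left hT2.le hc1
    linarith
  have b3 : |-((#(HH T):ℝ)*(1/2)) - R| ≤ 2*(T:ℝ)^2 + 30*((T:ℝ)^3*ℓ) := by
    rw [abs_le] at *
    constructor <;> linarith
  have t := abs_add_three (Phi T*(g - Phi T/24)) ((Phi T - c*(T:ℝ)^2)*((Phi T + c*(T:ℝ)^2)/24)) (-((#(HH T):ℝ)*(1/2)) - R)
  refine t.trans ((add_le_add (add_le_add b1 b2) b3).trans ?_)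
  have u1 : (T:ℝ)^2 ≤ (T:ℝ)^3 := pow_le_pow_right₀ hTr (by norm_num)
  have hT3 : 0 < (T:ℝ)^3 := by positivity
  have u2 : (T:ℝ)^3*ℓ ≤ (T:ℝ)^3*Y := mul_le_mul_of_nonneg_left hYℓ hT3.le
  have u3 : (T:ℝ)^3*1 ≤ (T:ℝ)^3*Y := mul_le_mul_of_nonneg_left (by linarith) hT3.le
  have u4 : (T*(3000*Y)+T)*(2*(T:ℝ)^2/24) = 250*((T:ℝ)^3*Y) + (T:ℝ)^3/12 := by ring
  rw [u4]
  linarith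

lemma ge_sixteen (T : ℕ) (hT : 16 ≤ T) : 1 ≤ Real.log T ∧ 1 ≤ Real.log (Real.log T) := by
  have hTr : (16:ℝ) ≤ T := by exact_mod_cast hT
  have h1 := Real.log_le_log (by norm_num) hTr
  have h2 : Real.log 16 = 4*Real.log 2 := by
    rw [show (16:ℝ) = 2^4 by norm_num, Real.log_pow]; norm_num
  have h3 := Real.log_two_gt_d9
  have h4 : Real.exp 1 ≤ Real.log T := by
    have := Real.exp_one_lt_d9
    linarith
  refine ⟨by linarith, ?_⟩
  rw [Real.le_log_iff_exp_le (by linarith)]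
  exact h4

end VK

/-- Corollary 1.3: `C(T) = (3/(8π⁴))·T⁴ + O(T³·(log T)^{2/3}·(log log T)^{1+o(1)})`. -/
theorem CT_asymptotic :
    ∀ ε : ℝ, 0 < ε → ∃ K : ℝ, 0 < K ∧ ∀ T : ℕ, 16 ≤ T →
      |(C T : ℝ) - 3 / (8 * Real.pi ^ 4) * (T : ℝ) ^ 4| ≤
        K * (T : ℝ) ^ 3 * Real.log T ^ ((2 : ℝ) / 3)
          * Real.log (Real.log T) ^ (1 + ε) := by
  intro ε hε
  obtain ⟨N, hN⟩ := exists_nat_ge (Real.exp (Real.exp 110000))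
  set f : ℕ → ℝ := fun T => |(C T : ℝ) - 3 / (8 * Real.pi ^ 4) * (T : ℝ) ^ 4| with hf
  have hf0 : ∀ T, 0 ≤ f T := fun T => abs_nonneg _
  have hS0 : 0 ≤ ∑ t ∈ Finset.range N, f t := Finset.sum_nonneg fun t _ => hf0 t
  refine ⟨300 + ∑ t ∈ Finset.range N, f t, by linarith, ?_⟩
  intro T hT
  obtain ⟨h1, h2⟩ := VK.ge_sixteen T hT
  have hTr : (16:ℝ) ≤ T := by exact_mod_cast hT
  have hT3 : (1:ℝ) ≤ (T:ℝ)^3 := one_le_pow₀ (by linarith)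
  have hL : 1 ≤ Real.log T ^ ((2:ℝ)/3) := Real.one_le_rpow h1 (by norm_num)
  have hl : Real.log (Real.log T) ≤ Real.log (Real.log T) ^ (1+ε) := by
    have := Real.rpow_le_rpow_of_exponent_le h2 (by linarith : (1:ℝ) ≤ 1+ε)
    rwa [Real.rpow_one] at this
  have hl1 := h2.trans hl
  have hm : 1 ≤ (T:ℝ)^3 * (Real.log T ^ ((2:ℝ)/3) * Real.log (Real.log T) ^ (1+ε)) :=
    one_le_mul_of_one_le_of_one_le hT3 (one_le_mul_of_one_le_of_one_le hL hl1)
  have e : (300 + ∑ t ∈ Finset.range N, f t) * (T : ℝ) ^ 3 * Real.log T ^ ((2 : ℝ) / 3)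
          * Real.log (Real.log T) ^ (1 + ε) = (300 + ∑ t ∈ Finset.range N, f t) *
          ((T:ℝ)^3 * (Real.log T ^ ((2:ℝ)/3) * Real.log (Real.log T) ^ (1+ε))) := by ring
  rw [e]
  rcases Nat.lt_or_ge T N with hTN | hTN
  · have k1 : f T ≤ ∑ t ∈ Finset.range N, f t := Finset.single_le_sum (fun t _ => hf0 t) (Finset.mem_range.2 hTN)
    refine k1.trans ?_
    nlinarith
  · have k0 : Real.exp (Real.exp 110000) ≤ T := hN.trans (by exact_mod_cast hTN)
    have k1 : Real.exp 110000 ≤ Real.log T := by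
      rwa [Real.le_log_iff_exp_le (by linarith)]
    have k2 : 110000 ≤ Real.log (Real.log T) := by
      rwa [Real.le_log_iff_exp_le (by linarith)]
    refine (VK.large_T T _ _ rfl rfl k2).trans ?_
    have k3 : 300*((T:ℝ)^3*(Real.log T ^ ((2:ℝ)/3)*Real.log (Real.log T))) ≤
       300*((T:ℝ)^3*(Real.log T ^ ((2:ℝ)/3)*Real.log (Real.log T) ^ (1+ε))) := by gcongr
    refine k3.trans ?_
    apply mul_le_mul_of_nonneg_right _ (by linarith)
    linarith
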